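/- arXiv:2501.01065 — 5 statements merged into one kernel-verified Lean document; each statement's English description precedes it below -/
import Mathlib

section
/- Let m ≥ 1, let w_1,…,w_m ≥ 0 with ∑_{j=1}^m w_j = 1, let θ̂_1,…,θ̂_m ∈ ℝ, σ̂_1,…,σ̂_m > 0, and let k_1,…,k_m be positive integers. For θ ∈ ℝ set p_j(θ) = 2(1 − F_{k_j}(|θ̂_j − θ|/σ̂_j)) and S(θ) = ∑_{j=1}^m w_j · cot(π p_j(θ)/2). Then for every c ∈ ℝ the set {θ ∈ ℝ : S(θ) ≤ c} is convex (a possibly empty interval) and bounded. -/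
open MeasureTheory Real

/-- CDF of Student's t distribution with `k` degrees of freedom. -/
noncomputable def studentTCDF (k : ℕ) (x : ℝ) : ℝ :=
  ∫ t in Set.Iic x,
    Real.Gamma (((k : ℝ) + 1) / 2) / (Real.sqrt (k * π) * Real.Gamma ((k : ℝ) / 2)) *
      (1 + t ^ 2 / (k : ℝ)) ^ (-(((k : ℝ) + 1) / 2))


theorem cosat_pow (t : ℝ) (n : ℕ) :
    (1 + t ^ 2) ^ (-((n : ℝ) / 2)) = Real.cos (Real.arctan t) ^ n := by
  have h : (0:ℝ) < 1 + t ^ 2 := by positivity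
  rw [Real.cos_arctan, one_div, Real.sqrt_eq_rpow, ← Real.rpow_neg h.le, ← Real.rpow_natCast _ n,
    ← Real.rpow_mul h.le]
  congr 1; ring

theorem cosat_integrable (n : ℕ) (hn : 2 ≤ n) :
    Integrable (fun t : ℝ => Real.cos (Real.arctan t) ^ n) := by
  have h := integrable_rpow_neg_one_add_norm_sq (E := ℝ) (μ := volume) (r := n)
    (by simp; exact_mod_cast hn)
  refine h.congr (Filter.Eventually.of_forall fun t => ?_)
  simp only [Real.norm_eq_abs, sq_abs]
  rw [← cosat_pow, neg_div]

theorem cosat_deriv (n : ℕ) (t : ℝ) :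
    HasDerivAt (fun t : ℝ => Real.sin (Real.arctan t) * Real.cos (Real.arctan t) ^ n)
      ((n + 1) * Real.cos (Real.arctan t) ^ (n + 3) - n * Real.cos (Real.arctan t) ^ (n + 1)) t := by
  have ha := Real.hasDerivAt_arctan t
  have h := ha.sin.mul (ha.cos.pow n)
  refine h.congr_deriv ?_
  have h2 : 1 / (1 + t ^ 2) = Real.cos (Real.arctan t) ^ 2 := by
    rw [Real.cos_sq_arctan]
  have h3 := Real.sin_sq_add_cos_sq (Real.arctan t)
  rw [h2]
  set C := Real.cos (Real.arctan t)
  set S := Real.sin (Real.arctan t)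
  rcases n with _ | n
  · simp; ring
  · have : S ^ 2 = 1 - C ^ 2 := by linarith
    simp only [Nat.add_sub_cancel]
    push_cast
    simp only [Pi.pow_apply]
    change _ * C ^ (n + 1) + _ = _
    linear_combination (-((n:ℝ)+1) * C^(n+2)) * this

theorem cosat_rec (n : ℕ) (hn : 1 ≤ n) :
    (n + 1) * ∫ t : ℝ, Real.cos (Real.arctan t) ^ (n + 3) =
      n * ∫ t : ℝ, Real.cos (Real.arctan t) ^ (n + 1) := by
  have i1 := (cosat_integrable (n + 3) (by omega)).const_mul ((n:ℝ) + 1)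
  have i2 := (cosat_integrable (n + 1) (by omega)).const_mul (n:ℝ)
  have h := integral_of_hasDerivAt_of_tendsto (fun t => cosat_deriv n t) (i1.sub i2)
    (m := 0) (n := 0) ?_ ?_
  · rw [integral_sub i1 i2, integral_const_mul, integral_const_mul] at h
    linarith
  · have h1 := tendsto_nhds_of_tendsto_nhdsWithin Real.tendsto_arctan_atBot
    have h2 := ((Real.continuous_sin.mul (Real.continuous_cos.pow n)).tendsto (-(π/2))).comp h1
    simpa [Function.comp_def, show n ≠ 0 by omega] using h2
  · have h1 := tendsto_nhds_of_tendsto_nhdsWithin Real.tendsto_arctan_atTop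
    have h2 := ((Real.continuous_sin.mul (Real.continuous_cos.pow n)).tendsto ((π/2))).comp h1
    simpa [Function.comp_def, show n ≠ 0 by omega] using h2

theorem cosat_two : ∫ t : ℝ, Real.cos (Real.arctan t) ^ 2 = π := by
  rw [← integral_univ_inv_one_add_sq]
  simp [Real.cos_sq_arctan]

theorem cosat_three : ∫ t : ℝ, Real.cos (Real.arctan t) ^ 3 = 2 := by
  have h := integral_of_hasDerivAt_of_tendsto (fun t => cosat_deriv 0 t)
    (m := -1) (n := 1) ?_ ?_ ?_
  · norm_num at h; exact h
  · simpa using cosat_integrable 3 (by omega)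
  · have h1 := tendsto_nhds_of_tendsto_nhdsWithin Real.tendsto_arctan_atBot
    simpa [Function.comp_def] using (Real.continuous_sin.tendsto (-(π/2))).comp h1
  · have h1 := tendsto_nhds_of_tendsto_nhdsWithin Real.tendsto_arctan_atTop
    simpa [Function.comp_def] using (Real.continuous_sin.tendsto ((π/2))).comp h1

theorem cosat_gamma (k : ℕ) :
    Real.Gamma (((k+1:ℕ) + 1 : ℝ) / 2) * ∫ t : ℝ, Real.cos (Real.arctan t) ^ (k + 2)
      = Real.sqrt π * Real.Gamma (((k+1:ℕ) : ℝ) / 2) := by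
  induction k using Nat.twoStepInduction with
  | zero =>
    have := Real.mul_self_sqrt Real.pi_pos.le
    simp only [zero_add]
    rw [cosat_two]; norm_num
    rw [show (1:ℝ)/2 = 1/2 by rfl, Real.Gamma_one_half_eq]; linarith
  | one =>
    simp only [Nat.reduceAdd]
    rw [cosat_three]; norm_num
    rw [show (3:ℝ)/2 = 1/2 + 1 by norm_num, Real.Gamma_add_one (by norm_num),
      Real.Gamma_one_half_eq]; ring
  | more n ih _ =>
    have hr := cosat_rec (n+1) (by omega)
    have e1 : (((n+2+1:ℕ):ℝ) + 1) / 2 = (((n+1:ℕ):ℝ) + 1) / 2 + 1 := by push_cast; ring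
    have e2 : (((n+2+1:ℕ):ℝ)) / 2 = (((n+1:ℕ):ℝ)) / 2 + 1 := by push_cast; ring
    rw [e1, e2, Real.Gamma_add_one (by positivity), Real.Gamma_add_one (by positivity)]
    have e3 : n + 1 + 3 = n + 2 + 2 := by ring
    rw [e3] at hr
    linear_combination (Real.Gamma (((n+1:ℕ) + 1 : ℝ) / 2)/2) * hr + ((n+1:ℕ):ℝ)/2 * ih

noncomputable def tDens (k : ℕ) (t : ℝ) : ℝ :=
  Real.Gamma (((k : ℝ) + 1) / 2) / (Real.sqrt (k * π) * Real.Gamma ((k : ℝ) / 2)) *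
      (1 + t ^ 2 / (k : ℝ)) ^ (-(((k : ℝ) + 1) / 2))

theorem tDens_eq (k : ℕ) (t : ℝ) : tDens k t =
  Real.Gamma (((k : ℝ) + 1) / 2) / (Real.sqrt (k * π) * Real.Gamma ((k : ℝ) / 2)) *
      Real.cos (Real.arctan (t / Real.sqrt k)) ^ (k+1) := by
  unfold tDens
  rw [← cosat_pow, div_pow, Real.sq_sqrt (by positivity)]
  push_cast; rfl

theorem tDens_integrable (k : ℕ) (hk : 1 ≤ k) : Integrable (tDens k) := by
  have h : 0 < Real.sqrt k := Real.sqrt_pos.2 (by positivity)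
  have := ((cosat_integrable (k+1) (by omega)).comp_div h.ne').const_mul
    (Real.Gamma (((k : ℝ) + 1) / 2) / (Real.sqrt (k * π) * Real.Gamma ((k : ℝ) / 2)))
  exact this.congr (Filter.Eventually.of_forall fun t => (tDens_eq k t).symm)

theorem tDens_integral (k : ℕ) (hk : 1 ≤ k) : ∫ t, tDens k t = 1 := by
  have hk0 : (0:ℝ) < k := by positivity
  have h : 0 < Real.sqrt k := Real.sqrt_pos.2 hk0
  simp_rw [tDens_eq]
  rw [integral_const_mul,
    Measure.integral_comp_div (fun t => Real.cos (Real.arctan t) ^ (k+1)), abs_of_pos h]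
  obtain ⟨j, rfl⟩ : ∃ j, k = j + 1 := ⟨k - 1, by omega⟩
  have := cosat_gamma j
  have g2 : 0 < Real.Gamma (((j+1:ℕ) : ℝ) / 2) := Real.Gamma_pos_of_pos (by positivity)
  have g3 : 0 < Real.sqrt π := Real.sqrt_pos.2 Real.pi_pos
  rw [Real.sqrt_mul hk0.le, smul_eq_mul, div_mul_eq_mul_div, div_eq_one_iff_eq (by positivity)]
  linear_combination Real.sqrt ((j+1:ℕ):ℝ) * this

/-- If `D 0 = 0`, `D → 0`, and `D' = N * Q` with `Q > 0`, `N` antitone, then `D ≥ 0`. -/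
theorem unimodal_nonneg (D N Q : ℝ → ℝ) (h0 : D 0 = 0)
    (hlim : Filter.Tendsto D Filter.atTop (nhds 0))
    (hD : ∀ u, HasDerivAt D (N u * Q u) u) (hQ : ∀ u, 0 < Q u)
    (hN : AntitoneOn N (Set.Ici 0)) (u : ℝ) (hu : 0 ≤ u) : 0 ≤ D u := by
  by_contra! hneg
  have hu0 : 0 < u := lt_of_le_of_ne hu (by rintro rfl; linarith)
  have hc : Continuous D := continuous_iff_continuousAt.2 fun x => (hD x).continuousAt
  obtain ⟨v, ⟨hv0, hvu⟩, hv⟩ := exists_hasDerivAt_eq_slope D _ hu0 hc.continuousOn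
    (fun x _ => hD x)
  have hv' : N v * Q v < 0 := by
    rw [hv, h0]; apply div_neg_of_neg_of_pos <;> linarith
  have hNv : N v < 0 := by
    by_contra! hh; nlinarith [mul_nonneg hh (hQ v).le]
  have hanti : AntitoneOn D (Set.Ici u) := by
    apply antitoneOn_of_deriv_nonpos (convex_Ici u) hc.continuousOn
      (fun x _ => (hD x).differentiableAt.differentiableWithinAt)
    intro x hx
    rw [interior_Ici] at hx
    have hx' : u < x := hx
    rw [(hD x).deriv]
    have := hN (show (0:ℝ) ≤ v from hv0.le) (show (0:ℝ) ≤ x by linarith) (by linarith)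
    exact mul_nonpos_of_nonpos_of_nonneg (by linarith) (hQ x).le
  have : 0 ≤ D u := by
    refine le_of_tendsto hlim ?_
    filter_upwards [Filter.eventually_ge_atTop u] with x hx
    exact hanti (Set.mem_Ici.2 le_rfl) hx hx
  linarith

theorem P_deriv (κ : ℝ) (hκ : 1 ≤ κ) (u : ℝ) :
    HasDerivAt (fun u : ℝ => (1 + u ^ 2 / κ) ^ ((κ - 1) / 2))
      ((κ - 1) * u * (1 + u ^ 2 / κ) ^ ((κ - 1) / 2) / (κ * (1 + u ^ 2 / κ))) u := by
  have hv : (0:ℝ) < 1 + u ^ 2 / κ := by positivity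
  have h1 : HasDerivAt (fun u : ℝ => 1 + u ^ 2 / κ) (2 * u / κ) u := by
    simpa using ((hasDerivAt_pow 2 u).div_const κ).const_add 1
  refine (h1.rpow_const (p := (κ - 1) / 2) (Or.inl hv.ne')).congr_deriv ?_
  rw [Real.rpow_sub_one hv.ne']
  field_simp

theorem one_le_P (κ : ℝ) (hκ : 1 ≤ κ) (u : ℝ) : 1 ≤ (1 + u ^ 2 / κ) ^ ((κ - 1) / 2) := by
  apply Real.one_le_rpow
  · have : 0 ≤ u ^ 2 / κ := by positivity
    linarith
  · linarith


theorem core_arctan (κ c : ℝ) (hκ : 1 ≤ κ) (hc : 0 < c) (F : ℝ → ℝ)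
    (hF : ∀ u, HasDerivAt F (c / ((1 + u ^ 2 / κ) ^ ((κ - 1) / 2) * (1 + u ^ 2 / κ))) u)
    (hF0 : F 0 = 1 / 2) (hF1 : Filter.Tendsto F Filter.atTop (nhds 1)) (u : ℝ) (hu : 0 ≤ u) :
    Real.arctan ((κ + 1) / (2 * π * κ * c) * u * (1 + u ^ 2 / κ) ^ ((κ - 1) / 2)) ≤
      π * (F u - 1 / 2) := by
  have hpi := Real.pi_pos
  have hκ0 : 0 < κ := by linarith
  set A := (κ + 1) / (2 * π * κ * c) with hA
  have hA0 : 0 < A := by positivity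
  set P : ℝ → ℝ := fun u => (1 + u ^ 2 / κ) ^ ((κ - 1) / 2) with hP
  have hP1 : ∀ u, 1 ≤ P u := one_le_P κ hκ
  have hv0 : ∀ u : ℝ, 0 < 1 + u ^ 2 / κ := fun u => by positivity
  have key := unimodal_nonneg
    (fun u => π * (F u - 1 / 2) - Real.arctan (A * u * P u))
    (fun u => π * c / P u ^ 2 - A - A * (κ - 1) / (2 * κ) * u ^ 2)
    (fun u => P u / ((1 + u ^ 2 / κ) * (1 + (A * u * P u) ^ 2)))
    (by simp [hF0]) ?_ ?_ ?_ ?_ u hu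
  · simpa using key
  · have h1 : Filter.Tendsto (fun u => A * u * P u) Filter.atTop Filter.atTop := by
      refine Filter.tendsto_atTop_mono' _ ?_ (Filter.tendsto_id.const_mul_atTop hA0)
      filter_upwards [Filter.eventually_ge_atTop 0] with x hx
      exact le_mul_of_one_le_right (by simp only [id]; positivity) (hP1 x)
    have h2 := (tendsto_nhds_of_tendsto_nhdsWithin Real.tendsto_arctan_atTop).comp h1
    have h3 := ((hF1.sub_const (1/2)).const_mul π).sub h2
    have e : π * (1 - 1 / 2) - π / 2 = 0 := by ring
    rw [e] at h3
    exact h3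
  · intro u
    have hPu : 0 < P u := by linarith [hP1 u]
    have hv := hv0 u
    have hd := (((hF u).sub_const (1/2)).const_mul π).sub
      ((((hasDerivAt_id u).const_mul A).mul (P_deriv κ hκ u)).arctan)
    refine hd.congr_deriv ?_
    simp only [id]
    change π * (c / (P u * (1 + u ^ 2 / κ))) - 1 / (1 + (A * u * P u) ^ 2) *
      (A * 1 * P u + A * u * ((κ - 1) * u * P u / (κ * (1 + u ^ 2 / κ)))) = _
    have hcA : π * c * A = (κ + 1) / (2 * κ) := by rw [hA]; field_simp
    clear_value P A
    generalize hp : P u = p at *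
    have e1 : A * 1 * p + A * u * ((κ - 1) * u * p / (κ * (1 + u ^ 2 / κ))) =
        A * p * (1 + u ^ 2) / (1 + u ^ 2 / κ) := by
      have : κ + u ^ 2 ≠ 0 := by positivity
      field_simp
      ring
    have hR : 0 < 1 + (A * u * p) ^ 2 := by positivity
    rw [e1]
    have e2 : π * (c / (p * (1 + u ^ 2 / κ))) - 1 / (1 + (A * u * p) ^ 2) *
      (A * p * (1 + u ^ 2) / (1 + u ^ 2 / κ)) =
      (π * c * (1 + (A * u * p) ^ 2) / p ^ 2 - A * (1 + u ^ 2)) *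
        (p / ((1 + u ^ 2 / κ) * (1 + (A * u * p) ^ 2))) := by
      generalize 1 + (A * u * p) ^ 2 = R at *
      generalize 1 + u ^ 2 / κ = v at *
      field_simp
    rw [e2]
    congr 1
    have e3 : π * c * (1 + (A * u * p) ^ 2) / p ^ 2 =
        π * c / p ^ 2 + (π * c * A) * A * u ^ 2 := by field_simp
    rw [e3, hcA]
    field_simp
    ring
  · intro u
    have hPu : 0 < P u := by linarith [hP1 u]
    have hv := hv0 u
    positivity
  · intro x hx y hy hxy
    have hx : 0 ≤ x := hx
    have hPx : 0 < P x := by linarith [hP1 x]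
    have hxy2 : x ^ 2 ≤ y ^ 2 := by gcongr
    have hPxy : P x ≤ P y := by
      apply Real.rpow_le_rpow (hv0 x).le (by gcongr) (by linarith)
    have hκ1 : 0 ≤ κ - 1 := by linarith
    have a1 : π * c / P y ^ 2 ≤ π * c / P x ^ 2 := by gcongr
    have a2 : A * (κ - 1) / (2 * κ) * x ^ 2 ≤ A * (κ - 1) / (2 * κ) * y ^ 2 := by gcongr
    simp only
    linarith


theorem core_bounds (F f : ℝ → ℝ) (hF : ∀ u, HasDerivAt F (f u) u) (hf : ∀ u, 0 < f u)
    (hF1 : Filter.Tendsto F Filter.atTop (nhds 1)) :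
    StrictMono F ∧ ∀ u, F u < 1 := by
  have hm : StrictMono F := strictMono_of_hasDerivAt_pos hF hf
  refine ⟨hm, fun u => ?_⟩
  exact lt_of_lt_of_le (hm (lt_add_one u)) (hm.monotone.ge_of_tendsto hF1 _)

theorem core_convex (κ c : ℝ) (hκ : 1 ≤ κ) (hc : 0 < c) (F : ℝ → ℝ)
    (hF : ∀ u, HasDerivAt F (c / ((1 + u ^ 2 / κ) ^ ((κ - 1) / 2) * (1 + u ^ 2 / κ))) u)
    (hF0 : F 0 = 1 / 2) (hF1 : Filter.Tendsto F Filter.atTop (nhds 1)) :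
    ConvexOn ℝ (Set.Ici 0) (fun u => Real.tan (π * (F u - 1 / 2))) ∧
    MonotoneOn (fun u => Real.tan (π * (F u - 1 / 2))) (Set.Ici 0) ∧
    Filter.Tendsto (fun u => Real.tan (π * (F u - 1 / 2))) Filter.atTop Filter.atTop := by
  have hpi := Real.pi_pos
  have hκ0 : 0 < κ := by linarith
  have hv0 : ∀ u : ℝ, 0 < 1 + u ^ 2 / κ := fun u => by positivity
  have hP0 : ∀ u : ℝ, 0 < (1 + u ^ 2 / κ) ^ ((κ - 1) / 2) := fun u => by
    linarith [one_le_P κ hκ u]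
  obtain ⟨hm, hlt⟩ := core_bounds F _ hF (fun u => div_pos hc (mul_pos (hP0 u) (hv0 u))) hF1
  have hge : ∀ u, 0 ≤ u → 1 / 2 ≤ F u := fun u hu => hF0 ▸ hm.monotone hu
  have hup : ∀ u, π * (F u - 1 / 2) < π / 2 := fun u => by nlinarith [hlt u]
  have hlo : ∀ u, 0 ≤ u → 0 ≤ π * (F u - 1 / 2) := fun u hu =>
    mul_nonneg hpi.le (by linarith [hge u hu])
  have hcos : ∀ u, 0 ≤ u → 0 < Real.cos (π * (F u - 1 / 2)) := fun u hu =>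
    Real.cos_pos_of_mem_Ioo ⟨by linarith [hlo u hu], hup u⟩
  have harg : ∀ u, HasDerivAt (fun u => π * (F u - 1 / 2))
      (π * (c / ((1 + u ^ 2 / κ) ^ ((κ - 1) / 2) * (1 + u ^ 2 / κ)))) u :=
    fun u => ((hF u).sub_const (1/2)).const_mul π
  set g' : ℝ → ℝ := fun u => π * (c / ((1 + u ^ 2 / κ) ^ ((κ - 1) / 2) * (1 + u ^ 2 / κ))) /
    Real.cos (π * (F u - 1 / 2)) ^ 2 with hg'
  have hd1 : ∀ u, 0 ≤ u → HasDerivAt (fun u => Real.tan (π * (F u - 1 / 2))) (g' u) u := by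
    intro u hu
    have := (Real.hasDerivAt_tan (hcos u hu).ne').comp u (harg u)
    refine this.congr_deriv ?_
    simp only [hg']; ring
  have hcont : ContinuousOn (fun u => Real.tan (π * (F u - 1 / 2))) (Set.Ici 0) :=
    fun u hu => (hd1 u hu).continuousAt.continuousWithinAt
  refine ⟨?_, ?_, ?_⟩
  · have hd2 : ∀ u, 0 ≤ u → ∃ d, 0 ≤ d ∧ HasDerivAt g' d u := by
      intro u hu
      have hv : HasDerivAt (fun u : ℝ => 1 + u ^ 2 / κ) (2 * u / κ) u := by
        simpa using ((hasDerivAt_pow 2 u).div_const κ).const_add 1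
      have hnum := (((hasDerivAt_const u c).div ((P_deriv κ hκ u).mul hv)
        (mul_pos (hP0 u) (hv0 u)).ne')).const_mul π
      have hden := ((harg u).cos).pow 2
      have hh := hnum.div hden (pow_ne_zero 2 (hcos u hu).ne')
      refine ⟨_, ?_, hh⟩
      have htan : (κ + 1) / (2 * π * κ * c) * u * (1 + u ^ 2 / κ) ^ ((κ - 1) / 2) ≤
          Real.tan (π * (F u - 1 / 2)) := by
        have h1 := core_arctan κ c hκ hc F hF hF0 hF1 u hu
        rw [← Real.tan_arctan ((κ + 1) / (2 * π * κ * c) * u * (1 + u ^ 2 / κ) ^ ((κ - 1) / 2))]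
        exact Real.strictMonoOn_tan.monotoneOn
          ⟨Real.neg_pi_div_two_lt_arctan _, Real.arctan_lt_pi_div_two _⟩
          ⟨by linarith [hlo u hu], hup u⟩ h1
      rw [Real.tan_eq_sin_div_cos, le_div_iff₀ (hcos u hu)] at htan
      have hcu := hcos u hu
      have hPu := hP0 u
      have hvu := hv0 u
      simp only [Pi.mul_apply, Pi.pow_apply, Pi.div_apply]
      apply div_nonneg _ (by positivity)
      generalize Real.sin (π * (F u - 1 / 2)) = S at *
      generalize Real.cos (π * (F u - 1 / 2)) = C at *
      generalize (1 + u ^ 2 / κ) ^ ((κ - 1) / 2) = p at *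
      have e : (κ - 1) * u * p / (κ * (1 + u ^ 2 / κ)) * (1 + u ^ 2 / κ) + p * (2 * u / κ)
          = (κ + 1) * u * p / κ := by
        field_simp; ring
      rw [e]
      have : 0 ≤ 2 * π ^ 2 * c ^ 2 * C / (p ^ 2 * (1 + u ^ 2 / κ) ^ 2) *
        (S - (κ + 1) / (2 * π * κ * c) * u * p * C) := by
        apply mul_nonneg (by positivity) (by linarith)
      refine this.trans_eq ?_
      generalize 1 + u ^ 2 / κ = v at *
      simp only [Nat.cast_ofNat]
      field_simp
      ring
    have hde : ∀ u, 0 ≤ u → deriv (fun u => Real.tan (π * (F u - 1 / 2))) u = g' u :=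
      fun u hu => (hd1 u hu).deriv
    apply MonotoneOn.convexOn_of_deriv (convex_Ici 0) hcont
    · rw [interior_Ici]
      exact fun u hu => (hd1 u (le_of_lt hu)).differentiableAt.differentiableWithinAt
    · have hmono : MonotoneOn g' (Set.Ici 0) := by
        apply monotoneOn_of_deriv_nonneg (convex_Ici 0)
        · intro u hu
          obtain ⟨d, _, hd⟩ := hd2 u hu
          exact hd.continuousAt.continuousWithinAt
        · intro u hu
          rw [interior_Ici] at hu
          obtain ⟨d, _, hd⟩ := hd2 u (le_of_lt hu)
          exact hd.differentiableAt.differentiableWithinAt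
        · intro u hu
          rw [interior_Ici] at hu
          obtain ⟨d, h0, hd⟩ := hd2 u (le_of_lt hu)
          rw [hd.deriv]; exact h0
      rw [interior_Ici]
      intro x hx y hy hxy
      rw [hde x (le_of_lt hx), hde y (le_of_lt hy)]
      exact hmono (Set.mem_Ici.2 (le_of_lt hx)) (Set.mem_Ici.2 (le_of_lt hy)) hxy
  · intro x hx y hy hxy
    apply Real.strictMonoOn_tan.monotoneOn
      ⟨by linarith [hlo x hx], hup x⟩ ⟨by linarith [hlo y hy], hup y⟩
    have := hm.monotone hxy
    gcongr
  · apply Real.tendsto_tan_pi_div_two.comp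
    apply tendsto_nhdsWithin_of_tendsto_nhds_of_eventually_within
    · have h3 := ((hF1.sub_const (1/2)).const_mul π)
      have e : π * (1 - 1 / 2) = π / 2 := by ring
      rwa [e] at h3
    · exact Filter.Eventually.of_forall hup

theorem tCDF_facts (k : ℕ) (hk : 1 ≤ k) :
    (∀ u, HasDerivAt (studentTCDF k) (tDens k u) u) ∧ studentTCDF k 0 = 1 / 2 ∧
    Filter.Tendsto (studentTCDF k) Filter.atTop (nhds 1) := by
  have hi := tDens_integrable k hk
  have hI := tDens_integral k hk
  have hcont : Continuous (tDens k) := by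
    have : tDens k = fun t => Real.Gamma (((k : ℝ) + 1) / 2) /
        (Real.sqrt (k * π) * Real.Gamma ((k : ℝ) / 2)) *
        Real.cos (Real.arctan (t / Real.sqrt k)) ^ (k+1) := funext (tDens_eq k)
    rw [this]
    fun_prop
  have hdef : ∀ u, studentTCDF k u = ∫ t in Set.Iic u, tDens k t := fun u => rfl
  refine ⟨fun u => ?_, ?_, ?_⟩
  · have e : studentTCDF k = fun u => studentTCDF k 0 + ∫ t in (0:ℝ)..u, tDens k t := by
      funext u
      rw [← intervalIntegral.integral_Iic_sub_Iic hi.integrableOn hi.integrableOn, hdef, hdef]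
      ring
    rw [e]
    exact (intervalIntegral.integral_hasDerivAt_right (hcont.intervalIntegrable _ _)
      (hcont.stronglyMeasurableAtFilter _ _) hcont.continuousAt).const_add _
  · have h1 := intervalIntegral.integral_Iic_add_Ioi (b := (0:ℝ)) hi.integrableOn hi.integrableOn
    have h2 := integral_comp_neg_Iic (0:ℝ) (tDens k)
    have h3 : ∀ t, tDens k (-t) = tDens k t := fun t => by simp [tDens]
    simp only [h3, neg_zero] at h2
    rw [hdef]
    linarith
  · rw [← hI]
    exact (aecover_Iic Filter.tendsto_id).integral_tendsto_of_countably_generated hi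

theorem tScore_eq (x : ℝ) : Real.cot (π * (2 * (1 - x)) / 2) = Real.tan (π * (x - 1 / 2)) := by
  rw [← Real.tan_inv_eq_cot, ← Real.tan_pi_div_two_sub]
  congr 1; ring

theorem tScore_facts (k : ℕ) (hk : 1 ≤ k) :
    ConvexOn ℝ (Set.Ici 0) (fun u => Real.tan (π * (studentTCDF k u - 1 / 2))) ∧
    MonotoneOn (fun u => Real.tan (π * (studentTCDF k u - 1 / 2))) (Set.Ici 0) ∧
    Filter.Tendsto (fun u => Real.tan (π * (studentTCDF k u - 1 / 2)))
      Filter.atTop Filter.atTop := by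
  obtain ⟨h1, h2, h3⟩ := tCDF_facts k hk
  have hk1 : (1:ℝ) ≤ k := by exact_mod_cast hk
  have g1 : 0 < Real.Gamma (((k:ℝ) + 1) / 2) := Real.Gamma_pos_of_pos (by positivity)
  have g2 : 0 < Real.Gamma ((k : ℝ) / 2) := Real.Gamma_pos_of_pos (by positivity)
  have g3 : 0 < Real.sqrt (k * π) := Real.sqrt_pos.2 (by positivity)
  refine core_convex k _ hk1 (div_pos g1 (mul_pos g3 g2)) _ (fun u => ?_) h2 h3
  refine (h1 u).congr_deriv ?_
  have hv : (0:ℝ) < 1 + u ^ 2 / k := by positivity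
  unfold tDens
  rw [Real.rpow_neg hv.le, ← Real.rpow_add_one hv.ne',
    show ((k:ℝ) - 1) / 2 + 1 = ((k:ℝ) + 1) / 2 by ring, div_eq_mul_inv _ ((_ : ℝ) ^ (_ : ℝ))]

theorem tScore_convex (k : ℕ) (hk : 1 ≤ k) (a s : ℝ) (hs : 0 < s) :
    ConvexOn ℝ Set.univ
      (fun θ : ℝ => Real.tan (π * (studentTCDF k (|a - θ| / s) - 1 / 2))) := by
  obtain ⟨h1, h2, -⟩ := tScore_facts k hk
  refine ⟨convex_univ, fun x _ y _ α β hα hβ hαβ => ?_⟩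
  have hx : 0 ≤ |a - x| / s := by positivity
  have hy : 0 ≤ |a - y| / s := by positivity
  have hle : |a - (α • x + β • y)| / s ≤ α • (|a - x| / s) + β • (|a - y| / s) := by
    simp only [smul_eq_mul]
    have e : a - (α * x + β * y) = α * (a - x) + β * (a - y) := by
      linear_combination (-a) * hαβ
    have := abs_add_le (α * (a - x)) (β * (a - y))
    rw [abs_mul, abs_mul, abs_of_nonneg hα, abs_of_nonneg hβ, ← e] at this
    calc _ ≤ (α * |a - x| + β * |a - y|) / s := by gcongr
      _ = _ := by ring
  refine le_trans (h2 (Set.mem_Ici.2 (by positivity)) (Set.mem_Ici.2 ?_) hle)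
    (h1.2 hx hy hα hβ hαβ)
  simp only [smul_eq_mul]; positivity

/-- Theorem 2.1 (HCCT case): the sublevel sets of the Half-Cauchy combination test score
obtained from inverting two-sided t-tests are convex (possibly empty intervals) and bounded. -/
theorem hcct_confidence_set_convex_bounded
    (m : ℕ) (hm : 1 ≤ m) (w : Fin m → ℝ) (hw : ∀ j, 0 ≤ w j) (hwsum : ∑ j, w j = 1)
    (θhat : Fin m → ℝ) (σhat : Fin m → ℝ) (hσ : ∀ j, 0 < σhat j)
    (k : Fin m → ℕ) (hk : ∀ j, 1 ≤ k j) (c : ℝ) :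
    Convex ℝ {θ : ℝ | ∑ j, w j *
        Real.cot (π * (2 * (1 - studentTCDF (k j) (|θhat j - θ| / σhat j))) / 2) ≤ c} ∧
    Bornology.IsBounded {θ : ℝ | ∑ j, w j *
        Real.cot (π * (2 * (1 - studentTCDF (k j) (|θhat j - θ| / σhat j))) / 2) ≤ c} := by
  simp only [tScore_eq]
  constructor
  · have hconv : ConvexOn ℝ Set.univ (fun θ : ℝ => ∑ j, w j *
        Real.tan (π * (studentTCDF (k j) (|θhat j - θ| / σhat j) - 1 / 2))) := by
      refine ⟨convex_univ, fun x hx y hy α β hα hβ hαβ => ?_⟩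
      simp only [smul_eq_mul, Finset.mul_sum, ← Finset.sum_add_distrib]
      refine Finset.sum_le_sum fun j _ => ?_
      have := mul_le_mul_of_nonneg_left
        ((tScore_convex (k j) (hk j) (θhat j) (σhat j) (hσ j)).2 hx hy hα hβ hαβ) (hw j)
      simp only [smul_eq_mul] at this
      linarith
    simpa using hconv.convex_le c
  · obtain ⟨i, hi⟩ : ∃ i, 0 < w i := by
      by_contra! h
      have := Finset.sum_nonpos (s := Finset.univ) fun j _ => h j
      linarith
    have hnn : ∀ j θ, 0 ≤ w j *
        Real.tan (π * (studentTCDF (k j) (|θhat j - θ| / σhat j) - 1 / 2)) := by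
      intro j θ
      have hpos : 0 ≤ |θhat j - θ| / σhat j := div_nonneg (abs_nonneg _) (hσ j).le
      have h := (tScore_facts (k j) (hk j)).2.1 (Set.mem_Ici.2 le_rfl) (Set.mem_Ici.2 hpos) hpos
      simp only [(tCDF_facts (k j) (hk j)).2.1, sub_self, mul_zero, Real.tan_zero] at h
      exact mul_nonneg (hw j) h
    obtain ⟨M, hM⟩ := Filter.eventually_atTop.1
      ((tScore_facts (k i) (hk i)).2.2.eventually_gt_atTop (c / w i))
    refine (Metric.isBounded_closedBall (x := θhat i) (r := M * σhat i)).subset fun θ hθ => ?_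
    rw [Metric.mem_closedBall, dist_comm, Real.dist_eq]
    by_contra! hcon
    have h1 := hM (|θhat i - θ| / σhat i) ((le_div_iff₀ (hσ i)).2 hcon.le)
    rw [div_lt_iff₀' hi] at h1
    have h2 := Finset.single_le_sum (fun j _ => hnn j θ) (Finset.mem_univ i)
    have h3 : _ ≤ c := hθ
    linarith
end

section
/- Let m ≥ 1, let w_1,…,w_m ≥ 0 with ∑_{j=1}^m w_j = 1, let θ̂_1,…,θ̂_m ∈ ℝ, σ̂_1,…,σ̂_m > 0, and let k_1,…,k_m be positive integers. For θ ∈ ℝ set p_j(θ) = 2(1 − F_{k_j}(|θ̂_j − θ|/σ̂_j)) and S(θ) = ∑_{j=1}^m w_j / p_j(θ). Then for every c ∈ ℝ the set {θ ∈ ℝ : S(θ) ≤ c} is convex (a possibly empty interval) and bounded. -/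
open MeasureTheory Real

open Filter Topology

lemma st_int (r : ℝ) (hr : 1 < r) : Integrable (fun x : ℝ => (1 + x ^ 2) ^ (-(r / 2))) := by
  have h := integrable_rpow_neg_one_add_norm_sq (E := ℝ) (μ := volume) (r := r) (by simpa using hr)
  simpa [neg_div] using h

lemma st_hasDeriv_rpow (K s x : ℝ) (hK : 0 < K) :
    HasDerivAt (fun x : ℝ => (1 + x ^ 2 / K) ^ s) (s * (2 * x / K) * (1 + x ^ 2 / K) ^ (s - 1)) x := by
  have hq : 0 < 1 + x ^ 2 / K := by positivity
  have h1 : HasDerivAt (fun x : ℝ => 1 + x ^ 2 / K) (2 * x / K) x := by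
    have := ((hasDerivAt_pow 2 x).div_const K).const_add 1
    simpa using this
  have := h1.rpow_const (p := s) (Or.inl hq.ne')
  convert this using 1
  ring

lemma st_q_tendsto (l : Filter ℝ) (h : Tendsto (fun x : ℝ => x ^ 2) l atTop) (y : ℝ) (hy : 0 < y) :
    Tendsto (fun x : ℝ => (1 + x ^ 2) ^ (-y)) l (𝓝 0) :=
  (tendsto_rpow_neg_atTop hy).comp (tendsto_atTop_add_const_left _ 1 h)

lemma st_u_tendsto (l : Filter ℝ) (h : Tendsto (fun x : ℝ => x ^ 2) l atTop) (y : ℝ) (hy : 1 / 2 < y) :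
    Tendsto (fun x : ℝ => x * (1 + x ^ 2) ^ (-y)) l (𝓝 0) := by
  refine squeeze_zero_norm (fun x => ?_) (st_q_tendsto l h (y - 1 / 2) (by linarith))
  have hq : 0 < 1 + x ^ 2 := by positivity
  rw [norm_mul, Real.norm_of_nonneg (rpow_nonneg hq.le _), Real.norm_eq_abs]
  have h1 : -(y - 1 / 2) = 1 / 2 + -y := by ring
  rw [h1, rpow_add hq]
  gcongr
  rw [← Real.sqrt_eq_rpow]
  apply Real.abs_le_sqrt
  linarith

lemma st_sq_atTop : Tendsto (fun x : ℝ => x ^ 2) atTop atTop := tendsto_pow_atTop two_ne_zero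

lemma st_sq_atBot : Tendsto (fun x : ℝ => x ^ 2) atBot atTop := by
  have := st_sq_atTop.comp tendsto_neg_atBot_atTop
  simpa [Function.comp_def] using this

lemma st_rec (r : ℝ) (hr : 1 < r) :
    r * ∫ x : ℝ, (1 + x ^ 2) ^ (-((r + 2) / 2)) = (r - 1) * ∫ x : ℝ, (1 + x ^ 2) ^ (-(r / 2)) := by
  have hd : ∀ x : ℝ, HasDerivAt (fun x : ℝ => x * (1 + x ^ 2) ^ (-(r / 2)))
      (r * (1 + x ^ 2) ^ (-((r + 2) / 2)) - (r - 1) * (1 + x ^ 2) ^ (-(r / 2))) x := by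
    intro x
    have hq : 0 < 1 + x ^ 2 := by positivity
    have := (hasDerivAt_id x).mul (st_hasDeriv_rpow 1 (-(r / 2)) x one_pos)
    simp only [div_one, id] at this
    refine this.congr_deriv ?_
    have e1 : -(r / 2) = -((r + 2) / 2) + 1 := by ring
    have e2 : -(r / 2) - 1 = -((r + 2) / 2) := by ring
    rw [e2, e1, rpow_add_one hq.ne']
    ring
  have i1 := (st_int (r + 2) (by linarith)).const_mul r
  have i2 := (st_int r hr).const_mul (r - 1)
  have := integral_of_hasDerivAt_of_tendsto hd (i1.sub i2)
    (st_u_tendsto _ st_sq_atBot _ (by linarith)) (st_u_tendsto _ st_sq_atTop _ (by linarith))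
  rw [integral_sub i1 i2, integral_const_mul, integral_const_mul] at this
  linarith

lemma st_base2 : ∫ x : ℝ, (1 + x ^ 2) ^ (-((3 : ℝ) / 2)) = 2 := by
  have hd : ∀ x : ℝ, HasDerivAt (fun x : ℝ => Real.sin (Real.arctan x))
      ((1 + x ^ 2) ^ (-((3 : ℝ) / 2))) x := by
    intro x
    have hq : 0 < 1 + x ^ 2 := by positivity
    have := (Real.hasDerivAt_arctan x).sin
    convert this using 1
    rw [Real.cos_arctan]
    have e : -((3 : ℝ) / 2) = -(1 / 2) + -1 := by norm_num
    rw [e, rpow_add hq, rpow_neg_one, rpow_neg hq.le, ← Real.sqrt_eq_rpow]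
    simp
  have hT : Tendsto (fun x : ℝ => Real.sin (Real.arctan x)) atTop (𝓝 1) := by
    have := (Real.continuous_sin.tendsto (π / 2)).comp
      (tendsto_nhds_of_tendsto_nhdsWithin Real.tendsto_arctan_atTop)
    simpa [Function.comp_def] using this
  have hB : Tendsto (fun x : ℝ => Real.sin (Real.arctan x)) atBot (𝓝 (-1)) := by
    have := (Real.continuous_sin.tendsto (-(π / 2))).comp
      (tendsto_nhds_of_tendsto_nhdsWithin Real.tendsto_arctan_atBot)
    simpa [Function.comp_def] using this
  have := integral_of_hasDerivAt_of_tendsto hd (st_int 3 (by norm_num)) hB hT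
  rw [this]; norm_num

lemma st_total (n : ℕ) : ∫ x : ℝ, (1 + x ^ 2) ^ (-((((n + 1 : ℕ) : ℝ) + 1) / 2)) =
    √π * Gamma (((n + 1 : ℕ) : ℝ) / 2) / Gamma ((((n + 1 : ℕ) : ℝ) + 1) / 2) := by
  induction n using Nat.twoStepInduction with
  | zero =>
    have e : -((((0 + 1 : ℕ) : ℝ) + 1) / 2) = -1 := by norm_num
    have e2 : ((((0 + 1 : ℕ) : ℝ) + 1) / 2) = 1 := by norm_num
    have e3 : ((((0 + 1 : ℕ) : ℝ)) / 2) = 1 / 2 := by norm_num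
    rw [e, e2, e3, Real.Gamma_one_half_eq, Real.Gamma_one]
    simp_rw [rpow_neg_one]
    rw [integral_univ_inv_one_add_sq, Real.mul_self_sqrt pi_pos.le, div_one]
  | one =>
    have e2 : ((((1 + 1 : ℕ) : ℝ) + 1) / 2) = 3 / 2 := by norm_num
    have e3 : ((((1 + 1 : ℕ) : ℝ)) / 2) = 1 := by norm_num
    have e4 : (3 : ℝ) / 2 = 1 / 2 + 1 := by norm_num
    rw [e2, e3, st_base2, e4, Real.Gamma_add_one (by norm_num), Real.Gamma_one_half_eq,
      Real.Gamma_one]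
    have : √π ≠ 0 := (Real.sqrt_pos.2 pi_pos).ne'
    field_simp
  | more n ih _ =>
    have hr := st_rec (((n + 1 : ℕ) : ℝ) + 1) (by push_cast; linarith [(Nat.cast_nonneg n : (0:ℝ) ≤ n)])
    rw [ih] at hr
    have e1 : (((n + 2 + 1 : ℕ) : ℝ) + 1) / 2 = (((n + 1 : ℕ) : ℝ) + 1) / 2 + 1 := by
      push_cast; ring
    have e2 : (((n + 2 + 1 : ℕ) : ℝ)) / 2 = (((n + 1 : ℕ) : ℝ)) / 2 + 1 := by
      push_cast; ring
    have e3 : ((((n + 1 : ℕ) : ℝ) + 1) + 2) / 2 = (((n + 1 : ℕ) : ℝ) + 1) / 2 + 1 := by ring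
    rw [e3] at hr
    have hp : 0 < ((n + 1 : ℕ) : ℝ) := by positivity
    generalize ((n + 1 : ℕ) : ℝ) = y at *
    rw [e1, e2, Real.Gamma_add_one (by positivity), Real.Gamma_add_one (by positivity)]
    have g1 : 0 < Gamma ((y + 1) / 2) := Real.Gamma_pos_of_pos (by positivity)
    have hy : y + 1 ≠ 0 := by positivity
    apply mul_left_cancel₀ hy
    rw [hr]
    field_simp
    ring

/-- The density. -/
noncomputable def stC (k : ℕ) : ℝ :=
  Real.Gamma (((k : ℝ) + 1) / 2) / (Real.sqrt (k * π) * Real.Gamma ((k : ℝ) / 2))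

noncomputable def stf (k : ℕ) (t : ℝ) : ℝ :=
  stC k * (1 + t ^ 2 / (k : ℝ)) ^ (-(((k : ℝ) + 1) / 2))

lemma stC_pos {k : ℕ} (hk : 1 ≤ k) : 0 < stC k := by
  have : (0 : ℝ) < k := by exact_mod_cast hk
  have g1 : 0 < Gamma (((k : ℝ) + 1) / 2) := Real.Gamma_pos_of_pos (by positivity)
  have g2 : 0 < Gamma ((k : ℝ) / 2) := Real.Gamma_pos_of_pos (by positivity)
  have := pi_pos
  unfold stC
  positivity

lemma stf_pos {k : ℕ} (hk : 1 ≤ k) (t : ℝ) : 0 < stf k t :=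
  mul_pos (stC_pos hk) (by positivity)

lemma stf_scale {k : ℕ} : stf k =
    fun t => stC k * (fun u : ℝ => (1 + u ^ 2) ^ (-(((k : ℝ) + 1) / 2))) (t / √(k : ℝ)) := by
  funext t
  simp only [stf, div_pow, Real.sq_sqrt (Nat.cast_nonneg k)]

lemma stf_int {k : ℕ} (hk : 1 ≤ k) : Integrable (stf k) := by
  have h0 : (0 : ℝ) < k := by exact_mod_cast hk
  rw [stf_scale]
  exact ((st_int ((k : ℝ) + 1) (by linarith)).comp_div (Real.sqrt_pos.2 h0).ne').const_mul _

lemma stf_total {k : ℕ} (hk : 1 ≤ k) : ∫ t, stf k t = 1 := by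
  have h0 : (0 : ℝ) < k := by exact_mod_cast hk
  obtain ⟨n, rfl⟩ : ∃ n, k = n + 1 := ⟨k - 1, by omega⟩
  rw [stf_scale, integral_const_mul,
    Measure.integral_comp_div (fun u : ℝ => (1 + u ^ 2) ^ (-((((n + 1 : ℕ) : ℝ) + 1) / 2))),
    st_total, stC]
  generalize ((n + 1 : ℕ) : ℝ) = y at *
  have g1 : 0 < Gamma ((y + 1) / 2) := Real.Gamma_pos_of_pos (by positivity)
  have g2 : 0 < Gamma (y / 2) := Real.Gamma_pos_of_pos (by positivity)
  have s1 := Real.sqrt_pos.2 h0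
  have s2 := Real.sqrt_pos.2 pi_pos
  rw [abs_of_pos s1, Real.sqrt_mul h0.le, smul_eq_mul]
  field_simp

lemma stf_deriv {k : ℕ} (hk : 1 ≤ k) (x : ℝ) : HasDerivAt (stf k)
    (stC k * (-(((k : ℝ) + 1) / 2) * (2 * x / k) *
      (1 + x ^ 2 / k) ^ (-(((k : ℝ) + 1) / 2) - 1))) x :=
  (st_hasDeriv_rpow k _ x (by exact_mod_cast hk)).const_mul _

lemma stf_cont {k : ℕ} (hk : 1 ≤ k) : Continuous (stf k) :=
  continuous_iff_continuousAt.2 fun x => (stf_deriv hk x).continuousAt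

lemma stF_eq (k : ℕ) (x : ℝ) : studentTCDF k x = ∫ t in Set.Iic x, stf k t := rfl

noncomputable def stG (k : ℕ) (x : ℝ) : ℝ := 1 - studentTCDF k x

lemma stG_deriv {k : ℕ} (hk : 1 ≤ k) (x : ℝ) : HasDerivAt (stG k) (-stf k x) x := by
  have hc := stf_cont hk
  have h1 : HasDerivAt (fun u => ∫ t in (0 : ℝ)..u, stf k t) (stf k x) x :=
    intervalIntegral.integral_hasDerivAt_right (hc.intervalIntegrable _ _)
      (hc.stronglyMeasurableAtFilter _ _) hc.continuousAt
  have h2 : stG k = fun u => (1 - studentTCDF k 0) - ∫ t in (0 : ℝ)..u, stf k t := by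
    funext u
    rw [← intervalIntegral.integral_Iic_sub_Iic (stf_int hk).integrableOn
      (stf_int hk).integrableOn, stG, stF_eq, stF_eq]
    ring
  rw [h2]
  exact h1.const_sub _

lemma stG_tendsto {k : ℕ} (hk : 1 ≤ k) : Tendsto (stG k) atTop (𝓝 0) := by
  have := (aecover_Iic (μ := volume) (tendsto_id (α := ℝ) (x := atTop))).integral_tendsto_of_countably_generated
    (stf_int hk)
  rw [stf_total hk] at this
  have h2 := this.const_sub 1
  rw [sub_self] at h2
  exact h2

lemma stG_anti {k : ℕ} (hk : 1 ≤ k) : StrictAnti (stG k) :=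
  strictAnti_of_deriv_neg fun x => by
    rw [(stG_deriv hk x).deriv]; linarith [stf_pos hk x]

lemma stG_pos {k : ℕ} (hk : 1 ≤ k) (x : ℝ) : 0 < stG k x :=
  lt_of_le_of_lt ((stG_anti hk).antitone.le_of_tendsto (stG_tendsto hk) (x + 1))
    (stG_anti hk (by linarith))

lemma stG_le {k : ℕ} (hk : 1 ≤ k) {x : ℝ} (hx : 0 < x) :
    stG k x ≤ stC k * (k / (((k : ℝ) + 1) / 2)) *
      (x⁻¹ * (1 + x ^ 2 / k) ^ (1 - ((k : ℝ) + 1) / 2)) := by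
  have h1 : (1 : ℝ) ≤ k := by exact_mod_cast hk
  have h0 : (0 : ℝ) < k := by linarith
  have hC := stC_pos hk
  set A := stC k * (k / (((k : ℝ) + 1) / 2)) with hA
  have hA0 : 0 < A := by positivity
  set B : ℝ → ℝ := fun x => A * (x⁻¹ * (1 + x ^ 2 / k) ^ (1 - ((k : ℝ) + 1) / 2)) with hB
  have hd : ∀ y : ℝ, 0 < y → HasDerivAt (fun y => B y - stG k y)
      (A * (-(y ^ 2)⁻¹ * (1 + y ^ 2 / k) ^ (1 - ((k : ℝ) + 1) / 2) +
        y⁻¹ * ((1 - ((k : ℝ) + 1) / 2) * (2 * y / k) *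
          (1 + y ^ 2 / k) ^ (1 - ((k : ℝ) + 1) / 2 - 1))) - -stf k y) y := fun y hy =>
    (((hasDerivAt_inv hy.ne').mul (st_hasDeriv_rpow k _ y h0)).const_mul A).sub (stG_deriv hk y)
  have hle : ∀ y : ℝ, 0 < y → deriv (fun y => B y - stG k y) y ≤ 0 := by
    intro y hy
    rw [(hd y hy).deriv]
    have hq : 0 < 1 + y ^ 2 / (k : ℝ) := by positivity
    have e1 : 1 - ((k : ℝ) + 1) / 2 = -(((k : ℝ) + 1) / 2) + 1 := by ring
    have e2 : 1 - ((k : ℝ) + 1) / 2 - 1 = -(((k : ℝ) + 1) / 2) := by ring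
    rw [e2, stf, e1, rpow_add_one hq.ne', hA]
    have hP : 0 < (1 + y ^ 2 / (k : ℝ)) ^ (-(((k : ℝ) + 1) / 2)) := rpow_pos_of_pos hq _
    generalize (1 + y ^ 2 / (k : ℝ)) ^ (-(((k : ℝ) + 1) / 2)) = P at *
    have : stC k * (k / (((k : ℝ) + 1) / 2)) * (-(y ^ 2)⁻¹ * (P * (1 + y ^ 2 / (k : ℝ))) +
        y⁻¹ * ((-(((k : ℝ) + 1) / 2) + 1) * (2 * y / k) * P)) - -(stC k * P)
        = - (stC k * P * ((2 * k / y ^ 2 + (k - 1)) / (k + 1))) := by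
      field_simp
      ring
    rw [this]
    have : 0 ≤ (k : ℝ) - 1 := by linarith
    rw [neg_nonpos]
    positivity
  have hanti : AntitoneOn (fun y => B y - stG k y) (Set.Ioi 0) := by
    apply antitoneOn_of_deriv_nonpos (convex_Ioi 0)
    · exact fun y hy => (hd y hy).continuousAt.continuousWithinAt
    · rw [interior_Ioi]
      exact fun y hy => (hd y hy).differentiableAt.differentiableWithinAt
    · rw [interior_Ioi]
      exact fun y hy => hle y hy
  have hBlim : Tendsto B atTop (𝓝 0) := by
    have hi : Tendsto (fun y : ℝ => A * y⁻¹) atTop (𝓝 0) := by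
      simpa using tendsto_inv_atTop_zero.const_mul A
    refine tendsto_of_tendsto_of_tendsto_of_le_of_le' tendsto_const_nhds hi ?_ ?_
    · filter_upwards [eventually_gt_atTop 0] with y hy
      positivity
    · filter_upwards [eventually_gt_atTop 0] with y hy
      have : (1 + y ^ 2 / (k : ℝ)) ^ (1 - ((k : ℝ) + 1) / 2) ≤ 1 :=
        rpow_le_one_of_one_le_of_nonpos (by have : 0 ≤ y ^ 2 / (k : ℝ) := by positivity
                                            linarith) (by linarith)
      have h3 : y⁻¹ * (1 + y ^ 2 / (k : ℝ)) ^ (1 - ((k : ℝ) + 1) / 2) ≤ y⁻¹ :=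
        mul_le_of_le_one_right (by positivity) this
      exact mul_le_mul_of_nonneg_left h3 hA0.le
  have hlim : Tendsto (fun y => B y - stG k y) atTop (𝓝 0) := by
    simpa using hBlim.sub (stG_tendsto hk)
  have : 0 ≤ B x - stG k x := by
    refine le_of_tendsto hlim ?_
    filter_upwards [eventually_ge_atTop x] with y hy
    exact hanti hx (lt_of_lt_of_le hx hy) hy
  linarith

lemma st_key {k : ℕ} (hk : 1 ≤ k) (x : ℝ) :
    0 ≤ (stC k * (-(((k : ℝ) + 1) / 2) * (2 * x / k) *
      (1 + x ^ 2 / k) ^ (-(((k : ℝ) + 1) / 2) - 1))) * stG k x + 2 * stf k x ^ 2 := by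
  have h0 : (0 : ℝ) < k := by exact_mod_cast hk
  have hC := stC_pos hk
  have hG := stG_pos hk x
  have hq : 0 < 1 + x ^ 2 / (k : ℝ) := by positivity
  rcases le_or_gt x 0 with hx | hx
  · have : 0 ≤ (stC k * ((((k : ℝ) + 1) / 2) * (2 * (-x) / k) *
      (1 + x ^ 2 / k) ^ (-(((k : ℝ) + 1) / 2) - 1))) * stG k x := by
      have : 0 ≤ -x := by linarith
      positivity
    have h2 := sq_nonneg (stf k x)
    have e : ∀ a b c d e : ℝ, a * (-b * (2 * x / c) * d) * e = a * (b * (2 * (-x) / c) * d) * e := by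
      intros; ring
    rw [e]
    linarith
  · have hle := stG_le hk hx
    have e1 : 1 - ((k : ℝ) + 1) / 2 = -(((k : ℝ) + 1) / 2) + 1 := by ring
    rw [e1, rpow_add_one hq.ne'] at hle
    rw [rpow_sub_one hq.ne', stf]
    have hP : 0 < (1 + x ^ 2 / (k : ℝ)) ^ (-(((k : ℝ) + 1) / 2)) := rpow_pos_of_pos hq _
    generalize (1 + x ^ 2 / (k : ℝ)) ^ (-(((k : ℝ) + 1) / 2)) = P at *
    generalize 1 + x ^ 2 / (k : ℝ) = Q at *
    have hM : 0 ≤ stC k * ((((k : ℝ) + 1) / 2) * (2 * x / k) * (P / Q)) := by positivity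
    have h2 := mul_le_mul_of_nonneg_left hle hM
    have e : stC k * ((((k : ℝ) + 1) / 2) * (2 * x / k) * (P / Q)) *
        (stC k * (k / (((k : ℝ) + 1) / 2)) * (x⁻¹ * (P * Q))) = 2 * (stC k * P) ^ 2 := by
      field_simp
    rw [e] at h2
    linarith

lemma st_inv_deriv {k : ℕ} (hk : 1 ≤ k) (x : ℝ) :
    HasDerivAt (fun x => (stG k x)⁻¹) (stf k x / stG k x ^ 2) x := by
  refine ((stG_deriv hk x).inv (stG_pos hk x).ne').congr_deriv ?_
  rw [neg_neg]

lemma st_inv_convex {k : ℕ} (hk : 1 ≤ k) : ConvexOn ℝ Set.univ (fun x => (stG k x)⁻¹) := by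
  apply Monotone.convexOn_univ_of_deriv
  · exact fun x => (st_inv_deriv hk x).differentiableAt
  · have : deriv (fun x => (stG k x)⁻¹) = fun x => stf k x / stG k x ^ 2 :=
      funext fun x => (st_inv_deriv hk x).deriv
    rw [this]
    have hd := fun x => (stf_deriv hk x).div ((stG_deriv hk x).pow 2)
      (pow_ne_zero 2 (stG_pos hk x).ne')
    apply monotone_of_deriv_nonneg
    · exact fun x => (hd x).differentiableAt
    · intro x
      have h1 := (hd x).deriv
      have hG := stG_pos hk x
      have h2 := st_key hk x
      refine le_of_le_of_eq ?_ h1.symm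
      apply div_nonneg _ (by positivity)
      have := mul_nonneg hG.le h2
      simp only [Pi.pow_apply]
      norm_num
      nlinarith

lemma st_inv_mono {k : ℕ} (hk : 1 ≤ k) : Monotone (fun x => (stG k x)⁻¹) := fun x y h =>
  inv_anti₀ (stG_pos hk y) ((stG_anti hk).antitone h)

lemma st_inv_tendsto {k : ℕ} (hk : 1 ≤ k) : Tendsto (fun x => (stG k x)⁻¹) atTop atTop :=
  tendsto_inv_nhdsGT_zero.comp (tendsto_nhdsWithin_iff.2
    ⟨stG_tendsto hk, Eventually.of_forall fun x => stG_pos hk x⟩)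

lemma st_abs_convex (a s : ℝ) (hs : 0 < s) : ConvexOn ℝ Set.univ (fun x : ℝ => |a - x| / s) := by
  refine ⟨convex_univ, fun x _ y _ u v hu hv huv => ?_⟩
  simp only [smul_eq_mul]
  have : a - (u * x + v * y) = u * (a - x) + v * (a - y) := by
    have : a = (u + v) * a := by rw [huv, one_mul]
    linear_combination this
  rw [this, ← mul_div_assoc, ← mul_div_assoc, ← add_div]
  gcongr
  refine (abs_add_le _ _).trans ?_
  rw [abs_mul, abs_mul, abs_of_nonneg hu, abs_of_nonneg hv]


/-- Theorem 2.1 (EHMP case): the sublevel sets of the exact harmonic mean p-value score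
obtained from inverting two-sided t-tests are convex (possibly empty intervals) and bounded. -/
theorem ehmp_confidence_set_convex_bounded
    (m : ℕ) (hm : 1 ≤ m) (w : Fin m → ℝ) (hw : ∀ j, 0 ≤ w j) (hwsum : ∑ j, w j = 1)
    (θhat : Fin m → ℝ) (σhat : Fin m → ℝ) (hσ : ∀ j, 0 < σhat j)
    (k : Fin m → ℕ) (hk : ∀ j, 1 ≤ k j) (c : ℝ) :
    Convex ℝ {θ : ℝ | ∑ j, w j /
        (2 * (1 - studentTCDF (k j) (|θhat j - θ| / σhat j))) ≤ c} ∧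
    Bornology.IsBounded {θ : ℝ | ∑ j, w j /
        (2 * (1 - studentTCDF (k j) (|θhat j - θ| / σhat j))) ≤ c} := by
  have himg : ∀ j, Convex ℝ ((fun x : ℝ => |θhat j - x| / σhat j) '' Set.univ) := by
    intro j
    have hpc : IsPreconnected ((fun x : ℝ => |θhat j - x| / σhat j) '' Set.univ) :=
      isPreconnected_univ.image _ (by fun_prop)
    exact hpc.ordConnected.convex
  have hterm : ∀ j θ, w j / (2 * (1 - studentTCDF (k j) (|θhat j - θ| / σhat j))) =
      (w j / 2) * (stG (k j) (|θhat j - θ| / σhat j))⁻¹ := by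
    intro j θ
    rw [div_mul_eq_div_div, div_eq_mul_inv]
    rfl
  simp only [hterm]
  have hconv : ∀ j, ConvexOn ℝ Set.univ
      (fun θ => (w j / 2) * (stG (k j) (|θhat j - θ| / σhat j))⁻¹) := by
    intro j
    have hc := ConvexOn.comp (s := Set.univ) (f := fun x : ℝ => |θhat j - x| / σhat j)
      (g := fun x => (stG (k j) x)⁻¹)
      ((st_inv_convex (hk j)).subset (Set.subset_univ _) (himg j))
      (st_abs_convex (θhat j) (σhat j) (hσ j)) ((st_inv_mono (hk j)).monotoneOn _)
    exact hc.smul (div_nonneg (hw j) zero_le_two)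
  constructor
  · have hs : ConvexOn ℝ Set.univ
        (fun θ => ∑ j, (w j / 2) * (stG (k j) (|θhat j - θ| / σhat j))⁻¹) := by
      refine ⟨convex_univ, fun x hx y hy u v hu hv huv => ?_⟩
      simp only [smul_eq_mul, Finset.mul_sum, ← Finset.sum_add_distrib]
      exact Finset.sum_le_sum fun j _ => (hconv j).2 hx hy hu hv huv
    simpa using hs.convex_le c
  · obtain ⟨j, -, hj⟩ : ∃ j ∈ Finset.univ, 0 < w j := by
      apply Finset.exists_lt_of_sum_lt
      simp [hwsum]
    obtain ⟨X, hX⟩ := ((st_inv_tendsto (hk j)).eventually_gt_atTop (c / (w j / 2))).exists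
    refine (Metric.isBounded_closedBall (x := θhat j) (r := X * σhat j)).subset fun θ hθ => ?_
    rw [Metric.mem_closedBall, dist_comm, Real.dist_eq]
    by_contra hcon
    push Not at hcon
    have h1 : X ≤ |θhat j - θ| / σhat j := by
      rw [le_div_iff₀ (hσ j)]; exact hcon.le
    have h2 : c / (w j / 2) < (stG (k j) (|θhat j - θ| / σhat j))⁻¹ :=
      lt_of_lt_of_le hX (st_inv_mono (hk j) h1)
    rw [div_lt_iff₀' (by positivity)] at h2
    have h3 := Finset.single_le_sum
      (f := fun j => (w j / 2) * (stG (k j) (|θhat j - θ| / σhat j))⁻¹)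
      (fun i _ => mul_nonneg (div_nonneg (hw i) zero_le_two) (inv_nonneg.2 (stG_pos (hk i) _).le))
      (Finset.mem_univ j)
    have h4 : ∑ j, (w j / 2) * (stG (k j) (|θhat j - θ| / σhat j))⁻¹ ≤ c := hθ
    linarith
end

section
/- Let d ≥ 1 and m ≥ 1. For each j = 1,…,m let d_j be an integer with 1 ≤ d_j ≤ d, let k_j be an integer with k_j ≥ d_j + 1, let P_j be a real d_j × d matrix of rank d_j, let ξ̂_j ∈ ℝ^{d_j}, let Σ̂_j be a symmetric positive definite d_j × d_j real matrix, and let w_j ≥ 0 with ∑_{j=1}^m w_j = 1. For θ ∈ ℝ^d set Q_j(θ) = (ξ̂_j − P_jθ)ᵀ Σ̂_j^{−1} (ξ̂_j − P_jθ) and S(θ) = ∑_{j=1}^m w_j · tan((π/2) · H_{d_j,k_j}(Q_j(θ))). Then for every c ∈ ℝ the set {θ ∈ ℝ^d : S(θ) ≤ c} is convex; moreover, if the rows of the matrices {P_j : w_j > 0} span ℝ^d, then this set is bounded. -/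
open MeasureTheory Real Matrix

/-- CDF of Hotelling's `T²(d, k)` distribution, i.e. of `(d k/(k+1−d)) · F(d, k+1−d)`. -/
noncomputable def hotellingCDF (d k : ℕ) (q : ℝ) : ℝ :=
  if q < 0 then 0 else
    ∫ x in (0:ℝ)..(q * ((k : ℝ) + 1 - (d : ℝ)) / ((d : ℝ) * (k : ℝ))),
      Real.Gamma (((k : ℝ) + 1) / 2) /
          (Real.Gamma ((d : ℝ) / 2) * Real.Gamma (((k : ℝ) + 1 - (d : ℝ)) / 2)) *
        ((d : ℝ) / ((k : ℝ) + 1 - (d : ℝ))) ^ ((d : ℝ) / 2) *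
        x ^ ((d : ℝ) / 2 - 1) *
        (1 + (d : ℝ) * x / ((k : ℝ) + 1 - (d : ℝ))) ^ (-(((k : ℝ) + 1) / 2))

namespace HCProof

open Set Filter Topology

lemma hc_anti_nonneg {f f' : ℝ → ℝ} {t : ℝ} (hder : ∀ u, t ≤ u → HasDerivAt f (f' u) u)
    (hneg : ∀ u, t ≤ u → f' u ≤ 0) (hlim : Tendsto f atTop (𝓝 0)) : 0 ≤ f t := by
  have hanti : AntitoneOn f (Ici t) := by
    apply antitoneOn_of_deriv_nonpos (convex_Ici t)
    · exact fun u hu => (hder u hu).continuousAt.continuousWithinAt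
    · intro u hu
      rw [interior_Ici] at hu
      exact (hder u (le_of_lt hu)).differentiableAt.differentiableWithinAt
    · intro u hu
      rw [interior_Ici] at hu
      rw [(hder u (le_of_lt hu)).deriv]
      exact hneg u (le_of_lt hu)
  refine le_of_tendsto hlim ?_
  filter_upwards [eventually_ge_atTop t] with u hu
  exact hanti (mem_Ici.2 le_rfl) hu hu

lemma hc_mono_nonneg {f f' : ℝ → ℝ} {a t : ℝ} (hat : a < t)
    (hder : ∀ u, a < u → u ≤ t → HasDerivAt f (f' u) u)
    (hpos : ∀ u, a < u → u ≤ t → 0 ≤ f' u) (hlim : Tendsto f (𝓝[>] a) (𝓝 0)) : 0 ≤ f t := by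
  have hmono : MonotoneOn f (Ioc a t) := by
    apply monotoneOn_of_deriv_nonneg (convex_Ioc a t)
    · exact fun u hu => (hder u hu.1 hu.2).continuousAt.continuousWithinAt
    · intro u hu
      rw [interior_Ioc] at hu
      exact (hder u hu.1 hu.2.le).differentiableAt.differentiableWithinAt
    · intro u hu
      rw [interior_Ioc] at hu
      rw [(hder u hu.1 hu.2.le).deriv]
      exact hpos u hu.1 hu.2.le
  refine le_of_tendsto hlim ?_
  filter_upwards [Ioc_mem_nhdsGT hat] with u hu
  exact hmono hu ⟨hat, le_rfl⟩ hu.2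

/-- Becker–Stark: `(1 - p²) sin (π p / 2) ≤ (π p / 2) cos (π p / 2)`. -/
lemma hc_becker_stark {y : ℝ} (hy0 : 0 < y) (hy1 : y < π / 2) :
    (1 - 4 * y ^ 2 / π ^ 2) * Real.sin y ≤ y * Real.cos y := by
  have hpi := Real.pi_pos
  have hpi3 := Real.pi_gt_three
  have hpi2 : (8:ℝ) < π ^ 2 := by nlinarith
  set β : ℝ := 1 - 8 / π ^ 2 with hβ
  have hβ0 : 0 < β := by
    rw [hβ, sub_pos, div_lt_one (by positivity)]; exact hpi2
  set h : ℝ → ℝ := fun y => y * Real.cos y - (1 - 4 * y ^ 2 / π ^ 2) * Real.sin y with hh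
  have hd : ∀ u, HasDerivAt h (u * (4 / π ^ 2 * u * Real.cos u - β * Real.sin u)) u := by
    intro u
    have h1 := (hasDerivAt_id u).mul (Real.hasDerivAt_cos u)
    have h2 := ((((hasDerivAt_id u).pow 2).const_mul 4).div_const (π ^ 2)).const_sub 1
    have h3 := h1.sub (h2.mul (Real.hasDerivAt_sin u))
    refine (h3.congr_deriv ?_)
    simp [hβ]
    ring
  -- `u cot u` is antitone
  have hcot : AntitoneOn (fun u => u * Real.cos u / Real.sin u) (Ioo 0 (π/2)) := by
    have hs : ∀ u ∈ Ioo (0:ℝ) (π/2), 0 < Real.sin u := fun u hu =>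
      Real.sin_pos_of_pos_of_lt_pi hu.1 (by linarith [hu.2])
    have hder : ∀ u ∈ Ioo (0:ℝ) (π/2), HasDerivAt (fun u => u * Real.cos u / Real.sin u)
        ((Real.cos u * Real.sin u - u) / (Real.sin u)^2) u := by
      intro u hu
      have h1 := ((hasDerivAt_id u).mul (Real.hasDerivAt_cos u)).div (Real.hasDerivAt_sin u)
        (hs u hu).ne'
      refine h1.congr_deriv ?_
      congr 1
      simp
      have := Real.sin_sq_add_cos_sq u
      linear_combination (-u) * this
    apply antitoneOn_of_deriv_nonpos (convex_Ioo _ _)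
    · exact fun u hu => (hder u hu).continuousAt.continuousWithinAt
    · intro u hu
      rw [interior_Ioo] at hu
      exact (hder u hu).differentiableAt.differentiableWithinAt
    · intro u hu
      rw [interior_Ioo] at hu
      rw [(hder u hu).deriv]
      apply div_nonpos_of_nonpos_of_nonneg _ (sq_nonneg _)
      have h1 := Real.sin_lt hu.1
      have h2 := hs u hu
      have h3 := Real.cos_le_one u
      nlinarith
  have hsin : ∀ u, 0 < u → u < π/2 → 0 < Real.sin u := fun u hu hu' =>
      Real.sin_pos_of_pos_of_lt_pi hu (by linarith)
  suffices 0 ≤ h y by simp only [hh] at this; linarith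
  by_cases hc : β ≤ 4 / π^2 * (y * Real.cos y / Real.sin y)
  · refine hc_mono_nonneg (f := h) (a := 0) hy0 (fun u _ _ => hd u) ?_ ?_
    · intro u hu huy
      have hu' : u < π/2 := lt_of_le_of_lt huy hy1
      have h1 := hcot ⟨hu, hu'⟩ ⟨hy0, hy1⟩ huy
      simp only at h1
      have h2 : β ≤ 4 / π^2 * (u * Real.cos u / Real.sin u) :=
        hc.trans (mul_le_mul_of_nonneg_left h1 (by positivity))
      have h3 := hsin u hu hu'
      apply mul_nonneg hu.le
      have : β * Real.sin u ≤ 4 / π^2 * (u * Real.cos u / Real.sin u) * Real.sin u :=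
        mul_le_mul_of_nonneg_right h2 h3.le
      have h4 : 4 / π^2 * (u * Real.cos u / Real.sin u) * Real.sin u = 4/π^2 * u * Real.cos u := by
        field_simp
      linarith
    · have : h 0 = 0 := by simp [hh]
      have h2 := (hd 0).continuousAt.tendsto
      rw [this] at h2
      exact h2.mono_left nhdsWithin_le_nhds
  · push Not at hc
    have hanti : AntitoneOn h (Icc y (π/2)) := by
      apply antitoneOn_of_deriv_nonpos (convex_Icc _ _)
      · exact fun u hu => (hd u).continuousAt.continuousWithinAt
      · exact fun u hu => (hd u).differentiableAt.differentiableWithinAt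
      · intro u hu
        rw [interior_Icc] at hu
        rw [(hd u).deriv]
        have hu0 : 0 < u := hy0.trans hu.1
        have h1 := hcot ⟨hy0, hy1⟩ ⟨hu0, hu.2⟩ hu.1.le
        simp only at h1
        have h2 : 4 / π^2 * (u * Real.cos u / Real.sin u) ≤ β :=
          (mul_le_mul_of_nonneg_left h1 (by positivity)).trans hc.le
        have h3 := hsin u hu0 hu.2
        apply mul_nonpos_of_nonneg_of_nonpos hu0.le
        have : 4 / π^2 * (u * Real.cos u / Real.sin u) * Real.sin u ≤ β * Real.sin u :=
          mul_le_mul_of_nonneg_right h2 h3.le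
        have h4 : 4 / π^2 * (u * Real.cos u / Real.sin u) * Real.sin u
            = 4/π^2 * u * Real.cos u := by
          field_simp
        linarith
    have h1 := hanti ⟨le_rfl, hy1.le⟩ ⟨hy1.le, le_rfl⟩ hy1.le
    have h2 : h (π/2) = 0 := by
      simp only [hh, Real.cos_pi_div_two, Real.sin_pi_div_two]
      field_simp
      ring
    linarith

/-- The facts about the law of `t = r²/k` used in the proof.  `γ` is the density of `log √t`. -/
structure HCData (d ν : ℝ) (G γ : ℝ → ℝ) : Prop where
  hd : 1 ≤ d
  hν : 2 ≤ ν
  G0 : G 0 = 0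
  Gcont : ContinuousOn G (Ici 0)
  Glim : Tendsto G atTop (𝓝 1)
  Gder : ∀ t, 0 < t → HasDerivAt G (γ t / (2 * t)) t
  form : ∃ C, 0 < C ∧ ∀ t, 0 < t → γ t = C * t ^ (d / 2) * (1 + t) ^ (-((d + ν) / 2))

namespace HCData
variable {d ν : ℝ} {G γ : ℝ → ℝ}

lemma pos (h : HCData d ν G γ) {t : ℝ} (ht : 0 < t) : 0 < γ t := by
  obtain ⟨C, hC, hf⟩ := h.form
  rw [hf t ht]; positivity

lemma γder (h : HCData d ν G γ) {t : ℝ} (ht : 0 < t) :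
    HasDerivAt γ (γ t * ((d - ν * t) / (1 + t)) / (2 * t)) t := by
  obtain ⟨C, hC, hf⟩ := h.form
  have h1 : HasDerivAt (fun t : ℝ => C * t ^ (d / 2) * (1 + t) ^ (-((d + ν) / 2)))
      (C * (d/2 * t ^ (d/2 - 1)) * (1 + t) ^ (-((d + ν) / 2)) + C * t ^ (d / 2) *
        (1 * (-((d + ν) / 2)) * (1 + t) ^ (-((d + ν) / 2) - 1))) t := by
    have h2 := (Real.hasDerivAt_rpow_const (p := d/2) (Or.inl ht.ne')).const_mul C
    have h3 := ((hasDerivAt_id t).const_add 1).rpow_const (p := -((d + ν) / 2))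
      (Or.inl (by simp; positivity))
    exact h2.mul h3
  have h4 : γ =ᶠ[𝓝 t] (fun t : ℝ => C * t ^ (d / 2) * (1 + t) ^ (-((d + ν) / 2))) := by
    filter_upwards [Ioi_mem_nhds ht] with u hu using hf u hu
  refine (h1.congr_of_eventuallyEq h4).congr_deriv ?_
  rw [hf t ht, Real.rpow_sub ht, Real.rpow_sub (by positivity), Real.rpow_one, Real.rpow_one]
  have : 0 < 1 + t := by positivity
  field_simp
  ring

lemma mono (h : HCData d ν G γ) : StrictMonoOn G (Ici 0) := by
  apply strictMonoOn_of_deriv_pos (convex_Ici 0) h.Gcont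
  intro u hu
  rw [interior_Ici] at hu
  have hu : 0 < u := hu
  rw [(h.Gder u hu).deriv]
  have := h.pos hu
  positivity

lemma nonneg (h : HCData d ν G γ) {t : ℝ} (ht : 0 ≤ t) : 0 ≤ G t := by
  rw [← h.G0]; exact h.mono.monotoneOn (mem_Ici.2 le_rfl) ht ht

lemma lt_one (h : HCData d ν G γ) {t : ℝ} (ht : 0 ≤ t) : G t < 1 := by
  have h1 : G t < G (t + 1) := h.mono ht (mem_Ici.2 (by linarith)) (by linarith)
  refine lt_of_lt_of_le h1 (ge_of_tendsto h.Glim ?_)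
  filter_upwards [eventually_ge_atTop (t+1)] with u hu
  exact h.mono.monotoneOn (mem_Ici.2 (by linarith)) (mem_Ici.2 (by linarith)) hu

lemma γ_le (h : HCData d ν G γ) : ∃ C, 0 < C ∧ ∀ t, 0 < t → γ t ≤ C / (1 + t) := by
  obtain ⟨C, hC, hf⟩ := h.form
  refine ⟨C, hC, fun t ht => ?_⟩
  rw [hf t ht]
  have h1 : t ^ (d/2) ≤ (1+t)^(d/2) := Real.rpow_le_rpow ht.le (by linarith) (by linarith [h.hd])
  calc C * t ^ (d / 2) * (1 + t) ^ (-((d + ν) / 2))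
      ≤ C * (1+t) ^ (d / 2) * (1 + t) ^ (-((d + ν) / 2)) := by gcongr
    _ = C * (1+t)^(-(ν/2)) := by
        rw [mul_assoc, ← Real.rpow_add (by positivity)]; congr 2; ring
    _ ≤ C * (1+t)^(-1:ℝ) := by
        gcongr
        · linarith
        · linarith [h.hν]
    _ = C / (1+t) := by rw [Real.rpow_neg_one]; rfl

lemma γ_zero (h : HCData d ν G γ) : ∃ C, 0 < C ∧ ∀ t, 0 < t → γ t ≤ C * t ^ (d/2) := by
  obtain ⟨C, hC, hf⟩ := h.form
  refine ⟨C, hC, fun t ht => ?_⟩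
  rw [hf t ht]
  have : (1 + t) ^ (-((d + ν) / 2)) ≤ 1 :=
    Real.rpow_le_one_of_one_le_of_nonpos (by linarith) (by linarith [h.hd, h.hν])
  have h2 : 0 ≤ C * t ^ (d/2) := by positivity
  nlinarith

lemma tendsto_γ (h : HCData d ν G γ) : Tendsto γ atTop (𝓝 0) := by
  obtain ⟨C, hC, hb⟩ := h.γ_le
  have h1 : Tendsto (fun t : ℝ => C / (1 + t)) atTop (𝓝 0) :=
    tendsto_const_nhds.div_atTop (tendsto_atTop_add_const_left _ _ tendsto_id)
  refine squeeze_zero' ?_ ?_ h1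
  · filter_upwards [eventually_gt_atTop 0] with t ht using (h.pos ht).le
  · filter_upwards [eventually_gt_atTop 0] with t ht using hb t ht

lemma tendsto_γ_zero (h : HCData d ν G γ) : Tendsto γ (𝓝[>] 0) (𝓝 0) := by
  obtain ⟨C, hC, hb⟩ := h.γ_zero
  have h1 : Tendsto (fun t : ℝ => C * t ^ (d/2)) (𝓝[>] 0) (𝓝 0) := by
    have : Tendsto (fun t : ℝ => C * t ^ (d/2)) (𝓝 0) (𝓝 (C * 0 ^ (d/2))) :=
      ((Real.continuousAt_rpow_const 0 (d/2) (Or.inr (by linarith [h.hd]))).tendsto).const_mul C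
    rw [Real.zero_rpow (by linarith [h.hd]), mul_zero] at this
    exact this.mono_left nhdsWithin_le_nhds
  refine squeeze_zero' ?_ ?_ h1
  · filter_upwards [self_mem_nhdsWithin] with t ht using (h.pos ht).le
  · filter_upwards [self_mem_nhdsWithin] with t ht using hb t ht

lemma tendsto_G_zero (h : HCData d ν G γ) : Tendsto G (𝓝[>] 0) (𝓝 0) := by
  have := (h.Gcont 0 (mem_Ici.2 le_rfl)).tendsto
  rw [h.G0] at this
  exact this.mono_left (nhdsWithin_mono _ Ioi_subset_Ici_self)

/-- lower bound for `G` -/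
lemma G_ge (h : HCData d ν G γ) {t : ℝ} (ht : 0 < t) : γ t * (1 + t) / d ≤ G t := by
  have hd := h.hd
  suffices 0 ≤ G t - γ t * (1 + t) / d by linarith
  refine hc_mono_nonneg (f := fun t => G t - γ t * (1 + t) / d)
    (f' := fun u => γ u * (ν - 2) / (2 * d)) ht ?_ ?_ ?_
  · intro u hu _
    have h1 := (h.Gder u hu).sub (((h.γder hu).mul ((hasDerivAt_id u).const_add 1)).div_const d)
    refine h1.congr_deriv ?_
    have : 0 < 1 + u := by linarith
    simp only [id]
    field_simp
    ring
  · intro u hu _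
    have := h.pos hu
    have := h.hν
    apply div_nonneg (mul_nonneg (by positivity) (by linarith)) (by positivity)
  · have h1 : Tendsto (fun t : ℝ => 1 + t) (𝓝[>] 0) (𝓝 (1 + 0)) :=
      (((continuous_const.add continuous_id).tendsto (0:ℝ))).mono_left nhdsWithin_le_nhds
    have h2 := h.tendsto_G_zero.sub ((h.tendsto_γ_zero.mul h1).div_const d)
    simpa using h2

/-- upper bound for `1 - G` -/
lemma p_le (h : HCData d ν G γ) (hd2 : 2 ≤ d) {t : ℝ} (ht : (d - 2) / (ν + 2) < t) :
    1 - G t ≤ γ t * ((1 + t) / (ν * (t - (d - 2) / (ν + 2)))) := by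
  have hν := h.hν
  set t1 := (d - 2) / (ν + 2) with ht1
  have ht10 : 0 ≤ t1 := div_nonneg (by linarith) (by linarith)
  have e1 : t1 * (ν + 2) = d - 2 := by rw [ht1]; field_simp
  suffices 0 ≤ γ t * ((1 + t) / (ν * (t - t1))) - (1 - G t) by linarith
  refine hc_anti_nonneg (f := fun t => γ t * ((1 + t) / (ν * (t - t1))) - (1 - G t))
    (f' := fun u => γ u / (2 * u) * (-((d - ν * t1) * t1) / (ν * (u - t1)^2) )) ?_ ?_ ?_
  · intro u hu
    have hu1 : 0 < u - t1 := by linarith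
    have hu0 : 0 < u := by linarith
    have h0 := ((hasDerivAt_id u).const_add 1).div
      (((hasDerivAt_id u).sub_const t1).const_mul ν) (by simp; constructor <;> linarith)
    have h1 := ((h.γder hu0).mul h0).sub ((h.Gder u hu0).const_sub 1)
    refine h1.congr_deriv ?_
    have : 0 < 1 + u := by linarith
    have e2 : d = t1 * (ν + 2) + 2 := by linarith
    simp only [id, Pi.div_apply]
    clear_value t1
    subst e2
    field_simp
    ring
  · intro u hu
    have hu1 : 0 < u - t1 := by linarith
    have hu0 : 0 < u := by linarith
    have := h.pos hu0
    apply mul_nonpos_of_nonneg_of_nonpos (by positivity)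
    apply div_nonpos_of_nonpos_of_nonneg _ (by positivity)
    have : 0 ≤ d - ν * t1 := by nlinarith
    nlinarith [mul_nonneg this ht10]
  · have h1 : Tendsto (fun t : ℝ => (1 + t) / (ν * (t - t1))) atTop (𝓝 (1/ν)) := by
      have h2 : Tendsto (fun t : ℝ => 1/ν + (1 + t1)/ν / (t - t1)) atTop (𝓝 (1/ν + 0)) :=
        tendsto_const_nhds.add (tendsto_const_nhds.div_atTop
          (tendsto_atTop_add_const_right _ _ tendsto_id))
      rw [add_zero] at h2
      refine h2.congr' ?_
      filter_upwards [eventually_gt_atTop t1] with u hu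
      have : 0 < u - t1 := by linarith
      field_simp
      ring
    have h2 := (h.tendsto_γ.mul h1).sub (tendsto_const_nhds (x := (1:ℝ)).sub h.Glim)
    simpa using h2

end HCData

namespace HCData
variable {d ν : ℝ} {G γ : ℝ → ℝ}

/-- polynomial inequality, case `ν ≤ 7` or `d ≤ 7` -/
lemma poly_B (d n : ℕ) (hd : 2 ≤ d) (hn : 2 ≤ n) (hc : d ≤ 7 ∨ n ≤ 7) {σ : ℝ} (hσ : 0 ≤ σ) :
    0 ≤ 2 * (n:ℝ) * σ ^ 2 * (2 + σ) - (n + 1) * σ * (1 + σ) ^ 2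
      + ((n:ℝ) * (d + n) / (d * (n + 2))) * (1 + σ) ^ 2 := by
  have hd' : (2:ℝ) ≤ d := by exact_mod_cast hd
  have hn' : (2:ℝ) ≤ n := by exact_mod_cast hn
  have hσ3 : 0 ≤ σ ^ 3 := by positivity
  by_cases hn7 : n ≤ 7
  · have hs : (n:ℝ) / (n + 2) ≤ (n:ℝ) * (d + n) / (d * (n + 2)) := by
      rw [div_le_div_iff₀ (by positivity) (by positivity)]
      nlinarith [mul_nonneg (by positivity : (0:ℝ) ≤ n) (by positivity : (0:ℝ) ≤ n * (n+2))]
    have h2 : (n:ℝ) / (n + 2) * (1 + σ)^2 ≤ (n:ℝ) * (d + n) / (d * (n + 2)) * (1 + σ) ^ 2 :=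
      mul_le_mul_of_nonneg_right hs (by positivity)
    suffices 0 ≤ 2 * (n:ℝ) * σ ^ 2 * (2 + σ) - (n + 1) * σ * (1 + σ) ^ 2
      + ((n:ℝ) / (n + 2)) * (1 + σ) ^ 2 by linarith
    clear h2 hs
    interval_cases n <;> norm_num <;> nlinarith [sq_nonneg (σ - 1/4), sq_nonneg (σ-2/5), mul_nonneg hσ (sq_nonneg (σ - 1/4))]
  · have hd7 : d ≤ 7 := by omega
    have hn8 : (8:ℝ) ≤ n := by exact_mod_cast (by omega : 8 ≤ n)
    have hd7' : (d:ℝ) ≤ 7 := by exact_mod_cast hd7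
    have hs : ((n:ℝ) + 4) / 7 ≤ (n:ℝ) * (d + n) / (d * (n + 2)) := by
      rw [div_le_div_iff₀ (by positivity) (by positivity)]
      nlinarith [mul_nonneg (by linarith : (0:ℝ) ≤ 7 - d) (by positivity : (0:ℝ) ≤ (n:ℝ)^2),
        mul_nonneg (by linarith : (0:ℝ) ≤ n - 8) (by linarith : (0:ℝ) ≤ d)]
    have h2 : ((n:ℝ) + 4) / 7 * (1 + σ)^2 ≤ (n:ℝ) * (d + n) / (d * (n + 2)) * (1 + σ) ^ 2 :=
      mul_le_mul_of_nonneg_right hs (by positivity)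
    suffices 0 ≤ 2 * (n:ℝ) * σ ^ 2 * (2 + σ) - (n + 1) * σ * (1 + σ) ^ 2
      + (((n:ℝ) + 4) / 7) * (1 + σ) ^ 2 by linarith
    have h3 : 0 ≤ σ^3 + 15/7 * σ^2 - 5/7*σ + 1/7 := by nlinarith [sq_nonneg (σ - 1/6)]
    have h4 := mul_nonneg (by linarith : (0:ℝ) ≤ n - 8) h3
    nlinarith [sq_nonneg (σ - 1/6), sq_nonneg (σ-1/4)]

/-- case B of the key inequality -/
lemma key_B (d n : ℕ) (hd : 2 ≤ d) (hn : 2 ≤ n) (hc : d ≤ 7 ∨ n ≤ 7)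
    (h : HCData (d:ℝ) (n:ℝ) G γ) {t : ℝ} (ht : 0 < t) :
    (((n:ℝ) + 1) * t - (d - 1)) / (1 + t) * Real.cos (π / 2 * G t)
      ≤ π * γ t * Real.sin (π / 2 * G t) := by
  have hpi := Real.pi_pos
  have hd' : (2:ℝ) ≤ d := by exact_mod_cast hd
  have hn' : (2:ℝ) ≤ n := by exact_mod_cast hn
  have hγ := h.pos ht
  have hG0 := h.nonneg ht.le
  have hG1 := h.lt_one ht.le
  have hcos : 0 ≤ Real.cos (π / 2 * G t) :=
    Real.cos_nonneg_of_neg_pi_div_two_le_of_le (by nlinarith) (by nlinarith)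
  have hsin : 0 ≤ Real.sin (π / 2 * G t) :=
    Real.sin_nonneg_of_nonneg_of_le_pi (by positivity) (by nlinarith)
  by_cases hΦ : ((n:ℝ) + 1) * t - (d - 1) ≤ 0
  · have h1 : (((n:ℝ) + 1) * t - (d - 1)) / (1 + t) * Real.cos (π / 2 * G t) ≤ 0 :=
      mul_nonpos_of_nonpos_of_nonneg (div_nonpos_of_nonpos_of_nonneg hΦ (by positivity)) hcos
    have h2 : 0 ≤ π * γ t * Real.sin (π / 2 * G t) := by positivity
    linarith
  push Not at hΦ
  have e0 : ((d:ℝ) - 2) / (n + 2) * (n + 2) = d - 2 := by field_simp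
  set t1 : ℝ := ((d:ℝ) - 2) / (n + 2) with ht1
  have ht1t : t1 < t := by
    rw [ht1, div_lt_iff₀ (by positivity)]
    nlinarith
  have hp := h.p_le hd' ht1t
  rw [← ht1] at hp
  have hg := h.G_ge ht
  set p := 1 - G t with hpdef
  have hp0 : 0 < p := by linarith
  have hp1 : p ≤ 1 := by linarith
  have hs : 0 < t - t1 := by linarith
  -- p * (n (t - t1) + d) ≤ d
  have hpd : p * (n * (t - t1) + d) ≤ d := by
    have h1 : γ t * (1 + t) ≤ G t * d := by
      rwa [div_le_iff₀ (by positivity)] at hg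
    have h2 : p * (n * (t - t1)) ≤ γ t * (1 + t) := by
      rw [← mul_div_assoc, le_div_iff₀ (by positivity)] at hp
      exact hp
    have : G t = 1 - p := by rw [hpdef]; ring
    rw [this] at h1
    linarith
  set σ : ℝ := n * (t - t1) / d with hσ
  have hσ0 : 0 < σ := by positivity
  have hpσ : p * (1 + σ) ≤ 1 := by
    have : n * (t - t1) = σ * d := by rw [hσ]; field_simp
    rw [this] at hpd
    have h3 : (p * (1 + σ)) * d ≤ 1 * d := by linarith
    exact le_of_mul_le_mul_right h3 (by positivity)
  have hpoly := poly_B d n hd hn hc hσ0.le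
  -- Φ R ≤ 2 (1 - p^2)
  have hΦR : (((n:ℝ) + 1) * t - (d - 1)) / (n * (t - t1)) ≤ 2 * (1 - p ^ 2) := by
    have h1 : p ^ 2 * (1 + σ) ^ 2 ≤ 1 := by
      rw [← mul_pow]; exact pow_le_one₀ (by positivity) hpσ
    have h2 : (((n:ℝ) + 1) * t - (d - 1)) / (n * (t - t1)) * (1 + σ) ^ 2
        ≤ 2 * ((1 + σ) ^ 2 - 1) := by
      have e1 : (n:ℝ) * (t - t1) = σ * d := by rw [hσ]; field_simp
      rw [e1, div_mul_eq_mul_div, div_le_iff₀ (by positivity)]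
      have e2 : t = σ * d / n + t1 := by rw [← e1]; field_simp; ring
      have e3 : ((n:ℝ) + 1) * t - (d - 1) = ((n:ℝ)+1) * σ * d / n - (d + n) / (n + 2) := by
        rw [e2, ht1]; field_simp; ring
      rw [e3]
      have e4 : 2 * ((1 + σ) ^ 2 - 1) * (σ * ↑d) -
          (((n:ℝ)+1) * σ * d / n - (d + n) / (n + 2)) * (1 + σ) ^ 2
          = d / n * (2 * (n:ℝ) * σ ^ 2 * (2 + σ) - (n + 1) * σ * (1 + σ) ^ 2
      + ((n:ℝ) * (d + n) / (d * (n + 2))) * (1 + σ) ^ 2) := by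
        field_simp; ring
      have := mul_nonneg (by positivity : (0:ℝ) ≤ d / n) hpoly
      linarith
    have h3 : (((n:ℝ) + 1) * t - (d - 1)) / (n * (t - t1)) * (1 + σ) ^ 2
        ≤ 2 * (1 - p ^ 2) * (1 + σ) ^ 2 := by linarith
    exact le_of_mul_le_mul_right h3 (by positivity)
  set Φ := (((n:ℝ) + 1) * t - (d - 1)) / (1 + t) with hΦdef
  have hΦ0 : 0 < Φ := div_pos hΦ (by positivity)
  have h5 : Φ * p ≤ 2 * γ t * (1 - p ^ 2) := by
    calc Φ * p ≤ Φ * (γ t * ((1 + t) / (n * (t - t1)))) := by gcongr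
      _ = γ t * ((((n:ℝ) + 1) * t - (d - 1)) / (n * (t - t1))) := by
          rw [hΦdef]; field_simp
      _ ≤ γ t * (2 * (1 - p ^ 2)) := by gcongr
      _ = _ := by ring
  have hG : π / 2 * G t = π / 2 - π / 2 * p := by rw [hpdef]; ring
  rw [hG, Real.cos_pi_div_two_sub, Real.sin_pi_div_two_sub]
  by_cases hp1' : p = 1
  · have : G t = 0 := by linarith
    have h8 : 0 < γ t * (1 + t) / d := by positivity
    linarith
  have hplt : p < 1 := lt_of_le_of_ne hp1 hp1'
  have hbs := hc_becker_stark (y := π / 2 * p) (by positivity) (by nlinarith)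
  have e5 : 1 - 4 * (π / 2 * p) ^ 2 / π ^ 2 = 1 - p ^ 2 := by field_simp; ring
  rw [e5] at hbs
  have hsn : 0 ≤ Real.sin (π / 2 * p) :=
    Real.sin_nonneg_of_nonneg_of_le_pi (by positivity) (by nlinarith)
  have h6 : Φ * Real.sin (π / 2 * p) * p ≤ π * γ t * Real.cos (π / 2 * p) * p := by
    calc Φ * Real.sin (π / 2 * p) * p = (Φ * p) * Real.sin (π / 2 * p) := by ring
      _ ≤ (2 * γ t * (1 - p ^ 2)) * Real.sin (π / 2 * p) := by gcongr
      _ = 2 * γ t * ((1 - p ^ 2) * Real.sin (π / 2 * p)) := by ring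
      _ ≤ 2 * γ t * (π / 2 * p * Real.cos (π / 2 * p)) := by gcongr
      _ = _ := by ring
  exact le_of_mul_le_mul_right h6 hp0

/-- The function `D` used in cases A and C. -/
lemma hasDeriv_D (h : HCData d ν G γ) {t : ℝ} (ht : 0 < t) :
    HasDerivAt (fun t => π / 2 * G t - Real.arctan (((ν + 1) * t - (d - 1)) / (1 + t) / (π * γ t)))
      (π * γ t / (4 * t) / (π ^ 2 * γ t ^ 2 + (((ν + 1) * t - (d - 1)) / (1 + t)) ^ 2) *
        (π ^ 2 * γ t ^ 2 + 1 - ((d - ν * t) / (1 + t)) ^ 2 - 4 * (d + ν) * t / (1 + t) ^ 2)) t := by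
  have hγ := h.pos ht
  have hpi := Real.pi_pos
  have h1 := ((((hasDerivAt_id t).const_mul (ν + 1)).sub_const (d - 1)).div
    ((hasDerivAt_id t).const_add 1) (by simp; positivity)).div ((h.γder ht).const_mul π)
      (by positivity)
  have h2 := ((h.Gder t ht).const_mul (π / 2)).sub h1.arctan
  refine h2.congr_deriv ?_
  simp only [id, Pi.div_apply]
  have : 0 < 1 + t := by linarith
  have h3 : 0 < π ^ 2 * γ t ^ 2 + (((ν + 1) * t - (d - 1)) / (1 + t)) ^ 2 := by positivity
  have h4 : 0 < 1 + (((ν + 1) * t - (d - 1)) / (1 + t) / (π * γ t)) ^ 2 := by positivity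
  have h5 : 1 + (((ν + 1) * t - (d - 1)) / (1 + t) / (π * γ t)) ^ 2
    = (π ^ 2 * γ t ^ 2 + (((ν + 1) * t - (d - 1)) / (1 + t)) ^ 2) / (π * γ t) ^ 2 := by
    field_simp
  rw [h5]
  have h6 : ((ν + 1) * t - (d - 1)) / (1 + t) = 1 - (d - ν * t) / (1 + t) := by field_simp; ring
  have h7 : ((ν + 1) * 1 * (1 + t) - ((ν + 1) * t - (d - 1)) * 1) / (1 + t) ^ 2
     = (d + ν) / (1 + t) ^ 2 := by congr 1; ring
  have h8 : 4 * (d + ν) * t / (1 + t) ^ 2 = 4 * t * ((d + ν) / (1 + t) ^ 2) := by ring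
  rw [h7, h8]
  rw [h6] at h3 ⊢
  set κ := (d - ν * t) / (1 + t)
  set W := (d + ν) / (1 + t) ^ 2
  field_simp
  ring

lemma tendsto_D (h : HCData d ν G γ) :
    Tendsto (fun t => π / 2 * G t -
      Real.arctan (((ν + 1) * t - (d - 1)) / (1 + t) / (π * γ t))) atTop (𝓝 0) := by
  have hν := h.hν
  have hpi := Real.pi_pos
  have h1 : Tendsto (fun t : ℝ => ((ν + 1) * t - (d - 1)) / (1 + t)) atTop (𝓝 (ν + 1)) := by
    have h2 : Tendsto (fun t : ℝ => (ν + 1) - (d + ν) / (1 + t)) atTop (𝓝 ((ν + 1) - 0)) :=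
      tendsto_const_nhds.sub (tendsto_const_nhds.div_atTop
        (tendsto_atTop_add_const_left _ _ tendsto_id))
    rw [sub_zero] at h2
    refine h2.congr' ?_
    filter_upwards [eventually_gt_atTop 0] with u hu
    field_simp
    ring
  have h3 : Tendsto (fun t => (π * γ t)⁻¹) atTop atTop := by
    apply Tendsto.inv_tendsto_nhdsGT_zero
    rw [tendsto_nhdsWithin_iff]
    constructor
    · simpa using h.tendsto_γ.const_mul π
    · filter_upwards [eventually_gt_atTop 0] with u hu
      exact mul_pos hpi (h.pos hu)
  have h4 := h1.pos_mul_atTop (by linarith) h3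
  have h5 := (Real.tendsto_arctan_atTop.mono_right nhdsWithin_le_nhds).comp h4
  have h6 := (h.Glim.const_mul (π / 2)).sub h5
  simpa [div_eq_mul_inv] using h6

lemma key_of_D (h : HCData d ν G γ) {t : ℝ} (ht : 0 < t)
    (hD : 0 ≤ π / 2 * G t - Real.arctan (((ν + 1) * t - (d - 1)) / (1 + t) / (π * γ t))) :
    ((ν + 1) * t - (d - 1)) / (1 + t) * Real.cos (π / 2 * G t)
      ≤ π * γ t * Real.sin (π / 2 * G t) := by
  have hpi := Real.pi_pos
  have hγ := h.pos ht
  have hG0 := h.nonneg ht.le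
  have hG1 := h.lt_one ht.le
  have hcos : 0 < Real.cos (π / 2 * G t) :=
    Real.cos_pos_of_mem_Ioo ⟨by nlinarith, by nlinarith⟩
  set Φ := ((ν + 1) * t - (d - 1)) / (1 + t)
  have h1 : Real.arctan (Φ / (π * γ t)) ≤ π / 2 * G t := by linarith
  have h2 : Φ / (π * γ t) ≤ Real.tan (π / 2 * G t) := by
    rw [← Real.tan_arctan (Φ / (π * γ t))]
    rcases h1.eq_or_lt with h1 | h1
    · rw [h1]
    · exact (Real.tan_lt_tan_of_lt_of_lt_pi_div_two (Real.neg_pi_div_two_lt_arctan _)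
        (by nlinarith) h1).le
  rw [Real.tan_eq_sin_div_cos, div_le_div_iff₀ (by positivity) hcos] at h2
  linarith

/-- case A -/
lemma key_A (h : HCData 1 ν G γ) {t : ℝ} (ht : 0 < t) :
    ((ν + 1) * t - (1 - 1)) / (1 + t) * Real.cos (π / 2 * G t)
      ≤ π * γ t * Real.sin (π / 2 * G t) := by
  have hpi := Real.pi_pos
  have hν := h.hν
  apply h.key_of_D ht
  obtain ⟨C, hC, hf⟩ := h.form
  set s : ℝ → ℝ := fun t => π ^ 2 * C ^ 2 * (1 + t) ^ (1 - ν) - (ν + 1) * ((ν - 1) * t + 2) with hs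
  have hsanti : ∀ u v, 0 < u → u ≤ v → s v ≤ s u := by
    intro u v hu huv
    have h1 : (1 + v) ^ (1 - ν) ≤ (1 + u) ^ (1 - ν) :=
      Real.rpow_le_rpow_of_nonpos (by linarith) (by linarith) (by linarith)
    have h2 : π ^ 2 * C ^ 2 * (1 + v) ^ (1 - ν) ≤ π ^ 2 * C ^ 2 * (1 + u) ^ (1 - ν) := by gcongr
    have h3 : (ν + 1) * ((ν - 1) * u + 2) ≤ (ν + 1) * ((ν - 1) * v + 2) := by
      gcongr
      linarith
    simp only [hs]
    linarith
  have hS : ∀ t, 0 < t → (π ^ 2 * γ t ^ 2 + 1 - ((1 - ν * t) / (1 + t)) ^ 2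
      - 4 * (1 + ν) * t / (1 + t) ^ 2) = t / (1 + t)^2 * s t := by
    intro t ht
    have e1 : γ t ^ 2 = C ^ 2 * t * ((1 + t) ^ (1 - ν) / (1 + t) ^ 2) := by
      rw [hf t ht, mul_pow, mul_pow, ← Real.rpow_natCast (t ^ (1 / 2 : ℝ)), ← Real.rpow_mul ht.le,
        ← Real.rpow_natCast ((1 + t) ^ (-((1 + ν) / 2) : ℝ)), ← Real.rpow_mul (by linarith),
        ← Real.rpow_natCast (1 + t) 2, ← Real.rpow_sub (by linarith)]
      have : ((1:ℝ) / 2 * ((2:ℕ):ℝ)) = 1 := by norm_num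
      rw [this, Real.rpow_one]
      congr 2
      push_cast
      ring
    rw [e1]
    simp only [hs]
    field_simp
    ring
  have hder := fun u (hu : 0 < u) => h.hasDeriv_D hu
  have hpre : ∀ u, 0 < u → 0 ≤ π * γ u / (4 * u) /
      (π ^ 2 * γ u ^ 2 + (((ν + 1) * u - (1 - 1)) / (1 + u)) ^ 2) := by
    intro u hu
    have := h.pos hu
    positivity
  rcases le_total 0 (s t) with h0 | h0
  · refine hc_mono_nonneg (f := fun t => π / 2 * G t -
      Real.arctan (((ν + 1) * t - (1 - 1)) / (1 + t) / (π * γ t))) ht (fun u hu _ => hder u hu) ?_ ?_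
    · intro u hu hut
      rw [hS u hu]
      exact mul_nonneg (hpre u hu) (mul_nonneg (by positivity) (h0.trans (hsanti u t hu hut)))
    · have h1 : Tendsto (fun t => ((ν + 1) * t - (1 - 1)) / (1 + t) / (π * γ t)) (𝓝[>] 0) (𝓝 0) := by
        have h2 : Tendsto (fun t : ℝ => (ν + 1) / (π * C) * (t ^ (1/2:ℝ) * (1 + t) ^ ((ν - 1)/2)))
            (𝓝 0) (𝓝 ((ν + 1) / (π * C) * ((0:ℝ) ^ (1/2:ℝ) * (1 + 0) ^ ((ν - 1)/2)))) := by
          refine Tendsto.const_mul _ (Tendsto.mul ?_ ?_)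
          · exact (Real.continuousAt_rpow_const 0 (1/2) (Or.inr (by norm_num))).tendsto
          · have : ContinuousAt (fun t : ℝ => (1 + t) ^ ((ν - 1)/2)) 0 :=
              (continuousAt_const.add continuousAt_id).rpow_const (Or.inl (by simp))
            exact this.tendsto
        rw [Real.zero_rpow (by norm_num), zero_mul, mul_zero] at h2
        refine (h2.mono_left nhdsWithin_le_nhds).congr' ?_
        filter_upwards [self_mem_nhdsWithin] with u hu
        have hu : 0 < u := hu
        have hu1 : 0 < 1 + u := by linarith
        rw [hf u hu]
        have e1 : u ^ (1/2:ℝ) * u ^ (1/2:ℝ) = u := by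
          rw [← Real.rpow_add hu]; norm_num
        have e2 : (1 + u) ^ ((ν - 1)/2) * (1 + u) * (1 + u) ^ (-((1 + ν) / 2)) = 1 := by
          nth_rewrite 2 [← Real.rpow_one (1 + u)]
          rw [← Real.rpow_add hu1, ← Real.rpow_add hu1]
          convert Real.rpow_zero (1 + u) using 2
          ring
        have p1 : 0 < u ^ (1/2:ℝ) := by positivity
        have p2 : 0 < (1 + u) ^ (-((1 + ν) / 2)) := by positivity
        rw [eq_div_iff (by positivity), eq_div_iff (by positivity)]
        have : (ν + 1) / (π * C) * (u ^ (1 / 2:ℝ) * (1 + u) ^ ((ν - 1) / 2)) *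
            (π * (C * u ^ (1 / 2:ℝ) * (1 + u) ^ (-((1 + ν) / 2)))) * (1 + u) =
            (ν + 1) * (u ^ (1/2:ℝ) * u ^ (1/2:ℝ)) *
            ((1 + u) ^ ((ν - 1)/2) * (1 + u) * (1 + u) ^ (-((1 + ν) / 2))) := by
          field_simp
        rw [this, e1, e2]
        ring
      have h3 := (h.tendsto_G_zero.const_mul (π/2)).sub
        ((Real.continuous_arctan.tendsto 0).comp h1)
      simpa using h3
  · refine hc_anti_nonneg (f := fun t => π / 2 * G t -
      Real.arctan (((ν + 1) * t - (1 - 1)) / (1 + t) / (π * γ t)))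
      (fun u hu => hder u (lt_of_lt_of_le ht hu)) ?_ h.tendsto_D
    intro u hu
    have hu0 := lt_of_lt_of_le ht hu
    rw [hS u hu0]
    exact mul_nonpos_of_nonneg_of_nonpos (hpre u hu0)
      (mul_nonpos_of_nonneg_of_nonpos (by positivity) ((hsanti t u ht hu).trans h0))

end HCData

namespace HCData
variable {d ν : ℝ} {G γ : ℝ → ℝ}

lemma pair (h : HCData d ν G γ) {t Ω : ℝ} (ht : 0 < t) (hΩ : (d + ν) * t / (1 + t) ^ 2 ≤ Ω)
    (s : ℝ) :
    2 * γ t * Real.exp (-Ω * Real.sinh s ^ 2)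
      ≤ γ (t * Real.exp (2 * s)) + γ (t * Real.exp (-(2 * s))) := by
  have hd := h.hd
  have hν := h.hν
  obtain ⟨C, hC, hf⟩ := h.form
  set X := γ (t * Real.exp (2 * s)) with hX
  set Y := γ (t * Real.exp (-(2 * s))) with hY
  have hX0 : 0 < X := h.pos (by positivity)
  have hY0 : 0 < Y := h.pos (by positivity)
  have hg := h.pos ht
  set u := Real.sinh s with hu
  have he : Real.exp (2 * s) * Real.exp (-(2 * s)) = 1 := by rw [← Real.exp_add]; simp
  have he2 : Real.exp (2 * s) + Real.exp (-(2 * s)) = 2 + 4 * u ^ 2 := by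
    have h1 := Real.cosh_two_mul s
    have h2 := Real.cosh_sq s
    have h3 := Real.cosh_eq (2 * s)
    rw [h2] at h1
    linarith
  have hprod : X * Y = C ^ 2 * (t * t) ^ (d / 2) *
      ((1 + t) ^ 2 * (1 + 4 * t * u ^ 2 / (1 + t) ^ 2)) ^ (-((d + ν) / 2)) := by
    rw [hX, hY, hf _ (by positivity), hf _ (by positivity)]
    have e1 : (t * Real.exp (2 * s)) ^ (d/2) * (t * Real.exp (-(2 * s))) ^ (d/2)
        = (t * t) ^ (d/2) := by
      rw [← Real.mul_rpow (by positivity) (by positivity)]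
      congr 1
      linear_combination t * t * he
    have e2 : (1 + t * Real.exp (2 * s)) ^ (-((d + ν) / 2)) *
        (1 + t * Real.exp (-(2 * s))) ^ (-((d + ν) / 2))
        = ((1 + t) ^ 2 * (1 + 4 * t * u ^ 2 / (1 + t) ^ 2)) ^ (-((d + ν) / 2)) := by
      rw [← Real.mul_rpow (by positivity) (by positivity)]
      congr 1
      have : (1 + t) ^ 2 * (1 + 4 * t * u ^ 2 / (1 + t) ^ 2) = (1 + t)^2 + 4 * t * u^2 := by
        field_simp
      rw [this]
      linear_combination t * t * he + t * he2
    rw [← e1, ← e2]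
    ring
  have hlow : (γ t * Real.exp (-Ω * u ^ 2)) ^ 2 ≤ X * Y := by
    rw [hprod, Real.mul_rpow (x := (1 + t) ^ 2) (by positivity) (by positivity)]
    have e3 : γ t ^ 2 = C ^ 2 * (t * t) ^ (d/2) * ((1 + t) ^ 2) ^ (-((d + ν) / 2)) := by
      rw [hf t ht, Real.mul_rpow ht.le ht.le, sq (1 + t),
        Real.mul_rpow (x := 1 + t) (y := 1 + t) (by positivity) (by positivity)]
      ring
    rw [mul_pow, e3, ← mul_assoc]
    refine mul_le_mul_of_nonneg_left ?_ (by positivity)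
    have e4 : (Real.exp (4 * t * u ^ 2 / (1 + t) ^ 2)) ^ (-((d + ν) / 2)) ≤
        (1 + 4 * t * u ^ 2 / (1 + t) ^ 2) ^ (-((d + ν) / 2)) := by
      apply Real.rpow_le_rpow_of_nonpos (by positivity)
      · have := Real.add_one_le_exp (4 * t * u ^ 2 / (1 + t) ^ 2)
        linarith
      · linarith
    refine le_trans ?_ e4
    rw [← Real.exp_mul, sq, ← Real.exp_add]
    apply Real.exp_le_exp.2
    have e5 : 4 * t * u ^ 2 / (1 + t) ^ 2 * -((d + ν) / 2)
      = -2 * ((d + ν) * t / (1 + t) ^ 2 * u ^ 2) := by field_simp; ring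
    rw [e5]
    have := mul_le_mul_of_nonneg_right hΩ (sq_nonneg u)
    linarith
  have h1 : (2 * γ t * Real.exp (-Ω * u ^ 2)) ^ 2 ≤ (X + Y) ^ 2 := by
    nlinarith [sq_nonneg (X - Y)]
  exact le_of_sq_le_sq h1 (by positivity)

lemma cosh_bound (s : ℝ) : Real.cosh s * (1 - Real.sinh s ^ 2 / 2) ≤ 1 := by
  have h1 := Real.cosh_sq s
  have h2 := Real.cosh_pos s
  set u2 := Real.sinh s ^ 2 with hu
  have hu0 : 0 ≤ u2 := sq_nonneg _
  by_cases hc : u2 ≤ 2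
  · refine le_of_sq_le_sq ?_ (zero_le_one' ℝ)
    rw [mul_pow, h1]
    nlinarith [mul_nonneg (sq_nonneg u2) (by linarith : 0 ≤ 3 - u2)]
  · push Not at hc
    nlinarith

lemma γ_bound (h : HCData d ν G γ) {t Ω : ℝ} (ht : 0 < t)
    (hΩ : (d + ν) * t / (1 + t) ^ 2 ≤ Ω) (hΩ4 : 4 ≤ Ω) :
    γ t * (√(π / Ω) * (1 - 1 / (4 * Ω))) ≤ 1 := by
  have hg := h.pos ht
  have hΩ0 : 0 < Ω := by linarith
  set e : ℝ → ℝ := fun v => Real.exp (-Ω * v ^ 2) with he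
  have hecont : Continuous e := by fun_prop
  set E : ℝ → ℝ := fun u => ∫ v in (0:ℝ)..u, e v with hE
  have hEd : ∀ u, HasDerivAt E (e u) u := fun u =>
    intervalIntegral.integral_hasDerivAt_right (hecont.intervalIntegrable _ _)
      (hecont.stronglyMeasurableAtFilter _ _) hecont.continuousAt
  have hc0 : 0 ≤ 1 - 1 / (4 * Ω) := by
    rw [sub_nonneg, div_le_one (by positivity)]; linarith
  set F : ℝ → ℝ := fun s => G (t * Real.exp (2 * s)) - G (t * Real.exp (-(2 * s))) -
    2 * γ t * ((1 - 1 / (4 * Ω)) * E (Real.sinh s) + Real.sinh s * e (Real.sinh s) / (4 * Ω)) with hF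
  have hFd : ∀ s, HasDerivAt F (γ (t * Real.exp (2 * s)) + γ (t * Real.exp (-(2 * s))) -
      2 * γ t * e (Real.sinh s) * (Real.cosh s * (1 - Real.sinh s ^ 2 / 2))) s := by
    intro s
    have a1 : HasDerivAt (fun s => t * Real.exp (2 * s)) (t * (Real.exp (2 * s) * (2 * 1))) s :=
      (((hasDerivAt_id s).const_mul 2).exp).const_mul t
    have a2 : HasDerivAt (fun s => t * Real.exp (-(2 * s)))
        (t * (Real.exp (-(2 * s)) * (-(2 * 1)))) s :=
      ((((hasDerivAt_id s).const_mul 2).neg).exp).const_mul t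
    have b1 := (h.Gder (t * Real.exp (2 * s)) (by positivity)).comp s a1
    have b2 := (h.Gder (t * Real.exp (-(2 * s))) (by positivity)).comp s a2
    have c0 := Real.hasDerivAt_sinh s
    have c1 := (hEd (Real.sinh s)).comp s c0
    have c2 : HasDerivAt (fun s => e (Real.sinh s))
        (Real.exp (-Ω * Real.sinh s ^ 2) * (-Ω * (2 * Real.sinh s ^ (2 - 1) * Real.cosh s))) s := by
      have := ((c0.pow 2).const_mul (-Ω)).exp
      simpa [he] using this
    have c3 := ((c1.const_mul (1 - 1 / (4 * Ω))).add ((c0.mul c2).div_const (4 * Ω))).const_mul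
      (2 * γ t)
    refine ((b1.sub b2).sub c3).congr_deriv ?_
    have p1 := Real.exp_pos (2 * s)
    have p2 := Real.exp_pos (-(2 * s))
    simp only [he]
    field_simp
    ring
  have hF0 : F 0 = 0 := by simp [hF, hE]
  have hFn : ∀ s, 0 < s → 0 ≤ F s := by
    intro s hs
    refine hc_mono_nonneg (f := F) (a := 0) hs (fun u _ _ => hFd u) ?_ ?_
    · intro u _ _
      have h1 := h.pair ht hΩ u
      have h2 := cosh_bound u
      have h3 : 0 ≤ 2 * γ t * e (Real.sinh u) := by positivity
      have h4 := mul_le_mul_of_nonneg_left h2 h3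
      simp only [he] at h4 ⊢
      linarith
    · have := (hFd 0).continuousAt.tendsto
      rw [hF0] at this
      exact this.mono_left nhdsWithin_le_nhds
  have hEb : ∀ u, 0 < u → 2 * γ t * ((1 - 1 / (4 * Ω)) * E u) ≤ 1 := by
    intro u hu
    have hs : 0 < Real.arsinh u := Real.arsinh_pos_iff.2 hu
    have h1 := hFn _ hs
    simp only [hF, Real.sinh_arsinh] at h1
    have h2 := h.lt_one (t := t * Real.exp (2 * Real.arsinh u)) (by positivity)
    have h3 := h.nonneg (t := t * Real.exp (-(2 * Real.arsinh u))) (by positivity)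
    have h4 : 0 ≤ 2 * γ t * (u * e u / (4 * Ω)) := by positivity
    linarith
  have hlim : Tendsto E atTop (𝓝 (√(π / Ω) / 2)) := by
    rw [← integral_gaussian_Ioi Ω]
    exact intervalIntegral_tendsto_integral_Ioi 0 (integrable_exp_neg_mul_sq hΩ0).integrableOn
      tendsto_id
  have hlim2 := (hlim.const_mul (1 - 1 / (4 * Ω))).const_mul (2 * γ t)
  have hfin := le_of_tendsto hlim2 (by
    filter_upwards [eventually_gt_atTop 0] with u hu using hEb u hu)
  linarith

/-- case C -/
lemma key_C (h : HCData d ν G γ) (hd8 : 8 ≤ d) (hν8 : 8 ≤ ν) {t : ℝ} (ht : 0 < t) :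
    ((ν + 1) * t - (d - 1)) / (1 + t) * Real.cos (π / 2 * G t)
      ≤ π * γ t * Real.sin (π / 2 * G t) := by
  have hpi := Real.pi_pos
  by_cases hΦ : (ν + 1) * t - (d - 1) ≤ 0
  · have hγ := h.pos ht
    have hG0 := h.nonneg ht.le
    have hG1 := h.lt_one ht.le
    have hcos : 0 ≤ Real.cos (π / 2 * G t) :=
      Real.cos_nonneg_of_neg_pi_div_two_le_of_le (by nlinarith) (by nlinarith)
    have hsin : 0 ≤ Real.sin (π / 2 * G t) :=
      Real.sin_nonneg_of_nonneg_of_le_pi (by positivity) (by nlinarith)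
    have h1 : ((ν + 1) * t - (d - 1)) / (1 + t) * Real.cos (π / 2 * G t) ≤ 0 :=
      mul_nonpos_of_nonpos_of_nonneg (div_nonpos_of_nonpos_of_nonneg hΦ (by positivity)) hcos
    have h2 : 0 ≤ π * γ t * Real.sin (π / 2 * G t) := by positivity
    linarith
  push Not at hΦ
  apply h.key_of_D ht
  refine hc_anti_nonneg (f := fun t => π / 2 * G t -
      Real.arctan (((ν + 1) * t - (d - 1)) / (1 + t) / (π * γ t)))
      (fun u hu => h.hasDeriv_D (lt_of_lt_of_le ht hu)) ?_ h.tendsto_D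
  intro u hu
  have hu0 := lt_of_lt_of_le ht hu
  have hγ := h.pos hu0
  apply mul_nonpos_of_nonneg_of_nonpos (by positivity)
  have hu1 : 0 < 1 + u := by linarith
  have hn : 0 < d + ν := by linarith
  -- κ ≤ 1
  set κ := (d - ν * u) / (1 + u) with hκ
  have hκ1 : κ ≤ 1 := by
    rw [hκ, div_le_one hu1]
    nlinarith
  have hω : (d + ν) * u / (1 + u) ^ 2 = (d - κ) * (ν + κ) / (d + ν) := by
    rw [hκ]; field_simp; ring
  have h4ω : 4 * (d + ν) * u / (1 + u) ^ 2 = 4 * ((d + ν) * u / (1 + u) ^ 2) := by ring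
  have hκν : -ν < κ := by
    rw [hκ, lt_div_iff₀ hu1]
    nlinarith
  rw [h4ω]
  set ω := (d + ν) * u / (1 + u) ^ 2 with hωd
  have hω0 : 0 ≤ ω := by positivity
  have h16 : 16 ≤ κ ^ 2 + 4 * ω := by
    by_cases hk : 16 ≤ κ ^ 2
    · linarith
    push Not at hk
    have hk4 : -4 < κ := by nlinarith
    have h1 : (8 - κ) * (8 + κ) / 16 ≤ ω := by
      rw [hω, div_le_div_iff₀ (by norm_num) hn]
      have hA : 0 ≤ d - 8 := by linarith
      have hB : 0 ≤ ν - 8 := by linarith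
      nlinarith [mul_nonneg hA hB, mul_nonneg hA (sq_nonneg (8 + κ)),
        mul_nonneg hB (sq_nonneg (8 - κ))]
    nlinarith [sq_nonneg κ]
  have hmain : ∀ Ω, ω ≤ Ω → 4 ≤ Ω → π ^ 2 * γ u ^ 2 ≤ 4 * Ω - 1 := by
    intro Ω h1 h2
    have h3 := h.γ_bound hu0 h1 h2
    have hΩ0 : 0 < Ω := by linarith
    have hc0 : 0 ≤ 1 - 1 / (4 * Ω) := by
      rw [sub_nonneg, div_le_one (by positivity)]; linarith
    have h4 : (γ u * (√(π / Ω) * (1 - 1 / (4 * Ω)))) ^ 2 ≤ 1 :=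
      pow_le_one₀ (by positivity) h3
    rw [mul_pow, mul_pow, Real.sq_sqrt (by positivity)] at h4
    have h5 : 1 - 1 / (2 * Ω) ≤ (1 - 1 / (4 * Ω)) ^ 2 := by
      have : (1 - 1 / (4 * Ω)) ^ 2 = 1 - 1 / (2 * Ω) + (1 / (4 * Ω)) ^ 2 := by field_simp; ring
      rw [this]; linarith [sq_nonneg (1 / (4 * Ω))]
    have h6 : γ u ^ 2 * (π / Ω * (1 - 1 / (2 * Ω))) ≤ 1 :=
      le_trans (by gcongr) h4
    have h7 : γ u ^ 2 * π * (2 * Ω - 1) ≤ 2 * Ω ^ 2 := by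
      have : γ u ^ 2 * (π / Ω * (1 - 1 / (2 * Ω))) = γ u ^ 2 * π * (2 * Ω - 1) / (2 * Ω ^ 2) := by
        field_simp
      rw [this, div_le_one (by positivity)] at h6
      exact h6
    have hpi2 := Real.pi_lt_d2
    have h8 : π * (2 * Ω ^ 2) ≤ (4 * Ω - 1) * (2 * Ω - 1) := by nlinarith
    have h9 : (π ^ 2 * γ u ^ 2) * (2 * Ω - 1) ≤ (4 * Ω - 1) * (2 * Ω - 1) := by
      calc (π ^ 2 * γ u ^ 2) * (2 * Ω - 1) = π * (γ u ^ 2 * π * (2 * Ω - 1)) := by ring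
        _ ≤ π * (2 * Ω ^ 2) := by gcongr
        _ ≤ _ := h8
    exact le_of_mul_le_mul_right h9 (by linarith)
  rcases le_total ω 4 with h1 | h1
  · have := hmain 4 h1 le_rfl
    linarith
  · have := hmain ω le_rfl h1
    linarith [sq_nonneg κ]

lemma key (d n : ℕ) (h : HCData (d:ℝ) (n:ℝ) G γ) {t : ℝ} (ht : 0 < t) :
    (((n:ℝ) + 1) * t - (d - 1)) / (1 + t) * Real.cos (π / 2 * G t)
      ≤ π * γ t * Real.sin (π / 2 * G t) := by
  have hd1 : 1 ≤ d := by exact_mod_cast h.hd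
  have hn2 : 2 ≤ n := by exact_mod_cast h.hν
  rcases hd1.eq_or_lt with h1 | h1
  · subst h1
    have h' : HCData 1 (n:ℝ) G γ := by simpa using h
    simpa using h'.key_A ht
  · by_cases hc : d ≤ 7 ∨ n ≤ 7
    · exact key_B d n h1 hn2 hc h ht
    · push Not at hc
      exact h.key_C (by exact_mod_cast hc.1) (by exact_mod_cast hc.2) ht

/-- the score as a function of the radius -/
lemma convex_tan (d n : ℕ) (h : HCData (d:ℝ) (n:ℝ) G γ) :
    ConvexOn ℝ (Ici 0) (fun r : ℝ => Real.tan (π / 2 * G (r ^ 2))) := by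
  have hpi := Real.pi_pos
  have hcos : ∀ r : ℝ, 0 < Real.cos (π / 2 * G (r ^ 2)) := by
    intro r
    have hG0 := h.nonneg (sq_nonneg r)
    have hG1 := h.lt_one (sq_nonneg r)
    exact Real.cos_pos_of_mem_Ioo ⟨by nlinarith, by nlinarith⟩
  have hGd : ∀ r : ℝ, 0 < r → HasDerivAt (fun r : ℝ => π / 2 * G (r ^ 2))
      (π / 2 * (γ (r ^ 2) / r)) r := by
    intro r hr
    have h1 := ((h.Gder (r ^ 2) (by positivity)).comp r (hasDerivAt_pow 2 r)).const_mul (π/2)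
    refine h1.congr_deriv ?_
    field_simp
    simp
    ring
  have hTd : ∀ r : ℝ, 0 < r → HasDerivAt (fun r : ℝ => Real.tan (π / 2 * G (r ^ 2)))
      (π / 2 * (γ (r ^ 2) / r) / Real.cos (π / 2 * G (r ^ 2)) ^ 2) r := by
    intro r hr
    have h1 := (Real.hasDerivAt_tan (hcos r).ne').comp r (hGd r hr)
    refine h1.congr_deriv ?_
    ring
  have hT2 : ∀ r : ℝ, 0 < r → HasDerivAt
      (fun r : ℝ => π / 2 * (γ (r ^ 2) / r) / Real.cos (π / 2 * G (r ^ 2)) ^ 2)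
      (π / 2 * γ (r ^ 2) / r ^ 2 / Real.cos (π / 2 * G (r ^ 2)) ^ 3 *
        (π * γ (r ^ 2) * Real.sin (π / 2 * G (r ^ 2)) -
        (((n:ℝ) + 1) * r ^ 2 - (d - 1)) / (1 + r ^ 2) * Real.cos (π / 2 * G (r ^ 2)))) r := by
    intro r hr
    have h1 := (((h.γder (t := r ^ 2) (by positivity)).comp r (hasDerivAt_pow 2 r)).div
      (hasDerivAt_id r) hr.ne').const_mul (π / 2)
    have h2 := ((hGd r hr).cos).pow 2
    have h3 := h1.div h2 (pow_ne_zero 2 (hcos r).ne')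
    refine h3.congr_deriv ?_
    have := hcos r
    simp only [Function.comp, id, Pi.div_apply, Pi.pow_apply]
    generalize Real.cos (π / 2 * G (r ^ 2)) = cc at this ⊢
    generalize Real.sin (π / 2 * G (r ^ 2)) = ss
    field_simp
    simp
    ring
  apply MonotoneOn.convexOn_of_deriv (convex_Ici 0)
  · intro r hr
    have h1 : ContinuousWithinAt (fun r : ℝ => G (r ^ 2)) (Ici 0) r :=
      ContinuousWithinAt.comp (g := G) (f := fun r : ℝ => r ^ 2) (t := Ici 0)
        (h.Gcont (r ^ 2) (mem_Ici.2 (sq_nonneg r)))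
        ((continuous_pow 2).continuousWithinAt) (fun x _ => mem_Ici.2 (sq_nonneg x))
    have h2 : ContinuousWithinAt (fun r : ℝ => π / 2 * G (r ^ 2)) (Ici 0) r :=
      continuousWithinAt_const.mul h1
    exact ContinuousAt.comp_continuousWithinAt (g := Real.tan)
      (f := fun r : ℝ => π / 2 * G (r ^ 2)) (Real.continuousAt_tan.2 (hcos r).ne') h2
  · intro r hr
    rw [interior_Ici] at hr
    exact (hTd r hr).differentiableAt.differentiableWithinAt
  · rw [interior_Ici]
    have hm : MonotoneOn
      (fun r : ℝ => π / 2 * (γ (r ^ 2) / r) / Real.cos (π / 2 * G (r ^ 2)) ^ 2) (Ioi 0) := by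
      apply monotoneOn_of_deriv_nonneg (convex_Ioi 0)
      · exact fun r hr => (hT2 r hr).continuousAt.continuousWithinAt
      · intro r hr
        rw [interior_Ioi] at hr
        exact (hT2 r hr).differentiableAt.differentiableWithinAt
      · intro r hr
        rw [interior_Ioi] at hr
        have hr : 0 < r := hr
        rw [(hT2 r hr).deriv]
        have hγ := h.pos (t := r ^ 2) (by positivity)
        have := hcos r
        apply mul_nonneg (by positivity)
        have := key d n h (t := r ^ 2) (by positivity)
        linarith
    exact hm.congr (fun r hr => (hTd r hr).deriv.symm)

lemma mono_tan (h : HCData d ν G γ) :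
    MonotoneOn (fun r : ℝ => Real.tan (π / 2 * G (r ^ 2))) (Ici 0) := by
  intro r hr s hs hrs
  have hpi := Real.pi_pos
  have hr : 0 ≤ r := hr
  have h1 : G (r ^ 2) ≤ G (s ^ 2) :=
    h.mono.monotoneOn (mem_Ici.2 (sq_nonneg r)) (mem_Ici.2 (sq_nonneg s)) (by gcongr)
  have h2 := h.nonneg (sq_nonneg r)
  have h3 := h.lt_one (sq_nonneg s)
  simp only
  rcases h1.eq_or_lt with h4 | h4
  · rw [h4]
  · exact (Real.tan_lt_tan_of_lt_of_lt_pi_div_two (by nlinarith) (by nlinarith) (by nlinarith)).le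

lemma tan_nonneg' (h : HCData d ν G γ) {t : ℝ} (ht : 0 ≤ t) : 0 ≤ Real.tan (π / 2 * G t) := by
  have hpi := Real.pi_pos
  have h2 := h.nonneg ht
  have h3 := h.lt_one ht
  exact Real.tan_nonneg_of_nonneg_of_le_pi_div_two (by positivity) (by nlinarith)

lemma tan_bdd (h : HCData d ν G γ) (c : ℝ) :
    ∃ M, ∀ t, 0 ≤ t → Real.tan (π / 2 * G t) ≤ c → t ≤ M := by
  have hpi := Real.pi_pos
  have h1 : 2 / π * Real.arctan c < 1 := by
    have := Real.arctan_lt_pi_div_two c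
    rw [div_mul_eq_mul_div, div_lt_one hpi]; linarith
  obtain ⟨M, hM⟩ := ((h.Glim.eventually_const_lt h1).and (eventually_ge_atTop 0)).exists
  refine ⟨M, fun t ht htc => ?_⟩
  by_contra hcon
  push Not at hcon
  have h2 : G M < G t := h.mono hM.2 ht hcon
  have h3 := h.lt_one ht
  have h4 : Real.arctan c < π / 2 * G t := by
    have : 2 / π * Real.arctan c < G t := hM.1.trans h2
    rw [div_mul_eq_mul_div, div_lt_iff₀ hpi] at this
    linarith
  have h5 := Real.tan_lt_tan_of_lt_of_lt_pi_div_two (Real.neg_pi_div_two_lt_arctan c)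
    (by nlinarith) h4
  rw [Real.tan_arctan] at h5
  linarith

end HCData

/-- the beta integral, with real exponents -/
lemma hc_beta_int {a b : ℝ} (ha : 0 < a) (hb : 0 < b) :
    ∫ x in (0:ℝ)..1, x ^ (a - 1) * (1 - x) ^ (b - 1) = ProbabilityTheory.beta a b := by
  rw [ProbabilityTheory.beta_eq_betaIntegralReal a b ha hb, Complex.betaIntegral]
  have : (∫ x : ℝ in (0:ℝ)..1, (x : ℂ) ^ ((a:ℂ) - 1) * (1 - (x : ℂ)) ^ ((b:ℂ) - 1))
      = ∫ x : ℝ in (0:ℝ)..1, ((x ^ (a - 1) * (1 - x) ^ (b - 1) : ℝ) : ℂ) := by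
    apply intervalIntegral.integral_congr
    intro x hx
    rw [uIcc_of_le zero_le_one] at hx
    have h1 : 0 ≤ 1 - x := by linarith [hx.2]
    simp only
    rw [Complex.ofReal_mul, Complex.ofReal_cpow hx.1, Complex.ofReal_cpow h1]
    push_cast
    rfl
  rw [this, intervalIntegral.integral_ofReal, Complex.ofReal_re]

lemma hc_prim {f : ℝ → ℝ} {R : ℝ} (hR : 0 < R) (hf : IntervalIntegrable f volume 0 R) :
    ContinuousOn (fun y => ∫ x in (0:ℝ)..y, f x) (Icc 0 R) := by
  have := intervalIntegral.continuousOn_primitive_interval' (a := 0) hf left_mem_uIcc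
  rwa [uIcc_of_le hR.le] at this

/-- a beta-prime type density -/
lemma hc_prim_der {f : ℝ → ℝ} {R y : ℝ} (hy : 0 < y) (hyR : y < R)
    (hf : IntervalIntegrable f volume 0 R) (hc : ContinuousOn f (Ioo 0 R)) :
    HasDerivAt (fun y => ∫ x in (0:ℝ)..y, f x) (f y) y := by
  have hn : Ioo 0 R ∈ 𝓝 y := Ioo_mem_nhds hy hyR
  refine intervalIntegral.integral_hasDerivAt_right ?_ ?_ (hc.continuousAt hn)
  · exact hf.mono_set (by
      rw [uIcc_of_le hy.le, uIcc_of_le (hy.trans hyR).le]; exact Icc_subset_Icc_right hyR.le)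
  · exact hc.stronglyMeasurableAtFilter isOpen_Ioo y ⟨hy, hyR⟩

lemma hc_data_aux {d ν : ℝ} (hd : 1 ≤ d) (hν : 2 ≤ ν) {G : ℝ → ℝ} {K : ℝ}
    (hK : K = Real.Gamma ((d + ν) / 2) / (Real.Gamma (d / 2) * Real.Gamma (ν / 2)))
    (hG : ∀ t, 0 ≤ t → G t = ∫ x in (0:ℝ)..(t * ν / d), K * (d / ν) ^ (d / 2) *
      x ^ (d / 2 - 1) * (1 + d * x / ν) ^ (-((d + ν) / 2))) :
    HCData d ν G (fun t => 2 * K * t ^ (d / 2) * (1 + t) ^ (-((d + ν) / 2))) := by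
  have hd0 : 0 < d := by linarith
  have hν0 : 0 < ν := by linarith
  have hK0 : 0 < K := by
    rw [hK]
    have h1 := Real.Gamma_pos_of_pos (show 0 < (d + ν) / 2 by positivity)
    have h2 := Real.Gamma_pos_of_pos (show 0 < d / 2 by positivity)
    have h3 := Real.Gamma_pos_of_pos (show 0 < ν / 2 by positivity)
    positivity
  set f : ℝ → ℝ := fun x => K * (d / ν) ^ (d / 2) *
      x ^ (d / 2 - 1) * (1 + d * x / ν) ^ (-((d + ν) / 2)) with hf
  have hcont1 : ∀ x : ℝ, 0 ≤ x → ContinuousAt (fun x : ℝ => (1 + d * x / ν) ^ (-((d + ν) / 2))) x := by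
    intro x hx
    apply ContinuousAt.rpow_const (by fun_prop)
    left
    positivity
  have hint : ∀ R : ℝ, 0 < R → IntervalIntegrable f volume 0 R := by
    intro R hR
    apply IntervalIntegrable.mul_continuousOn
    · exact (intervalIntegral.intervalIntegrable_rpow' (by linarith)).const_mul _
    · intro x hx
      rw [uIcc_of_le hR.le] at hx
      exact (hcont1 x hx.1).continuousWithinAt
  have hfc : ∀ R : ℝ, ContinuousOn f (Ioo 0 R) := by
    intro R x hx
    apply ContinuousAt.continuousWithinAt
    exact ContinuousAt.mul (continuousAt_const.mul
      (Real.continuousAt_rpow_const _ _ (Or.inl hx.1.ne'))) (hcont1 x hx.1.le)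
  set F : ℝ → ℝ := fun y => ∫ x in (0:ℝ)..y, f x with hF
  have hG0 : G 0 = 0 := by rw [hG 0 le_rfl]; simp
  have hGder : ∀ t, 0 < t → HasDerivAt G
      ((2 * K * t ^ (d / 2) * (1 + t) ^ (-((d + ν) / 2))) / (2 * t)) t := by
    intro t ht
    have hy : 0 < t * ν / d := by positivity
    have h1 := hc_prim_der hy (lt_add_one _) (hint (t * ν / d + 1) (by positivity)) (hfc _)
    have h2 : HasDerivAt (fun t : ℝ => t * ν / d) (1 * ν / d) t :=
      ((hasDerivAt_id t).mul_const ν).div_const d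
    have h3 := HasDerivAt.comp (h₂ := F) t h1 h2
    have h4 : HasDerivAt G (f (t * ν / d) * (1 * ν / d)) t := by
      refine h3.congr_of_eventuallyEq ?_
      filter_upwards [Ioi_mem_nhds ht] with s hs
      exact hG s (le_of_lt hs)
    refine h4.congr_deriv ?_
    have e1 : 1 + d * (t * ν / d) / ν = 1 + t := by field_simp
    have e2 : (t * ν / d) ^ (d / 2 - 1) = t ^ (d/2) / t * ((ν / d) ^ (d / 2) / (ν / d)) := by
      rw [mul_div_assoc, Real.mul_rpow ht.le (by positivity), Real.rpow_sub_one ht.ne',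
        Real.rpow_sub_one (by positivity)]
    have e3 : (d / ν) ^ (d / 2) * (ν / d) ^ (d / 2) = 1 := by
      rw [← Real.mul_rpow (by positivity) (by positivity)]
      rw [div_mul_div_comm, mul_comm, div_self (by positivity), Real.one_rpow]
    simp only [hf]
    rw [e1, e2]
    generalize (1 + t) ^ (-((d + ν) / 2)) = Z
    generalize t ^ (d / 2) = T
    generalize (d / ν) ^ (d / 2) = U at *
    generalize (ν / d) ^ (d / 2) = V at *
    field_simp
    linear_combination T * Z * e3
  have hGc : ContinuousOn G (Ici 0) := by
    intro t ht
    have ht : 0 ≤ t := ht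
    rcases ht.eq_or_lt with h0 | h0
    · subst h0
      have h1 := hc_prim (R := ν / d) (by positivity) (hint _ (by positivity)) 0
        ⟨le_rfl, by positivity⟩
      have h2 : ContinuousWithinAt G (Icc 0 1) 0 := by
        have h3 : ContinuousWithinAt (F ∘ fun t : ℝ => t * ν / d) (Icc 0 1) 0 := by
          apply ContinuousWithinAt.comp (t := Icc 0 (ν / d))
          · simpa using h1
          · exact (by fun_prop : Continuous fun t : ℝ => t * ν / d).continuousWithinAt
          · intro s hs
            refine ⟨by have := hs.1; positivity, ?_⟩
            have := hs.2
            change s * ν / d ≤ ν / d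
            gcongr
            nlinarith
        exact h3.congr (fun s hs => hG s hs.1) (hG 0 le_rfl)
      refine h2.mono_of_mem_nhdsWithin ?_
      exact Icc_mem_nhdsGE zero_lt_one
    · exact (hGder t h0).continuousAt.continuousWithinAt
  refine ⟨hd, hν, hG0, hGc, ?_, hGder, ⟨2 * K, by positivity, fun t _ => rfl⟩⟩
  -- the limit
  set g : ℝ → ℝ := fun x => x ^ (d / 2 - 1) * (1 - x) ^ (ν / 2 - 1) with hg
  have hgi : IntervalIntegrable g volume 0 1 := by
    apply IntervalIntegrable.mul_continuousOn
    · exact intervalIntegral.intervalIntegrable_rpow' (by linarith)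
    · exact (Continuous.rpow_const (by fun_prop) (fun x => Or.inr (by linarith))).continuousOn
  have hgc : ContinuousOn g (Ioo 0 1) := by
    intro x hx
    apply ContinuousAt.continuousWithinAt
    exact ContinuousAt.mul (Real.continuousAt_rpow_const _ _ (Or.inl hx.1.ne'))
      (ContinuousAt.rpow_const (by fun_prop) (Or.inr (by linarith)))
  set I : ℝ → ℝ := fun y => ∫ x in (0:ℝ)..y, g x with hI
  have hIc := hc_prim zero_lt_one hgi
  have hI1 : K * I 1 = 1 := by
    have h1 := Real.Gamma_pos_of_pos (show 0 < (d + ν) / 2 by positivity)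
    have h2 := Real.Gamma_pos_of_pos (show 0 < d / 2 by positivity)
    have h3 := Real.Gamma_pos_of_pos (show 0 < ν / 2 by positivity)
    simp only [hI, hg]
    rw [hc_beta_int (by positivity) (by positivity), hK, ProbabilityTheory.beta]
    rw [← add_div]
    field_simp
  have hmap : ∀ t : ℝ, 0 ≤ t → t / (1 + t) ∈ Icc (0:ℝ) 1 := by
    intro t ht
    refine ⟨by positivity, ?_⟩
    rw [div_le_one (by positivity)]; linarith
  have hJc : ContinuousOn (fun t => K * I (t / (1 + t))) (Ici 0) := by
    apply ContinuousOn.mul continuousOn_const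
    refine ContinuousOn.comp (t := Icc 0 1) hIc ?_ (fun t ht => hmap t ht)
    intro t ht
    have ht : 0 ≤ t := ht
    apply ContinuousAt.continuousWithinAt
    apply ContinuousAt.div (by fun_prop) (by fun_prop) (by positivity)
  have hJd : ∀ t, 0 < t → HasDerivAt (fun t => K * I (t / (1 + t)))
      ((2 * K * t ^ (d / 2) * (1 + t) ^ (-((d + ν) / 2))) / (2 * t)) t := by
    intro t ht
    have ht1 : 0 < 1 + t := by linarith
    have h1 := hc_prim_der (y := t / (1 + t)) (by positivity)
      (by rw [div_lt_one ht1]; linarith) hgi hgc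
    have h2 : HasDerivAt (fun t : ℝ => t / (1 + t)) ((1 * (1 + t) - t * 1) / (1 + t) ^ 2) t :=
      (hasDerivAt_id t).div ((hasDerivAt_id t).const_add 1) ht1.ne'
    have h3 := (HasDerivAt.comp (h₂ := I) t h1 h2).const_mul K
    refine h3.congr_deriv ?_
    have e0 : 1 - t / (1 + t) = (1 + t)⁻¹ := by field_simp; ring
    have e2 : g (t / (1 + t)) = t ^ (d / 2) / t * (1 + t) ^ (-((d + ν) / 2)) * (1 + t) ^ 2 := by
      simp only [hg]
      rw [e0, div_eq_mul_inv, Real.mul_rpow ht.le (by positivity), Real.inv_rpow ht1.le,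
        Real.inv_rpow ht1.le, ← Real.rpow_neg ht1.le, ← Real.rpow_neg ht1.le,
        Real.rpow_sub_one ht.ne', mul_assoc, mul_assoc, ← Real.rpow_add ht1, ← Real.rpow_two,
        ← Real.rpow_add ht1]
      congr 2
      ring
    rw [e2]
    field_simp
    ring
  have heq : ∀ t, 0 < t → G t = K * I (t / (1 + t)) := by
    intro t ht
    have h0 : (Icc 0 t) ⊆ Ici 0 := Icc_subset_Ici_self
    obtain ⟨x, hx, hxe⟩ := exists_hasDerivAt_eq_slope (fun t => G t - K * I (t / (1 + t)))
      (fun _ => 0) ht ((hGc.mono h0).sub (hJc.mono h0))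
      (fun x hx => ((hGder x hx.1).sub (hJd x hx.1)).congr_deriv (sub_self _))
    have hI0 : I 0 = 0 := by simp [hI]
    have h2 : G 0 - K * I (0 / (1 + 0)) = 0 := by rw [zero_div, hI0, hG0]; ring
    rw [h2, eq_comm, div_eq_zero_iff] at hxe
    rcases hxe with h3 | h3 <;> linarith
  have hlim1 : Tendsto (fun t : ℝ => t / (1 + t)) atTop (𝓝 1) := by
    have : Tendsto (fun t : ℝ => 1 - (1 + t)⁻¹) atTop (𝓝 (1 - 0)) :=
      tendsto_const_nhds.sub (tendsto_inv_atTop_zero.comp (tendsto_atTop_add_const_left _ _ tendsto_id))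
    rw [sub_zero] at this
    refine this.congr' ?_
    filter_upwards [eventually_gt_atTop 0] with t ht
    field_simp
    ring
  have hlim2 : Tendsto (fun t : ℝ => t / (1 + t)) atTop (𝓝[Icc 0 1] 1) := by
    rw [tendsto_nhdsWithin_iff]
    refine ⟨hlim1, ?_⟩
    filter_upwards [eventually_ge_atTop 0] with t ht using hmap t ht
  have hlim3 := ((hIc 1 ⟨zero_le_one, le_rfl⟩).tendsto.comp hlim2).const_mul K
  have hlim4 : Tendsto (fun t => K * I (t / (1 + t))) atTop (𝓝 1) := by
    rw [show K * (∫ x in (0:ℝ)..1, g x) = 1 from hI1] at hlim3; exact hlim3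
  refine hlim4.congr' ?_
  filter_upwards [eventually_gt_atTop 0] with t ht using (heq t ht).symm

lemma hotelling_data (d k : ℕ) (hd : 1 ≤ d) (hk : d + 1 ≤ k) :
    ∃ γ, HCData (d:ℝ) ((k + 1 - d : ℕ) : ℝ) (fun t => hotellingCDF d k (k * t)) γ := by
  have hc : ((k + 1 - d : ℕ) : ℝ) = (k:ℝ) + 1 - d := by
    rw [Nat.cast_sub (by omega)]; push_cast; rfl
  have hd' : (1:ℝ) ≤ d := by exact_mod_cast hd
  have hk' : (d:ℝ) + 1 ≤ k := by exact_mod_cast hk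
  refine ⟨_, hc_data_aux hd' (by rw [hc]; linarith) rfl ?_⟩
  intro t ht
  have hk0 : (0:ℝ) < k := by linarith
  rw [hc]
  have h1 : ¬ ((k:ℝ) * t < 0) := not_lt.2 (by positivity)
  have h2 : (k:ℝ) * t * ((k:ℝ) + 1 - d) / (d * k) = t * ((k:ℝ) + 1 - d) / d := by
    field_simp
  have h3 : (d:ℝ) + ((k:ℝ) + 1 - d) = k + 1 := by ring
  simp only [hotellingCDF, if_neg h1]
  rw [h2, h3]

lemma hc_factor {n : ℕ} {A : Matrix (Fin n) (Fin n) ℝ} (hA : A.PosDef) :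
    ∃ B : Matrix (Fin n) (Fin n) ℝ, (∀ v : Fin n → ℝ,
      v ⬝ᵥ A.mulVec v = ‖(WithLp.toLp 2 (B.mulVec v) : EuclideanSpace ℝ (Fin n))‖ ^ 2) ∧
      IsUnit B := by
  open scoped MatrixOrder in
  obtain ⟨B, hB⟩ := CStarAlgebra.nonneg_iff_eq_star_mul_self.mp hA.posSemidef.nonneg
  refine ⟨B, fun v => ?_, ?_⟩
  · rw [EuclideanSpace.norm_sq_eq]
    have h1 : v ⬝ᵥ A.mulVec v = B.mulVec v ⬝ᵥ B.mulVec v := by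
      rw [hB, ← Matrix.mulVec_mulVec, Matrix.dotProduct_mulVec, Matrix.star_eq_conjTranspose,
        Matrix.vecMul_conjTranspose]
      simp
    rw [h1]
    simp [dotProduct, sq]
  · have h1 := hA.isUnit
    rw [hB] at h1
    rw [Matrix.isUnit_iff_isUnit_det] at h1 ⊢
    rw [Matrix.det_mul] at h1
    exact isUnit_of_mul_isUnit_right h1

/-- one summand of the score: convexity, nonnegativity, coercivity -/
lemma hc_term {d n k : ℕ} (hn : 1 ≤ n) (hk : n + 1 ≤ k) (P : Matrix (Fin n) (Fin d) ℝ)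
    (ξ : Fin n → ℝ) {A : Matrix (Fin n) (Fin n) ℝ} (hA : A.PosDef) :
    ConvexOn ℝ univ (fun θ : Fin d → ℝ => Real.tan (π / 2 * hotellingCDF n k
      ((ξ - P.mulVec θ) ⬝ᵥ A.mulVec (ξ - P.mulVec θ)))) ∧
    (∀ θ : Fin d → ℝ, 0 ≤ Real.tan (π / 2 * hotellingCDF n k
      ((ξ - P.mulVec θ) ⬝ᵥ A.mulVec (ξ - P.mulVec θ)))) ∧
    (∀ c : ℝ, ∃ C : ℝ, ∀ θ : Fin d → ℝ, Real.tan (π / 2 * hotellingCDF n k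
      ((ξ - P.mulVec θ) ⬝ᵥ A.mulVec (ξ - P.mulVec θ))) ≤ c → ∀ i, |P i ⬝ᵥ θ| ≤ C) := by
  obtain ⟨γ, h⟩ := hotelling_data n k hn hk
  obtain ⟨B, hB, hBu⟩ := hc_factor hA
  have hk0 : (0:ℝ) < k := by exact_mod_cast (by omega : 0 < k)
  set r : (Fin d → ℝ) → ℝ := fun θ =>
    ‖(WithLp.toLp 2 (B.mulVec (ξ - P.mulVec θ)) : EuclideanSpace ℝ (Fin n))‖ / √k with hr
  have hr0 : ∀ θ, 0 ≤ r θ := fun θ => by positivity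
  have hQ : ∀ θ : Fin d → ℝ, (ξ - P.mulVec θ) ⬝ᵥ A.mulVec (ξ - P.mulVec θ) = k * r θ ^ 2 := by
    intro θ
    rw [hB, hr]
    simp only [div_pow]
    rw [Real.sq_sqrt hk0.le]
    field_simp
  have hrc : ConvexOn ℝ univ r := by
    refine ⟨convex_univ, ?_⟩
    intro x _ y _ a b ha hb hab
    simp only [hr, smul_eq_mul]
    have e : (WithLp.toLp 2 (B.mulVec (ξ - P.mulVec (a • x + b • y))) : EuclideanSpace ℝ (Fin n))
        = a • WithLp.toLp 2 (B.mulVec (ξ - P.mulVec x)) +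
          b • WithLp.toLp 2 (B.mulVec (ξ - P.mulVec y)) := by
      rw [← WithLp.toLp_smul, ← WithLp.toLp_smul, ← WithLp.toLp_add]
      congr 1
      rw [← Matrix.mulVec_smul, ← Matrix.mulVec_smul, ← Matrix.mulVec_add]
      congr 1
      rw [Matrix.mulVec_add, Matrix.mulVec_smul, Matrix.mulVec_smul]
      have : ξ = a • ξ + b • ξ := by rw [← add_smul, hab, one_smul]
      conv_lhs => rw [this]
      module
    rw [e, ← mul_div_assoc, ← mul_div_assoc, ← add_div]
    gcongr
    refine (norm_add_le _ _).trans ?_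
    rw [norm_smul, norm_smul, Real.norm_of_nonneg ha, Real.norm_of_nonneg hb]
  simp only [hQ]
  refine ⟨?_, ?_, ?_⟩
  · have hcv := HCData.convex_tan _ _ h
    have hmo := h.mono_tan
    have himg : r '' univ ⊆ Ici 0 := by
      rintro _ ⟨θ, _, rfl⟩; exact hr0 θ
    refine ⟨convex_univ, ?_⟩
    intro x _ y _ a b ha hb hab
    have h1 := hrc.2 (mem_univ x) (mem_univ y) ha hb hab
    have h2 := hcv.2 (mem_Ici.2 (hr0 x)) (mem_Ici.2 (hr0 y)) ha hb hab
    refine le_trans ?_ h2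
    refine hmo (hr0 _) ?_ h1
    have := hr0 x
    have := hr0 y
    simp only [smul_eq_mul, mem_Ici]
    positivity
  · exact fun θ => h.tan_nonneg' (sq_nonneg _)
  · intro c
    obtain ⟨M, hM⟩ := h.tan_bdd c
    -- bounded linear image
    obtain ⟨u, hu⟩ := hBu
    have hinv : ∀ v, B⁻¹.mulVec (B.mulVec v) = v := by
      intro v
      rw [Matrix.mulVec_mulVec, Matrix.nonsing_inv_mul, Matrix.one_mulVec]
      rw [← Matrix.isUnit_iff_isUnit_det]; exact ⟨u, hu⟩
    set T := k * M with hT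
    have hcoord : ∀ θ, Real.tan (π / 2 * hotellingCDF n k (k * r θ ^ 2)) ≤ c →
        ∀ l, |B.mulVec (ξ - P.mulVec θ) l| ≤ √T := by
      intro θ hθ l
      have h1 := hM (r θ ^ 2) (sq_nonneg _) hθ
      have h2 : ‖(WithLp.toLp 2 (B.mulVec (ξ - P.mulVec θ)) : EuclideanSpace ℝ (Fin n))‖ ^ 2 ≤ T := by
        rw [← hB, hQ]
        exact mul_le_mul_of_nonneg_left h1 hk0.le
      have h3 := PiLp.norm_apply_le
        (WithLp.toLp 2 (B.mulVec (ξ - P.mulVec θ)) : EuclideanSpace ℝ (Fin n)) l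
      exact h3.trans (Real.le_sqrt_of_sq_le h2)
    have hfin : ∀ i, ∀ θ, Real.tan (π / 2 * hotellingCDF n k (k * r θ ^ 2)) ≤ c →
        |P i ⬝ᵥ θ| ≤ |ξ i| + ∑ l, |B⁻¹ i l| * √T := by
      intro i θ hθ
      have h1 : P i ⬝ᵥ θ = ξ i - ∑ l, B⁻¹ i l * B.mulVec (ξ - P.mulVec θ) l := by
        have := congrFun (hinv (ξ - P.mulVec θ)) i
        have h2 : ∑ l, B⁻¹ i l * B.mulVec (ξ - P.mulVec θ) l = ξ i - P i ⬝ᵥ θ := this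
        linarith
      rw [h1]
      refine (abs_sub _ _).trans ?_
      gcongr
      refine (Finset.abs_sum_le_sum_abs _ _).trans ?_
      gcongr with l
      rw [abs_mul]
      gcongr
      exact hcoord θ hθ l
    refine ⟨∑ i, (|ξ i| + ∑ l, |B⁻¹ i l| * √T), fun θ hθ i => (hfin i θ hθ).trans ?_⟩
    exact Finset.single_le_sum (f := fun i => |ξ i| + ∑ l, |B⁻¹ i l| * √T)
      (fun i _ => by positivity) (Finset.mem_univ i)

lemma hc_bdd_of_span {d : ℕ} {S : Set (Fin d → ℝ)} {R : Set (Fin d → ℝ)}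
    (hR : Submodule.span ℝ R = ⊤) (h : ∀ v ∈ R, ∃ C : ℝ, ∀ θ ∈ S, |v ⬝ᵥ θ| ≤ C) :
    Bornology.IsBounded S := by
  have hall : ∀ v ∈ Submodule.span ℝ R, ∃ C : ℝ, ∀ θ ∈ S, |v ⬝ᵥ θ| ≤ C := by
    intro v hv
    induction hv using Submodule.span_induction with
    | mem x hx => exact h x hx
    | zero => exact ⟨0, fun θ _ => by simp⟩
    | add x y _ _ hx hy =>
      obtain ⟨C, hC⟩ := hx
      obtain ⟨D, hD⟩ := hy
      refine ⟨C + D, fun θ hθ => ?_⟩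
      rw [add_dotProduct]
      exact (abs_add_le _ _).trans (add_le_add (hC θ hθ) (hD θ hθ))
    | smul a x _ hx =>
      obtain ⟨C, hC⟩ := hx
      refine ⟨|a| * C, fun θ hθ => ?_⟩
      rw [smul_dotProduct, smul_eq_mul, abs_mul]
      exact mul_le_mul_of_nonneg_left (hC θ hθ) (abs_nonneg a)
  have hco : ∀ i : Fin d, ∃ C : ℝ, ∀ θ ∈ S, |θ i| ≤ C := by
    intro i
    obtain ⟨C, hC⟩ := hall (Pi.single i 1) (by rw [hR]; trivial)
    refine ⟨C, fun θ hθ => ?_⟩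
    simpa using hC θ hθ
  choose C hC using hco
  rw [isBounded_iff_forall_norm_le]
  refine ⟨∑ i, |C i|, fun θ hθ => ?_⟩
  rw [pi_norm_le_iff_of_nonneg (by positivity)]
  intro i
  rw [Real.norm_eq_abs]
  refine (hC i θ hθ).trans ((le_abs_self _).trans ?_)
  exact Finset.single_le_sum (f := fun i => |C i|) (fun i _ => abs_nonneg _) (Finset.mem_univ i)

end HCProof

/-- Theorem 2.2 (HCCT case): the sublevel sets of the multivariate Half-Cauchy combination test
score are convex; and bounded when the rows of the design matrices with positive weight
span `ℝ^d`. -/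
theorem multivariate_hcct_convex_bounded
    (d m : ℕ) (hd : 1 ≤ d) (hm : 1 ≤ m)
    (d' : Fin m → ℕ) (hd'1 : ∀ j, 1 ≤ d' j) (hd'2 : ∀ j, d' j ≤ d)
    (k : Fin m → ℕ) (hk : ∀ j, d' j + 1 ≤ k j)
    (P : (j : Fin m) → Matrix (Fin (d' j)) (Fin d) ℝ)
    (hrank : ∀ j, (P j).rank = d' j)
    (ξ : (j : Fin m) → Fin (d' j) → ℝ)
    (Sig : (j : Fin m) → Matrix (Fin (d' j)) (Fin (d' j)) ℝ)
    (hSig : ∀ j, (Sig j).PosDef)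
    (w : Fin m → ℝ) (hw : ∀ j, 0 ≤ w j) (hwsum : ∑ j, w j = 1) (c : ℝ) :
    Convex ℝ {θ : Fin d → ℝ | ∑ j, w j *
        Real.tan (π / 2 * hotellingCDF (d' j) (k j)
          ((ξ j - (P j).mulVec θ) ⬝ᵥ ((Sig j)⁻¹).mulVec (ξ j - (P j).mulVec θ))) ≤ c} ∧
      (Submodule.span ℝ {v : Fin d → ℝ | ∃ j, 0 < w j ∧ ∃ i, v = (P j) i} = ⊤ →
        Bornology.IsBounded {θ : Fin d → ℝ | ∑ j, w j *
          Real.tan (π / 2 * hotellingCDF (d' j) (k j)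
            ((ξ j - (P j).mulVec θ) ⬝ᵥ ((Sig j)⁻¹).mulVec (ξ j - (P j).mulVec θ))) ≤ c}) := by

  have ht := fun j => HCProof.hc_term (hd'1 j) (hk j) (P j) (ξ j) (hSig j).inv
  constructor
  · have hcv : ConvexOn ℝ Set.univ (fun θ : Fin d → ℝ => ∑ j, w j *
        Real.tan (π / 2 * hotellingCDF (d' j) (k j)
          ((ξ j - (P j).mulVec θ) ⬝ᵥ ((Sig j)⁻¹).mulVec (ξ j - (P j).mulVec θ)))) := by
      refine ⟨convex_univ, ?_⟩
      intro x _ y _ a b ha hb hab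
      simp only [smul_eq_mul]
      rw [Finset.mul_sum, Finset.mul_sum, ← Finset.sum_add_distrib]
      refine Finset.sum_le_sum fun j _ => ?_
      have h1 := (ht j).1.2 (Set.mem_univ x) (Set.mem_univ y) ha hb hab
      simp only [smul_eq_mul] at h1
      have h2 := mul_le_mul_of_nonneg_left h1 (hw j)
      refine h2.trans (le_of_eq ?_)
      ring
    have := hcv.convex_le c
    simpa using this
  · intro hspan
    refine HCProof.hc_bdd_of_span hspan ?_
    rintro v ⟨j, hwj, i, rfl⟩
    obtain ⟨C, hC⟩ := (ht j).2.2 (c / w j)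
    refine ⟨C, fun θ hθ => hC θ ?_ i⟩
    rw [le_div_iff₀ hwj, mul_comm]
    refine le_trans ?_ hθ
    exact Finset.single_le_sum (f := fun j => w j *
        Real.tan (π / 2 * hotellingCDF (d' j) (k j)
          ((ξ j - (P j).mulVec θ) ⬝ᵥ ((Sig j)⁻¹).mulVec (ξ j - (P j).mulVec θ))))
      (fun l _ => mul_nonneg (hw l) ((ht l).2.1 θ)) (Finset.mem_univ j)
end

section
/- Let d ≥ 1 and m ≥ 1. For each j = 1,…,m let d_j be an integer with 1 ≤ d_j ≤ d, let k_j be an integer with k_j ≥ d_j + 1, let P_j be a real d_j × d matrix of rank d_j, let ξ̂_j ∈ ℝ^{d_j}, let Σ̂_j be a symmetric positive definite d_j × d_j real matrix, and let w_j ≥ 0 with ∑_{j=1}^m w_j = 1. For θ ∈ ℝ^d set Q_j(θ) = (ξ̂_j − P_jθ)ᵀ Σ̂_j^{−1} (ξ̂_j − P_jθ) and S(θ) = ∑_{j=1}^m w_j / (1 − H_{d_j,k_j}(Q_j(θ))). Then for every c ∈ ℝ the set {θ ∈ ℝ^d : S(θ) ≤ c} is convex; moreover, if the rows of the matrices {P_j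 : w_j > 0} span ℝ^d, then this set is bounded. -/
open MeasureTheory Real Matrix

noncomputable def bpDens (α β y : ℝ) : ℝ :=
  1 / ProbabilityTheory.beta α β * y ^ (α - 1) * (1 + y) ^ (-(α + β))

lemma bp_image : (fun y : ℝ => y / (1 + y)) '' Set.Ioi 0 = Set.Ioo 0 1 := by
  ext z
  simp only [Set.mem_image, Set.mem_Ioi, Set.mem_Ioo]
  constructor
  · rintro ⟨y, hy, rfl⟩
    exact ⟨by positivity, by rw [div_lt_one (by positivity)]; linarith⟩
  · rintro ⟨h0, h1⟩
    have : 0 < 1 - z := by linarith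
    refine ⟨z / (1 - z), by positivity, ?_⟩
    field_simp
    ring

lemma bp_hasDeriv (y : ℝ) (hy : 0 < y) :
    HasDerivAt (fun y : ℝ => y / (1 + y)) (1 / (1 + y) ^ 2) y := by
  have h := (hasDerivAt_id' y).fun_div ((hasDerivAt_id' y).const_add 1) (by positivity)
  have e : 1 / (1 + y) ^ 2 = (1 * (1 + y) - y * 1) / (1 + y) ^ 2 := by ring
  rw [e]
  exact h

lemma bp_inj : Set.InjOn (fun y : ℝ => y / (1 + y)) (Set.Ioi 0) := by
  intro a ha b hb h
  simp only [Set.mem_Ioi] at ha hb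
  simp only at h
  field_simp at h
  linarith

lemma bp_pull (α β y : ℝ) (hy : 0 < y) :
    |1 / (1 + y) ^ 2| • ProbabilityTheory.betaPDFReal α β (y / (1 + y)) = bpDens α β y := by
  have h1 : 0 < 1 + y := by positivity
  have h2 : 1 - y / (1 + y) = (1 + y)⁻¹ := by field_simp; ring
  rw [ProbabilityTheory.betaPDFReal, if_pos ⟨by positivity, by rw [div_lt_one h1]; linarith⟩, h2,
    Real.div_rpow hy.le h1.le, Real.inv_rpow h1.le, abs_of_pos (by positivity), bpDens,
    smul_eq_mul]
  have : (1 + y) ^ (-(α + β)) = ((1+y)^(α-1))⁻¹ * ((1+y)^(β-1))⁻¹ * ((1+y)^(2:ℕ))⁻¹ := by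
    rw [← Real.rpow_neg h1.le, ← Real.rpow_neg h1.le, ← Real.rpow_natCast, ← Real.rpow_neg h1.le,
      ← Real.rpow_add h1, ← Real.rpow_add h1]
    congr 1; push_cast; ring
  rw [this]
  ring

lemma betaPDFReal_integrable {α β : ℝ} (hα : 0 < α) (hβ : 0 < β) :
    Integrable (ProbabilityTheory.betaPDFReal α β) ∧
      ∫ z, ProbabilityTheory.betaPDFReal α β z = 1 := by
  have hn : ∀ z, 0 ≤ ProbabilityTheory.betaPDFReal α β z := by
    intro z
    by_cases h : 0 < z ∧ z < 1
    · exact (ProbabilityTheory.betaPDFReal_pos h.1 h.2 hα hβ).le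
    · rw [ProbabilityTheory.betaPDFReal, if_neg h]
  have h1 := ProbabilityTheory.lintegral_betaPDF_eq_one hα hβ
  have hm := (ProbabilityTheory.measurable_betaPDFReal α β).aestronglyMeasurable (μ := volume)
  constructor
  · refine ⟨hm, ?_⟩
    rw [hasFiniteIntegral_iff_ofReal (Filter.Eventually.of_forall hn)]
    change ∫⁻ x, ProbabilityTheory.betaPDF α β x < _
    rw [h1]; simp
  · rw [integral_eq_lintegral_of_nonneg_ae (Filter.Eventually.of_forall hn) hm]
    change (∫⁻ x, ProbabilityTheory.betaPDF α β x).toReal = _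
    rw [h1]; simp

lemma bp_integrable {α β : ℝ} (hα : 0 < α) (hβ : 0 < β) :
    IntegrableOn (bpDens α β) (Set.Ioi 0) := by
  have h := (integrableOn_image_iff_integrableOn_abs_deriv_smul measurableSet_Ioi
    (fun y hy => (bp_hasDeriv y hy).hasDerivWithinAt) bp_inj
    (ProbabilityTheory.betaPDFReal α β)).1 (betaPDFReal_integrable hα hβ).1.integrableOn
  exact h.congr_fun (fun y hy => bp_pull α β y hy) measurableSet_Ioi

lemma bp_integral {α β : ℝ} (hα : 0 < α) (hβ : 0 < β) :
    ∫ y in Set.Ioi 0, bpDens α β y = 1 := by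
  have h := integral_image_eq_integral_abs_deriv_smul measurableSet_Ioi
    (fun y hy => (bp_hasDeriv y hy).hasDerivWithinAt) bp_inj
    (ProbabilityTheory.betaPDFReal α β)
  rw [setIntegral_congr_fun measurableSet_Ioi (fun y hy => bp_pull α β y hy), bp_image] at h
  rw [← h]
  refine Eq.trans ?_ (betaPDFReal_integrable hα hβ).2
  apply setIntegral_eq_integral_of_forall_compl_eq_zero
  intro z hz
  unfold ProbabilityTheory.betaPDFReal
  exact if_neg hz

lemma bp_pos {α β y : ℝ} (hα : 0 < α) (hβ : 0 < β) (hy : 0 < y) : 0 < bpDens α β y := by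
  have := ProbabilityTheory.beta_pos hα hβ
  unfold bpDens; positivity

noncomputable def bpCDF (α β y : ℝ) : ℝ := ∫ x in (0:ℝ)..y, bpDens α β x

lemma bpCDF_tendsto {α β : ℝ} (hα : 0 < α) (hβ : 0 < β) :
    Filter.Tendsto (bpCDF α β) Filter.atTop (nhds 1) := by
  rw [← bp_integral hα hβ]
  exact intervalIntegral_tendsto_integral_Ioi 0 (bp_integrable hα hβ) Filter.tendsto_id

lemma bp_intervalIntegrable {α β : ℝ} (hα : 0 < α) (hβ : 0 < β) {a b : ℝ} (ha : 0 ≤ a)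
    (hb : 0 ≤ b) : IntervalIntegrable (bpDens α β) volume a b := by
  rw [intervalIntegrable_iff]
  exact (bp_integrable hα hβ).mono_set (fun x hx => lt_of_le_of_lt (le_min ha hb) hx.1)

lemma bpCDF_hasDerivAt {α β y : ℝ} (hα : 0 < α) (hβ : 0 < β) (hy : 0 < y) :
    HasDerivAt (bpCDF α β) (bpDens α β y) y := by
  have hc : ∀ x : ℝ, 0 < x → ContinuousAt (bpDens α β) x := by
    intro x hx
    unfold bpDens
    have h1 : ContinuousAt (fun x : ℝ => x ^ (α - 1)) x :=
      Real.continuousAt_rpow_const _ _ (Or.inl hx.ne')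
    have h2 : ContinuousAt (fun x : ℝ => (1 + x) ^ (-(α + β))) x :=
      ContinuousAt.rpow_const (by fun_prop) (Or.inl (by positivity))
    exact (continuousAt_const.mul h1).mul h2
  refine intervalIntegral.integral_hasDerivAt_right (bp_intervalIntegrable hα hβ le_rfl hy.le)
    ?_ (hc y hy)
  exact ContinuousOn.stronglyMeasurableAtFilter isOpen_Ioi
    (fun x hx => (hc x hx).continuousWithinAt) y hy

lemma bpCDF_continuousOn {α β : ℝ} (hα : 0 < α) (hβ : 0 < β) :
    ContinuousOn (bpCDF α β) (Set.Ici 0) := by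
  intro y hy
  have hy' : (0:ℝ) ≤ y := hy
  have h := intervalIntegral.continuousOn_primitive_interval' (μ := volume) (f := bpDens α β)
    (a := 0) (b₁ := 0) (b₂ := y + 1) (bp_intervalIntegrable hα hβ le_rfl (by linarith)) (by simp)
  rw [Set.uIcc_of_le (by linarith)] at h
  refine (h y ⟨hy', by linarith⟩).mono_of_mem_nhdsWithin ?_
  have := inter_mem_nhdsWithin (Set.Ici (0:ℝ)) (Iic_mem_nhds (show y < y + 1 by linarith))
  exact this

lemma bpCDF_strictMono {α β : ℝ} (hα : 0 < α) (hβ : 0 < β) :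
    StrictMonoOn (bpCDF α β) (Set.Ici 0) := by
  refine strictMonoOn_of_deriv_pos (convex_Ici 0) (bpCDF_continuousOn hα hβ) ?_
  intro x hx
  rw [interior_Ici] at hx
  rw [(bpCDF_hasDerivAt hα hβ hx).deriv]
  exact bp_pos hα hβ hx

lemma bpCDF_lt_one {α β y : ℝ} (hα : 0 < α) (hβ : 0 < β) (hy : 0 ≤ y) : bpCDF α β y < 1 := by
  have h1 : bpCDF α β y < bpCDF α β (y + 1) :=
    bpCDF_strictMono hα hβ hy (show (0:ℝ) ≤ y + 1 by linarith) (by linarith)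
  refine lt_of_lt_of_le h1 (ge_of_tendsto (bpCDF_tendsto hα hβ) ?_)
  filter_upwards [Filter.eventually_ge_atTop (y + 1)] with z hz
  exact (bpCDF_strictMono hα hβ).monotoneOn (show (0:ℝ) ≤ y + 1 by linarith)
    (show (0:ℝ) ≤ z by linarith) hz

noncomputable def rDens (α β t : ℝ) : ℝ := 2 * t * bpDens α β (t ^ 2)

noncomputable def rU (α β t : ℝ) : ℝ := 2 * (α + β) * t / (1 + t ^ 2) - (2 * α - 1) / t

lemma rDens_hasDerivAt {α β t : ℝ} (ht : 0 < t) :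
    HasDerivAt (rDens α β) (-(rU α β t * rDens α β t)) t := by
  have ht2 : 0 < t ^ 2 := by positivity
  have h1t : 0 < 1 + t ^ 2 := by positivity
  have hs : HasDerivAt (fun t : ℝ => t ^ 2) (2 * t) t := by simpa using hasDerivAt_pow 2 t
  have hA := hs.rpow_const (p := α - 1) (Or.inl ht2.ne')
  have hB := (hs.const_add 1).rpow_const (p := -(α + β)) (Or.inl h1t.ne')
  have h := ((hasDerivAt_id' t).const_mul 2).fun_mul
    ((hA.const_mul (1 / ProbabilityTheory.beta α β)).fun_mul hB)
  have h' : HasDerivAt (rDens α β) _ t := h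
  convert h' using 1
  unfold rDens rU bpDens
  rw [Real.rpow_sub_one ht2.ne' (α - 1), Real.rpow_sub_one h1t.ne']
  field_simp
  ring

lemma rU_hasDerivAt {α β t : ℝ} (ht : 0 < t) :
    HasDerivAt (rU α β)
      (2 * (α + β) * (1 - t ^ 2) / (1 + t ^ 2) ^ 2 + (2 * α - 1) / t ^ 2) t := by
  have h1t : 0 < 1 + t ^ 2 := by positivity
  have hs : HasDerivAt (fun t : ℝ => t ^ 2) (2 * t) t := by simpa using hasDerivAt_pow 2 t
  have h := (((hasDerivAt_id' t).const_mul (2 * (α + β))).fun_div (hs.const_add 1) h1t.ne').fun_sub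
    ((hasDerivAt_const t (2 * α - 1)).fun_div (hasDerivAt_id' t) ht.ne')
  have h' : HasDerivAt (rU α β) _ t := h
  convert h' using 1
  field_simp
  ring

lemma quad_nonneg (a e s : ℝ) (ha : 3 ≤ a) (he : e = 0 ∨ 1 ≤ e) (hs : 0 < s) :
    0 ≤ a * (a - 2) * s ^ 2 + s * (-2 * e * a + 2 * a + 6 * e) + e ^ 2 + 2 * e := by
  rcases he with rfl | he
  · have : 0 ≤ a * (a - 2) * s ^ 2 := mul_nonneg (by nlinarith) (by positivity)
    nlinarith
  · have hA : 0 < a * (a - 2) := by nlinarith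
    have hD : (-e * a + a + 3 * e) ^ 2 ≤ a * (a - 2) * (e ^ 2 + 2 * e) := by
      have h1 : 0 ≤ a * e * (e + 3 * a - 10) :=
        mul_nonneg (by nlinarith) (by linarith)
      have h2 : 0 ≤ e ^ 2 * (3 * a - 9) := mul_nonneg (by positivity) (by linarith)
      have h3 : 0 ≤ a ^ 2 * (e - 1) := mul_nonneg (by positivity) (by linarith)
      nlinarith
    have h4 : 0 ≤ (a * (a - 2)) * (a * (a - 2) * s ^ 2 + s * (-2 * e * a + 2 * a + 6 * e)
        + e ^ 2 + 2 * e) := by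
      have := sq_nonneg (a * (a - 2) * s + (-e * a + a + 3 * e))
      nlinarith
    exact nonneg_of_mul_nonneg_right h4 hA

lemma rU_ineq {α β t : ℝ} (hα : 2 * α - 1 = 0 ∨ 1 ≤ 2 * α - 1) (hβ : 1 ≤ β) (ht : 0 < t) :
    0 ≤ rU α β t ^ 2 +
      2 * (2 * (α + β) * (1 - t ^ 2) / (1 + t ^ 2) ^ 2 + (2 * α - 1) / t ^ 2) := by
  have h := quad_nonneg (2 * β + 1) (2 * α - 1) (t ^ 2) (by linarith) hα (by positivity)
  have : rU α β t ^ 2 +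
      2 * (2 * (α + β) * (1 - t ^ 2) / (1 + t ^ 2) ^ 2 + (2 * α - 1) / t ^ 2) =
      ((2 * β + 1) * ((2 * β + 1) - 2) * (t ^ 2) ^ 2 + t ^ 2 * (-2 * (2 * α - 1) * (2 * β + 1) +
        2 * (2 * β + 1) + 6 * (2 * α - 1)) + (2 * α - 1) ^ 2 + 2 * (2 * α - 1)) /
        (t ^ 2 * (1 + t ^ 2) ^ 2) := by
    unfold rU
    field_simp
    ring
  rw [this]
  positivity

lemma rU_pos_iff {α β t : ℝ} (ht : 0 < t) :
    0 < rU α β t ↔ 2 * α - 1 < (2 * β + 1) * t ^ 2 := by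
  have : rU α β t = ((2 * β + 1) * t ^ 2 - (2 * α - 1)) / (t * (1 + t ^ 2)) := by
    unfold rU
    field_simp
    ring
  rw [this, div_pos_iff_of_pos_right (by positivity)]
  exact sub_pos

lemma rDens_pos {α β t : ℝ} (hα : 0 < α) (hβ : 0 < β) (ht : 0 < t) : 0 < rDens α β t := by
  have := bp_pos (y := t ^ 2) hα hβ (by positivity)
  unfold rDens; positivity

noncomputable def rSurv (α β t : ℝ) : ℝ := 1 - bpCDF α β (t ^ 2)

lemma rSurv_pos {α β : ℝ} (hα : 0 < α) (hβ : 0 < β) (t : ℝ) : 0 < rSurv α β t :=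
  sub_pos.2 (bpCDF_lt_one hα hβ (by positivity))

lemma rSurv_tendsto {α β : ℝ} (hα : 0 < α) (hβ : 0 < β) :
    Filter.Tendsto (rSurv α β) Filter.atTop (nhds 0) := by
  have h := ((bpCDF_tendsto hα hβ).comp
    (Filter.tendsto_pow_atTop (α := ℝ) (n := 2) two_ne_zero)).const_sub 1
  rw [sub_self] at h
  exact h

lemma rSurv_hasDerivAt {α β t : ℝ} (hα : 0 < α) (hβ : 0 < β) (ht : 0 < t) :
    HasDerivAt (rSurv α β) (-rDens α β t) t := by
  have hs : HasDerivAt (fun t : ℝ => t ^ 2) (2 * t) t := by simpa using hasDerivAt_pow 2 t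
  have h := ((bpCDF_hasDerivAt (y := t ^ 2) hα hβ (by positivity)).comp t hs).const_sub 1
  have h' : HasDerivAt (rSurv α β) _ t := h
  convert h' using 1
  unfold rDens; ring

lemma rSurv_continuousOn {α β : ℝ} (hα : 0 < α) (hβ : 0 < β) :
    Continuous (rSurv α β) := by
  unfold rSurv
  refine continuous_const.sub ?_
  exact (bpCDF_continuousOn hα hβ).comp_continuous (by fun_prop) (fun t => sq_nonneg t)

lemma rSurv_antitone {α β : ℝ} (hα : 0 < α) (hβ : 0 < β) :
    AntitoneOn (rSurv α β) (Set.Ici 0) := by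
  intro a ha b hb hab
  have := (bpCDF_strictMono hα hβ).monotoneOn (sq_nonneg a) (sq_nonneg b)
    (pow_le_pow_left₀ ha hab 2)
  unfold rSurv; linarith

lemma rSurv_le {α β r : ℝ} (hα0 : 0 < α) (hα : 2 * α - 1 = 0 ∨ 1 ≤ 2 * α - 1) (hβ : 1 ≤ β)
    (hr : 0 < r) (hu : 0 < rU α β r) : rSurv α β r ≤ 2 * rDens α β r / rU α β r := by
  have hβ0 : 0 < β := by linarith
  have hup : ∀ t, r ≤ t → 0 < rU α β t := by
    intro t ht
    rw [rU_pos_iff (by linarith)]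
    rw [rU_pos_iff hr] at hu
    have : r ^ 2 ≤ t ^ 2 := pow_le_pow_left₀ hr.le ht 2
    nlinarith
  have hder : ∀ t, r ≤ t → HasDerivAt (fun t => rSurv α β t - 2 * rDens α β t / rU α β t)
      (-rDens α β t - ((2 * -(rU α β t * rDens α β t)) * rU α β t - 2 * rDens α β t *
        (2 * (α + β) * (1 - t ^ 2) / (1 + t ^ 2) ^ 2 + (2 * α - 1) / t ^ 2)) / rU α β t ^ 2) t := by
    intro t ht
    have ht0 : 0 < t := by linarith
    exact (rSurv_hasDerivAt hα0 hβ0 ht0).fun_sub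
      (((rDens_hasDerivAt ht0).const_mul 2).fun_div (rU_hasDerivAt ht0) (hup t ht).ne')
  have hmono : MonotoneOn (fun t => rSurv α β t - 2 * rDens α β t / rU α β t) (Set.Ici r) := by
    refine monotoneOn_of_deriv_nonneg (convex_Ici r)
      (fun t ht => (hder t ht).continuousAt.continuousWithinAt)
      (fun t ht => (hder t (interior_subset ht)).differentiableAt.differentiableWithinAt) ?_
    intro t ht
    have ht' : r ≤ t := interior_subset ht
    have ht0 : 0 < t := by linarith
    rw [(hder t ht').deriv]
    have h1 := rU_ineq (α := α) (β := β) hα hβ ht0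
    have h2 := rDens_pos hα0 hβ0 ht0
    have h3 := hup t ht'
    generalize (2 * (α + β) * (1 - t ^ 2) / (1 + t ^ 2) ^ 2 + (2 * α - 1) / t ^ 2) = U at *
    have : -rDens α β t - ((2 * -(rU α β t * rDens α β t)) * rU α β t - 2 * rDens α β t *
        U) / rU α β t ^ 2 = rDens α β t * (rU α β t ^ 2 + 2 * U) / rU α β t ^ 2 := by
      field_simp
      ring
    rw [this]
    positivity
  have : rSurv α β r - 2 * rDens α β r / rU α β r ≤ 0 := by
    refine ge_of_tendsto (rSurv_tendsto hα0 hβ0) ?_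
    filter_upwards [Filter.eventually_ge_atTop r] with t ht
    have h1 := hmono (Set.mem_Ici.2 le_rfl) ht ht
    have h2 := rDens_pos (α := α) (β := β) (t := t) hα0 hβ0 (by linarith)
    have h3 := hup t ht
    have : 0 < 2 * rDens α β t / rU α β t := by positivity
    simp only at h1
    linarith
  linarith

lemma rInv_convex {α β : ℝ} (hα0 : 0 < α) (hα : 2 * α - 1 = 0 ∨ 1 ≤ 2 * α - 1) (hβ : 1 ≤ β) :
    ConvexOn ℝ (Set.Ici 0) (fun t => (rSurv α β t)⁻¹) := by
  have hβ0 : 0 < β := by linarith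
  have hp := rSurv_pos hα0 hβ0
  refine convexOn_of_hasDerivWithinAt2_nonneg (convex_Ici 0)
    (f' := fun t => -(-rDens α β t) / rSurv α β t ^ 2)
    (f'' := fun t => (-(-(-(rU α β t * rDens α β t))) * rSurv α β t ^ 2 -
      -(-rDens α β t) * ((2:ℕ) * rSurv α β t ^ (2 - 1) * -rDens α β t)) / (rSurv α β t ^ 2) ^ 2)
    ((rSurv_continuousOn hα0 hβ0).inv₀ (fun t => (hp t).ne')).continuousOn ?_ ?_ ?_
  · intro t ht
    rw [interior_Ici] at ht ⊢
    exact ((rSurv_hasDerivAt hα0 hβ0 ht).inv (hp t).ne').hasDerivWithinAt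
  · intro t ht
    rw [interior_Ici] at ht ⊢
    have h1 := rSurv_hasDerivAt hα0 hβ0 ht
    have h2 := rDens_hasDerivAt (α := α) (β := β) ht
    exact (h2.fun_neg.fun_neg.fun_div (h1.fun_pow 2) (pow_ne_zero 2 (hp t).ne')).hasDerivWithinAt
  · intro t ht
    rw [interior_Ici] at ht
    have hf := rDens_pos hα0 hβ0 ht
    have hpt := hp t
    have hkey : rU α β t * rSurv α β t ≤ 2 * rDens α β t := by
      rcases le_or_gt (rU α β t) 0 with h | h
      · nlinarith
      · have := rSurv_le hα0 hα hβ ht h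
        rw [le_div_iff₀ h] at this
        linarith
    apply div_nonneg _ (by positivity)
    have : (-(-(-(rU α β t * rDens α β t))) * rSurv α β t ^ 2 -
      -(-rDens α β t) * ((2:ℕ) * rSurv α β t ^ (2 - 1) * -rDens α β t)) =
      rDens α β t * rSurv α β t * (2 * rDens α β t - rU α β t * rSurv α β t) := by
      push_cast
      simp only [pow_one]
      ring
    rw [this]
    exact mul_nonneg (by positivity) (by linarith)

lemma hotelling_eq (d k : ℕ) (hd : 1 ≤ d) (hk : d + 1 ≤ k) (q : ℝ) (hq : 0 ≤ q) :
    hotellingCDF d k q = bpCDF ((d : ℝ) / 2) (((k : ℝ) + 1 - d) / 2) (q / k) := by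
  have hd0 : (0 : ℝ) < d := by exact_mod_cast hd
  have hk' : (d : ℝ) + 1 ≤ k := by exact_mod_cast hk
  have hk0 : (0 : ℝ) < k := by linarith
  have hkd : (0 : ℝ) < (k : ℝ) + 1 - d := by linarith
  set c : ℝ := (d : ℝ) / ((k : ℝ) + 1 - d) with hc
  have hc0 : 0 < c := by positivity
  have hub : 0 ≤ q * ((k : ℝ) + 1 - (d : ℝ)) / ((d : ℝ) * (k : ℝ)) := by positivity
  unfold hotellingCDF
  rw [if_neg (not_lt.2 hq)]
  have e1 : q / k = c * (q * ((k : ℝ) + 1 - (d : ℝ)) / ((d : ℝ) * (k : ℝ))) := by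
    rw [hc]; field_simp
  have e2 := intervalIntegral.mul_integral_comp_mul_left (a := 0)
    (b := q * ((k : ℝ) + 1 - (d : ℝ)) / ((d : ℝ) * (k : ℝ)))
    (f := bpDens ((d : ℝ) / 2) (((k : ℝ) + 1 - d) / 2)) (c := c)
  rw [mul_zero] at e2
  rw [bpCDF, e1, ← e2, ← intervalIntegral.integral_const_mul]
  apply intervalIntegral.integral_congr
  intro x hx
  rw [Set.uIcc_of_le hub] at hx
  have hx0 : 0 ≤ x := hx.1
  simp only [bpDens, ProbabilityTheory.beta]
  rw [Real.mul_rpow hc0.le hx0, Real.rpow_sub_one hc0.ne']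
  have e3 : (d : ℝ) * x / ((k : ℝ) + 1 - d) = c * x := by rw [hc]; ring
  have e4 : (d : ℝ) / 2 + ((k : ℝ) + 1 - d) / 2 = ((k : ℝ) + 1) / 2 := by ring
  rw [e3, e4, one_div_div]
  field_simp
  rw [← hc, mul_comm]

open scoped MatrixOrder in
lemma posDef_factor {n : ℕ} (M : Matrix (Fin n) (Fin n) ℝ) (hM : M.PosDef) :
    ∃ L : Matrix (Fin n) (Fin n) ℝ, IsUnit L ∧
      ∀ x : Fin n → ℝ, x ⬝ᵥ M.mulVec x = ‖WithLp.toLp 2 (L.mulVec x)‖ ^ 2 := by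
  obtain ⟨L, hL⟩ := CStarAlgebra.nonneg_iff_eq_star_mul_self.mp hM.posSemidef.nonneg
  refine ⟨L, ?_, ?_⟩
  · have h := hM.isUnit
    rw [hL, Matrix.isUnit_iff_isUnit_det, Matrix.det_mul] at h
    rw [Matrix.isUnit_iff_isUnit_det]
    exact isUnit_of_mul_isUnit_right h
  · intro x
    rw [EuclideanSpace.real_norm_sq_eq, hL, ← Matrix.mulVec_mulVec, Matrix.dotProduct_mulVec,
      Matrix.star_eq_conjTranspose, Matrix.conjTranspose_eq_transpose_of_trivial,
      Matrix.vecMul_transpose]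
    simp [dotProduct, sq]

/-- The transformed radius function attached to one data source. -/
noncomputable def radius {n d : ℕ} (L : Matrix (Fin n) (Fin n) ℝ) (P : Matrix (Fin n) (Fin d) ℝ)
    (ξ : Fin n → ℝ) (k : ℕ) (θ : Fin d → ℝ) : ℝ :=
  ‖WithLp.toLp 2 (L.mulVec (ξ - P.mulVec θ))‖ / √k

lemma radius_nonneg {n d : ℕ} (L : Matrix (Fin n) (Fin n) ℝ) (P : Matrix (Fin n) (Fin d) ℝ)
    (ξ : Fin n → ℝ) (k : ℕ) (θ : Fin d → ℝ) : 0 ≤ radius L P ξ k θ := by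
  unfold radius; positivity

lemma radius_convex {n d : ℕ} (L : Matrix (Fin n) (Fin n) ℝ) (P : Matrix (Fin n) (Fin d) ℝ)
    (ξ : Fin n → ℝ) (k : ℕ) (x y : Fin d → ℝ) (a b : ℝ) (ha : 0 ≤ a) (hb : 0 ≤ b)
    (hab : a + b = 1) :
    radius L P ξ k (a • x + b • y) ≤ a * radius L P ξ k x + b * radius L P ξ k y := by
  unfold radius
  have h : WithLp.toLp 2 (L.mulVec (ξ - P.mulVec (a • x + b • y))) =
      a • WithLp.toLp 2 (L.mulVec (ξ - P.mulVec x)) +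
      b • WithLp.toLp 2 (L.mulVec (ξ - P.mulVec y)) := by
    rw [← WithLp.toLp_smul, ← WithLp.toLp_smul, ← WithLp.toLp_add]
    congr 1
    rw [← Matrix.mulVec_smul, ← Matrix.mulVec_smul, ← Matrix.mulVec_add]
    congr 1
    rw [Matrix.mulVec_add, Matrix.mulVec_smul, Matrix.mulVec_smul]
    have hξ : ξ = a • ξ + b • ξ := by rw [← add_smul, hab, one_smul]
    conv_lhs => rw [hξ]
    module
  rw [h, ← mul_div_assoc, ← mul_div_assoc, ← add_div]
  gcongr
  refine (norm_add_le _ _).trans ?_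
  rw [norm_smul, norm_smul, Real.norm_of_nonneg ha, Real.norm_of_nonneg hb]

lemma term_convex {α β : ℝ} (hα0 : 0 < α) (hα : 2 * α - 1 = 0 ∨ 1 ≤ 2 * α - 1) (hβ : 1 ≤ β)
    {n d : ℕ} (L : Matrix (Fin n) (Fin n) ℝ) (P : Matrix (Fin n) (Fin d) ℝ)
    (ξ : Fin n → ℝ) (k : ℕ) :
    ConvexOn ℝ Set.univ (fun θ : Fin d → ℝ => (rSurv α β (radius L P ξ k θ))⁻¹) := by
  refine ⟨convex_univ, ?_⟩
  intro x _ y _ a b ha hb hab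
  have h1 := radius_convex L P ξ k x y a b ha hb hab
  have hx := radius_nonneg L P ξ k x
  have hy := radius_nonneg L P ξ k y
  have h2 := (rInv_convex hα0 hα hβ).2 (Set.mem_Ici.2 hx) (Set.mem_Ici.2 hy) ha hb hab
  refine le_trans ?_ h2
  have hβ0 : 0 < β := by linarith
  have hmem : (0:ℝ) ≤ a * radius L P ξ k x + b * radius L P ξ k y := by positivity
  have h3 := rSurv_antitone hα0 hβ0 (radius_nonneg L P ξ k (a • x + b • y)) hmem h1
  simp only [smul_eq_mul]
  exact inv_anti₀ (rSurv_pos hα0 hβ0 _) h3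

lemma radius_bound {α β : ℝ} (hα0 : 0 < α) (hβ : 0 < β) (C : ℝ) :
    ∃ R : ℝ, ∀ t : ℝ, (rSurv α β t)⁻¹ ≤ C → t ≤ R := by
  have h : Filter.Tendsto (fun t => (rSurv α β t)⁻¹) Filter.atTop Filter.atTop := by
    apply Filter.Tendsto.inv_tendsto_nhdsGT_zero
    rw [tendsto_nhdsWithin_iff]
    exact ⟨rSurv_tendsto hα0 hβ, Filter.Eventually.of_forall (fun t => rSurv_pos hα0 hβ t)⟩
  obtain ⟨R, hR⟩ := Filter.eventually_atTop.1 (h.eventually_gt_atTop C)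
  refine ⟨R, fun t ht => ?_⟩
  by_contra hlt
  exact absurd (hR t (le_of_not_ge hlt)) (not_lt.2 ht)

lemma row_bound {n d : ℕ} (L : Matrix (Fin n) (Fin n) ℝ) (hL : IsUnit L)
    (P : Matrix (Fin n) (Fin d) ℝ)
    (ξ : Fin n → ℝ) (k : ℕ) (hk : 0 < k) (R : ℝ) (i : Fin n) :
    ∃ K : ℝ, ∀ θ : Fin d → ℝ, radius L P ξ k θ ≤ R → |P i ⬝ᵥ θ| ≤ K := by
  have hk0 : 0 < √(k:ℝ) := Real.sqrt_pos.2 (by exact_mod_cast hk)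
  refine ⟨|ξ i| + ∑ l, |L⁻¹ i l| * (R * √k), fun θ hθ => ?_⟩
  unfold radius at hθ
  rw [div_le_iff₀ hk0] at hθ
  set y := L.mulVec (ξ - P.mulVec θ) with hy
  have h1 : ∀ l, |y l| ≤ R * √k := fun l =>
    (PiLp.norm_apply_le (WithLp.toLp 2 y) l).trans hθ
  have h2 : ξ - P.mulVec θ = L⁻¹.mulVec y := by
    rw [hy, Matrix.mulVec_mulVec, Matrix.nonsing_inv_mul _ ((Matrix.isUnit_iff_isUnit_det L).1 hL),
      Matrix.one_mulVec]
  have h3 : P i ⬝ᵥ θ = ξ i - ∑ l, L⁻¹ i l * y l := by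
    have := congrFun h2 i
    simp only [Pi.sub_apply, Matrix.mulVec, dotProduct] at this
    simp only [dotProduct]
    linarith
  rw [h3]
  refine (abs_sub _ _).trans ?_
  gcongr
  refine (Finset.abs_sum_le_sum_abs _ _).trans ?_
  refine Finset.sum_le_sum (fun l _ => ?_)
  rw [abs_mul]
  exact mul_le_mul_of_nonneg_left (h1 l) (abs_nonneg _)

lemma bounded_of_span {d : ℕ} (T : Set (Fin d → ℝ)) (V : Set (Fin d → ℝ))
    (hV : Submodule.span ℝ V = ⊤) (h : ∀ v ∈ V, ∃ K : ℝ, ∀ θ ∈ T, |v ⬝ᵥ θ| ≤ K) :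
    Bornology.IsBounded T := by
  have h2 : ∀ v : Fin d → ℝ, ∃ K : ℝ, ∀ θ ∈ T, |v ⬝ᵥ θ| ≤ K := by
    intro v
    have hv : v ∈ Submodule.span ℝ V := by rw [hV]; trivial
    induction hv using Submodule.span_induction with
    | mem x hx => exact h x hx
    | zero => exact ⟨0, fun θ _ => by simp⟩
    | add x y _ _ hx hy =>
      obtain ⟨A, hA⟩ := hx
      obtain ⟨B, hB⟩ := hy
      refine ⟨A + B, fun θ hθ => ?_⟩
      rw [add_dotProduct]
      exact (abs_add_le _ _).trans (add_le_add (hA θ hθ) (hB θ hθ))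
    | smul a x _ hx =>
      obtain ⟨A, hA⟩ := hx
      refine ⟨|a| * A, fun θ hθ => ?_⟩
      rw [smul_dotProduct, smul_eq_mul, abs_mul]
      exact mul_le_mul_of_nonneg_left (hA θ hθ) (abs_nonneg _)
  choose K hK using fun i : Fin d => h2 (Pi.single i 1)
  rw [isBounded_iff_forall_norm_le]
  refine ⟨∑ i, |K i|, fun θ hθ => ?_⟩
  rw [pi_norm_le_iff_of_nonneg (by positivity)]
  intro i
  have h3 := hK i θ hθ
  rw [single_one_dotProduct] at h3
  exact (h3.trans (le_abs_self _)).trans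
    (Finset.single_le_sum (f := fun i => |K i|) (fun _ _ => abs_nonneg _) (Finset.mem_univ i))

/-- Theorem 2.2 (EHMP case): the sublevel sets of the multivariate exact harmonic mean p-value
score are convex; and bounded when the rows of the design matrices with positive weight
span `ℝ^d`. -/
theorem multivariate_ehmp_convex_bounded
    (d m : ℕ) (hd : 1 ≤ d) (hm : 1 ≤ m)
    (d' : Fin m → ℕ) (hd'1 : ∀ j, 1 ≤ d' j) (hd'2 : ∀ j, d' j ≤ d)
    (k : Fin m → ℕ) (hk : ∀ j, d' j + 1 ≤ k j)
    (P : (j : Fin m) → Matrix (Fin (d' j)) (Fin d) ℝ)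
    (hrank : ∀ j, (P j).rank = d' j)
    (ξ : (j : Fin m) → Fin (d' j) → ℝ)
    (Sig : (j : Fin m) → Matrix (Fin (d' j)) (Fin (d' j)) ℝ)
    (hSig : ∀ j, (Sig j).PosDef)
    (w : Fin m → ℝ) (hw : ∀ j, 0 ≤ w j) (hwsum : ∑ j, w j = 1) (c : ℝ) :
    Convex ℝ {θ : Fin d → ℝ | ∑ j, w j /
        (1 - hotellingCDF (d' j) (k j)
          ((ξ j - (P j).mulVec θ) ⬝ᵥ ((Sig j)⁻¹).mulVec (ξ j - (P j).mulVec θ))) ≤ c} ∧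
      (Submodule.span ℝ {v : Fin d → ℝ | ∃ j, 0 < w j ∧ ∃ i, v = (P j) i} = ⊤ →
        Bornology.IsBounded {θ : Fin d → ℝ | ∑ j, w j /
          (1 - hotellingCDF (d' j) (k j)
            ((ξ j - (P j).mulVec θ) ⬝ᵥ ((Sig j)⁻¹).mulVec (ξ j - (P j).mulVec θ))) ≤ c}) := by
  have hd0 : ∀ j, (1 : ℝ) ≤ d' j := fun j => by exact_mod_cast hd'1 j
  have hk' : ∀ j, (d' j : ℝ) + 1 ≤ k j := fun j => by exact_mod_cast hk j
  have hα0 : ∀ j, 0 < (d' j : ℝ) / 2 := fun j => by linarith [hd0 j]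
  have hα : ∀ j, 2 * ((d' j : ℝ) / 2) - 1 = 0 ∨ 1 ≤ 2 * ((d' j : ℝ) / 2) - 1 := by
    intro j
    rcases Nat.eq_or_lt_of_le (hd'1 j) with h | h
    · left
      rw [← h]; norm_num
    · right
      have : (2 : ℝ) ≤ d' j := by exact_mod_cast h
      linarith
  have hβ : ∀ j, 1 ≤ ((k j : ℝ) + 1 - d' j) / 2 := fun j => by linarith [hk' j]
  have hβ0 : ∀ j, 0 < ((k j : ℝ) + 1 - d' j) / 2 := fun j => by linarith [hk' j]
  choose L hLu hLq using fun j => posDef_factor (Sig j)⁻¹ (hSig j).inv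
  have hterm : ∀ (j : Fin m) (θ : Fin d → ℝ), w j / (1 - hotellingCDF (d' j) (k j)
      ((ξ j - (P j).mulVec θ) ⬝ᵥ ((Sig j)⁻¹).mulVec (ξ j - (P j).mulVec θ))) =
      w j * (rSurv ((d' j : ℝ) / 2) (((k j : ℝ) + 1 - d' j) / 2)
        (radius (L j) (P j) (ξ j) (k j) θ))⁻¹ := by
    intro j θ
    rw [hLq, hotelling_eq _ _ (hd'1 j) (hk j) _ (by positivity), rSurv, radius, div_pow,
      Real.sq_sqrt (by positivity), div_eq_mul_inv]
  simp only [hterm]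
  constructor
  · have hconv : ConvexOn ℝ Set.univ (fun θ : Fin d → ℝ => ∑ j, w j *
        (rSurv ((d' j : ℝ) / 2) (((k j : ℝ) + 1 - d' j) / 2)
          (radius (L j) (P j) (ξ j) (k j) θ))⁻¹) := by
      refine ⟨convex_univ, ?_⟩
      intro x _ y _ a b ha hb hab
      simp only [smul_eq_mul]
      rw [Finset.mul_sum, Finset.mul_sum, ← Finset.sum_add_distrib]
      refine Finset.sum_le_sum (fun j _ => ?_)
      have h := (term_convex (hα0 j) (hα j) (hβ j) (L j) (P j) (ξ j) (k j)).2
        (Set.mem_univ x) (Set.mem_univ y) ha hb hab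
      simp only [smul_eq_mul] at h
      have h2 := mul_le_mul_of_nonneg_left h (hw j)
      linarith
    have h := hconv.convex_le c
    simpa using h
  · intro hspan
    refine bounded_of_span _ _ hspan ?_
    rintro v ⟨j, hwj, i, rfl⟩
    obtain ⟨R, hR⟩ := radius_bound (hα0 j) (hβ0 j) (c / w j)
    obtain ⟨K, hK⟩ := row_bound (L j) (hLu j) (P j) (ξ j) (k j)
      (by have := hk j; omega) R i
    refine ⟨K, fun θ hθ => hK θ (hR _ ?_)⟩
    rw [le_div_iff₀ hwj, mul_comm]
    refine le_trans ?_ hθ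
    exact Finset.single_le_sum (f := fun j => w j *
        (rSurv ((d' j : ℝ) / 2) (((k j : ℝ) + 1 - d' j) / 2)
          (radius (L j) (P j) (ξ j) (k j) θ))⁻¹)
      (fun l _ => mul_nonneg (hw l) (inv_nonneg.2 (rSurv_pos (hα0 l) (hβ0 l) _).le))
      (Finset.mem_univ j)
end

section
/- Let m ≥ 1 and let p_1,…,p_m be random variables on a common probability space, each uniformly distributed on the interval [0,1], and let w_1,…,w_m > 0 with ∑_{j=1}^m w_j = 1. Suppose there exists a function t ↦ δ_t from (0,∞) to (0,∞) with δ_t → 0 and t·δ_t → ∞ as t → ∞ such that for all i ≠ j, t · P( p_i < 2 w_i m/(π t) and p_j < 2 w_j m/(π δ_t t) ) → 0 as t → ∞. Then lim_{t→∞} P(∑_{j=1}^m w_j cot(π p_j/2) > t) / (1 − (2/π) arctan t) = 1. -/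
open MeasureTheory Real Filter

lemma aux_tendsto_arctan (w : ℝ) :
    Tendsto (fun t : ℝ => t * Real.arctan (w / t)) atTop (nhds w) := by
  have h : HasDerivAt (fun y : ℝ => Real.arctan (w * y)) w 0 := by
    have h1 : HasDerivAt (fun y : ℝ => w * y) w 0 := by
      simpa using (hasDerivAt_id (0:ℝ)).const_mul w
    simpa using h1.arctan
  have h2 := h.tendsto_slope_zero_right.comp tendsto_inv_atTop_nhdsGT_zero
  refine h2.congr fun t => ?_
  simp [div_eq_mul_inv]

lemma aux_tail : Tendsto (fun t : ℝ => t * (1 - (2 / π) * Real.arctan t)) atTop (nhds (2 / π)) := by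
  have h := (aux_tendsto_arctan 1).const_mul (2 / π)
  rw [mul_one] at h
  refine h.congr' ?_
  filter_upwards [eventually_gt_atTop 0] with t ht
  have := Real.arctan_inv_of_pos ht
  rw [one_div, this]
  field_simp

lemma aux_arctan_le {x : ℝ} (hx : 0 ≤ x) : Real.arctan x ≤ x := by
  have h0 : 0 ≤ Real.arctan x := Real.arctan_nonneg.2 hx
  have := Real.le_tan h0 (Real.arctan_lt_pi_div_two x)
  rwa [Real.tan_arctan] at this

lemma aux_cot_eq (x : ℝ) : Real.cot x = (Real.tan x)⁻¹ := by
  rw [Real.cot_eq_cos_div_sin, Real.tan_eq_sin_div_cos, inv_div]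

/-- `w cot(πp/2) > s` forces `p` small. -/
lemma aux_upper {p w s : ℝ} (hp0 : 0 < p) (hp1 : p < 1) (hw : 0 < w) (hs : 0 < s)
    (h : s < w * Real.cot (π * p / 2)) : p < 2 * w / (π * s) := by
  have hπ := Real.pi_pos
  have hx0 : 0 < π * p / 2 := by positivity
  have hx1 : π * p / 2 < π / 2 := by nlinarith
  have ht := Real.lt_tan hx0 hx1
  have hc : Real.cot (π * p / 2) < (π * p / 2)⁻¹ := by
    rw [aux_cot_eq]
    exact inv_strictAnti₀ hx0 ht
  have h2 : s < w * (π * p / 2)⁻¹ := h.trans (mul_lt_mul_of_pos_left hc hw)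
  rw [← div_eq_mul_inv, lt_div_iff₀ hx0] at h2
  rw [lt_div_iff₀ (by positivity)]
  linarith

lemma aux_lower {p w s : ℝ} (hp0 : 0 < p) (hw : 0 < w) (hs : 0 < s)
    (h : p < 2 / π * Real.arctan (w / s)) : s < w * Real.cot (π * p / 2) := by
  have hπ := Real.pi_pos
  have hx0 : 0 < π * p / 2 := by positivity
  have hx : π * p / 2 < Real.arctan (w / s) := by
    have := mul_lt_mul_of_pos_left h (by positivity : 0 < π / 2)
    have e : π / 2 * (2 / π * Real.arctan (w / s)) = Real.arctan (w / s) := by field_simp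
    rw [e] at this
    linarith
  have hx1 := hx.trans (Real.arctan_lt_pi_div_two _)
  have ht : Real.tan (π * p / 2) < w / s := by
    have := Real.tan_lt_tan_of_lt_of_lt_pi_div_two (by linarith) (Real.arctan_lt_pi_div_two _) hx
    rwa [Real.tan_arctan] at this
  have ht0 := Real.tan_pos_of_pos_of_lt_pi_div_two hx0 hx1
  rw [aux_cot_eq, ← div_eq_mul_inv, lt_div_iff₀ ht0]
  rw [lt_div_iff₀ hs] at ht
  linarith

lemma aux_cot_nonneg {p : ℝ} (hp0 : 0 < p) (hp1 : p < 1) : 0 ≤ Real.cot (π * p / 2) := by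
  have hπ := Real.pi_pos
  rw [aux_cot_eq]
  exact inv_nonneg.2
    (Real.tan_pos_of_pos_of_lt_pi_div_two (by positivity) (by nlinarith)).le

section unif
variable {Ω : Type*} [MeasurableSpace Ω] {P : Measure Ω} [IsProbabilityMeasure P]
  {p : Ω → ℝ}

lemma aux_unif_le (hm : Measurable p)
    (hu : Measure.map p P = volume.restrict (Set.Icc (0:ℝ) 1)) {c : ℝ} (hc : 0 ≤ c) :
    P.real {ω | p ω < c} ≤ c := by
  have h : P {ω | p ω < c} = volume.restrict (Set.Icc (0:ℝ) 1) (Set.Iio c) := by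
    rw [← hu, Measure.map_apply hm measurableSet_Iio]; rfl
  rw [measureReal_def, h, Measure.restrict_apply measurableSet_Iio]
  refine ENNReal.toReal_le_of_le_ofReal hc ?_
  calc volume (Set.Iio c ∩ Set.Icc (0:ℝ) 1) ≤ volume (Set.Icc 0 c) :=
        measure_mono fun x hx => ⟨hx.2.1, hx.1.le⟩
    _ = ENNReal.ofReal c := by simp

lemma aux_unif_eq (hm : Measurable p)
    (hu : Measure.map p P = volume.restrict (Set.Icc (0:ℝ) 1)) {c : ℝ} (hc : 0 ≤ c) (hc1 : c ≤ 1) :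
    P.real {ω | 0 < p ω ∧ p ω < c} = c := by
  have h : P {ω | 0 < p ω ∧ p ω < c} = volume.restrict (Set.Icc (0:ℝ) 1) (Set.Ioo 0 c) := by
    rw [← hu, Measure.map_apply hm measurableSet_Ioo]; rfl
  rw [measureReal_def, h, Measure.restrict_apply measurableSet_Ioo,
    Set.inter_eq_left.2 (show Set.Ioo 0 c ⊆ Set.Icc (0:ℝ) 1 from
      fun x hx => ⟨hx.1.le, hx.2.le.trans hc1⟩)]
  simp [hc]

lemma aux_unif_ae (hm : Measurable p)
    (hu : Measure.map p P = volume.restrict (Set.Icc (0:ℝ) 1)) :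
    ∀ᵐ ω ∂P, 0 < p ω ∧ p ω < 1 := by
  have h : ∀ᵐ x ∂(Measure.map p P), x ∈ Set.Ioo (0:ℝ) 1 := by
    rw [hu, ← Measure.restrict_congr_set Ioo_ae_eq_Icc]
    exact ae_restrict_mem measurableSet_Ioo
  exact ae_of_ae_map hm.aemeasurable h

/-- A Bonferroni-type lower bound. -/
lemma aux_bonf {ι : Type*} [Fintype ι] (B : ι → Set Ω) (hB : ∀ i, MeasurableSet (B i))
    (E : ι → ι → Set Ω) (hE : ∀ i j, i ≠ j → B i ∩ B j ⊆ E i j) :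
    ∑ i, P.real (B i) ≤ P.real (⋃ i, B i) + ∑ i, ∑ j, P.real (E i j) := by
  classical
  let C : ι → Set Ω := fun i => B i \ ⋃ j, ⋃ (_ : j ≠ i), B j
  have hC : ∀ i, MeasurableSet (C i) := fun i =>
    (hB i).diff (MeasurableSet.iUnion fun j => MeasurableSet.iUnion fun _ => hB j)
  have hd : Pairwise (Function.onFun Disjoint C) := by
    intro i j hij
    refine Set.disjoint_left.2 fun x hx hx' => hx'.2 ?_
    exact Set.mem_iUnion₂.2 ⟨i, hij, hx.1⟩
  have h1 : ∑ i, P.real (C i) ≤ P.real (⋃ i, B i) := by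
    rw [← measureReal_iUnion_fintype hd hC]
    exact measureReal_mono (Set.iUnion_mono fun i => Set.sdiff_subset)
  have h2 : ∀ i, P.real (B i) ≤ P.real (C i) + ∑ j, P.real (E i j) := by
    intro i
    have : B i ⊆ C i ∪ ⋃ j, E i j := by
      intro x hx
      by_cases h : x ∈ ⋃ j, ⋃ (_ : j ≠ i), B j
      · obtain ⟨j, hj, hxj⟩ := Set.mem_iUnion₂.1 h
        exact Or.inr (Set.mem_iUnion.2 ⟨j, hE i j hj.symm ⟨hx, hxj⟩⟩)
      · exact Or.inl ⟨hx, h⟩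
    calc P.real (B i) ≤ P.real (C i ∪ ⋃ j, E i j) := measureReal_mono this
      _ ≤ P.real (C i) + P.real (⋃ j, E i j) := measureReal_union_le _ _
      _ ≤ _ := by gcongr; exact measureReal_iUnion_fintype_le _
  calc ∑ i, P.real (B i) ≤ ∑ i, (P.real (C i) + ∑ j, P.real (E i j)) :=
        Finset.sum_le_sum fun i _ => h2 i
    _ = ∑ i, P.real (C i) + ∑ i, ∑ j, P.real (E i j) := Finset.sum_add_distrib
    _ ≤ _ := by gcongr

end unif

/-- If a sum exceeds `t`, then one term is above `(1-d)t`, or two terms are fairly large. -/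
lemma aux_split {m : ℕ} (hm : 1 ≤ m) (x : Fin m → ℝ) {t d : ℝ} (ht : 0 < t) (hd : 0 < d)
    (h : t < ∑ j, x j) :
    (∃ j, (1 - d) * t < x j) ∨ ∃ i j, i ≠ j ∧ t / m < x i ∧ d * t / m < x j := by
  have hm0 : (0:ℝ) < m := by exact_mod_cast hm
  by_contra! hcon
  obtain ⟨h1, h2⟩ := hcon
  have : ∃ i, t / m < x i := by
    by_contra! h3
    have := Finset.sum_le_sum fun i (_ : i ∈ Finset.univ) => h3 i
    simp only [Finset.sum_const, Finset.card_univ, Fintype.card_fin, nsmul_eq_mul] at this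
    rw [mul_div_cancel₀ _ hm0.ne'] at this
    linarith
  obtain ⟨i, hi⟩ := this
  have h4 : ∑ j ∈ Finset.univ.erase i, x j ≤ d * t := by
    calc ∑ j ∈ Finset.univ.erase i, x j ≤ ∑ j ∈ Finset.univ.erase i, d * t / m :=
          Finset.sum_le_sum fun j hj => h2 i j (Finset.ne_of_mem_erase hj).symm hi
      _ ≤ ∑ j : Fin m, d * t / m :=
          Finset.sum_le_sum_of_subset_of_nonneg (Finset.erase_subset _ _)
            fun _ _ _ => by positivity
      _ = d * t := by
          simp only [Finset.sum_const, Finset.card_univ, Fintype.card_fin, nsmul_eq_mul]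
          rw [mul_div_cancel₀ _ hm0.ne']
  have h5 := Finset.add_sum_erase Finset.univ x (Finset.mem_univ i)
  have := h1 i
  linarith


/-- Theorem 5.4 (fixed-m HCCT case): under weak pairwise tail dependence, the tail probability of
the Half-Cauchy combination statistic is asymptotically the standard Half-Cauchy tail. -/
theorem hcct_tail_validity
    (m : ℕ) (hm : 1 ≤ m)
    (Ω : Type*) [MeasurableSpace Ω] (P : Measure Ω) [IsProbabilityMeasure P]
    (p : Fin m → Ω → ℝ) (hmeas : ∀ j, Measurable (p j))
    (hunif : ∀ j, Measure.map (p j) P = volume.restrict (Set.Icc (0:ℝ) 1))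
    (w : Fin m → ℝ) (hw : ∀ j, 0 < w j) (hwsum : ∑ j, w j = 1)
    (δ : ℝ → ℝ) (hδpos : ∀ t > (0:ℝ), 0 < δ t)
    (hδ0 : Tendsto δ atTop (nhds 0))
    (hδt : Tendsto (fun t => t * δ t) atTop atTop)
    (hpair : ∀ i j, i ≠ j →
      Tendsto (fun t => t *
          (P {ω | p i ω < 2 * w i * m / (π * t) ∧
              p j ω < 2 * w j * m / (π * δ t * t)}).toReal)
        atTop (nhds 0)) :
    Tendsto (fun t =>
        (P {ω | t < ∑ j, w j * Real.cot (π * p j ω / 2)}).toReal /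
          (1 - (2 / π) * Real.arctan t))
      atTop (nhds 1) := by
  have hπ := Real.pi_pos
  have hm1 : (1:ℝ) ≤ m := by exact_mod_cast hm
  have hae : ∀ᵐ ω ∂P, ∀ j, 0 < p j ω ∧ p j ω < 1 :=
    ae_all_iff.2 fun j => aux_unif_ae (hmeas j) (hunif j)
  let E : ℝ → Fin m → Fin m → Set Ω := fun t i j =>
    {ω | i ≠ j ∧ p i ω < 2 * w i * m / (π * t) ∧ p j ω < 2 * w j * m / (π * δ t * t)}
  let R : ℝ → ℝ := fun t => ∑ i, ∑ j, P.real (E t i j)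
  let F : ℝ → ℝ := fun t => P.real {ω | t < ∑ j, w j * Real.cot (π * p j ω / 2)}
  have hR : Tendsto (fun t => t * R t) atTop (nhds 0) := by
    have : Tendsto (fun t => ∑ i, ∑ j, t * P.real (E t i j)) atTop
        (nhds (∑ i : Fin m, ∑ j : Fin m, (0:ℝ))) := by
      refine tendsto_finsetSum _ fun i _ => tendsto_finsetSum _ fun j _ => ?_
      by_cases hij : i = j
      · simp [E, hij]
      · simpa [E, hij, measureReal_def] using hpair i j hij
    simpa [R, Finset.mul_sum] using this
  have hup : ∀ᶠ t in atTop, t * F t ≤ 2 / π * (1 - δ t)⁻¹ + t * R t := by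
    filter_upwards [eventually_gt_atTop 0, hδ0.eventually_lt_const zero_lt_one] with t ht hδ1
    have hd := hδpos t ht
    have h1d : 0 < 1 - δ t := by linarith
    have hsub : F t ≤ P.real ((⋃ j, {ω | p j ω < 2 * w j / (π * ((1 - δ t) * t))}) ∪
        ⋃ i, ⋃ j, E t i j) := by
      refine ENNReal.toReal_mono (measure_ne_top _ _) (measure_mono_ae ?_)
      filter_upwards [hae] with ω hω hS
      rcases aux_split hm _ ht hd hS with ⟨j, hj⟩ | ⟨i, j, hij, hi, hj⟩
      · refine Or.inl (Set.mem_iUnion.2 ⟨j, ?_⟩)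
        exact aux_upper (hω j).1 (hω j).2 (hw j) (by positivity) hj
      · refine Or.inr (Set.mem_iUnion₂.2 ⟨i, j, hij, ?_, ?_⟩)
        · have := aux_upper (hω i).1 (hω i).2 (hw i) (by positivity) hi
          refine this.trans_eq ?_
          field_simp
        · have := aux_upper (hω j).1 (hω j).2 (hw j) (by positivity) hj
          refine this.trans_eq ?_
          field_simp
    have hF : F t ≤ ∑ j, 2 * w j / (π * ((1 - δ t) * t)) + R t := by
      refine hsub.trans ((measureReal_union_le _ _).trans (add_le_add ?_ ?_))
      · refine (measureReal_iUnion_fintype_le _).trans (Finset.sum_le_sum fun j _ => ?_)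
        have := hw j
        exact aux_unif_le (hmeas j) (hunif j) (by positivity)
      · exact (measureReal_iUnion_fintype_le _).trans
          (Finset.sum_le_sum fun i _ => measureReal_iUnion_fintype_le _)
    rw [← Finset.sum_div, ← Finset.mul_sum, hwsum] at hF
    calc t * F t ≤ t * (2 * 1 / (π * ((1 - δ t) * t)) + R t) := by gcongr
      _ = _ := by field_simp
  have hlow : ∀ᶠ t in atTop,
      ∑ j, 2 / π * (t * Real.arctan (w j / t)) - t * R t ≤ t * F t := by
    filter_upwards [eventually_gt_atTop 0, hδ0.eventually_lt_const zero_lt_one] with t ht hδ1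
    have hd := hδpos t ht
    let B : Fin m → Set Ω := fun j => {ω | 0 < p j ω ∧ p j ω < 2 / π * Real.arctan (w j / t)}
    have hBm : ∀ j, MeasurableSet (B j) := fun j => hmeas j measurableSet_Ioo
    have hat : ∀ j, 2 / π * Real.arctan (w j / t) ≤ 2 * w j / (π * t) := by
      intro j
      have := hw j
      calc 2 / π * Real.arctan (w j / t) ≤ 2 / π * (w j / t) := by
            gcongr; exact aux_arctan_le (by positivity)
        _ = _ := by field_simp
    have hb := aux_bonf (P := P) B hBm (E t) (by
      rintro i j hij ω ⟨hi, hj⟩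
      have := hw i
      have := hw j
      refine ⟨hij, (hi.2.trans_le (hat i)).trans_le ?_, (hj.2.trans_le (hat j)).trans_le ?_⟩
      · apply div_le_div_of_nonneg_right _ (by positivity)
        nlinarith
      · apply div_le_div₀ (by positivity) (by nlinarith) (by positivity)
        have : 0 < π * t := by positivity
        nlinarith)
    have hBv : ∀ j, P.real (B j) = 2 / π * Real.arctan (w j / t) := by
      intro j
      have := hw j
      have h0 : 0 ≤ Real.arctan (w j / t) := Real.arctan_nonneg.2 (by positivity)
      refine aux_unif_eq (hmeas j) (hunif j) (by positivity) ?_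
      have := Real.arctan_lt_pi_div_two (w j / t)
      rw [div_mul_eq_mul_div, div_le_one hπ]
      linarith
    have hU : P.real (⋃ j, B j) ≤ F t := by
      refine ENNReal.toReal_mono (measure_ne_top _ _) (measure_mono_ae ?_)
      filter_upwards [hae] with ω hω hS
      obtain ⟨j, hj⟩ := Set.mem_iUnion.1 hS
      refine (aux_lower hj.1 (hw j) ht hj.2).trans_le ?_
      exact Finset.single_le_sum (f := fun j => w j * Real.cot (π * p j ω / 2))
        (fun i _ => mul_nonneg (hw i).le (aux_cot_nonneg (hω i).1 (hω i).2)) (Finset.mem_univ j)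
    simp only [hBv] at hb
    have h3 : ∑ j, 2 / π * (t * Real.arctan (w j / t))
        = t * ∑ j, 2 / π * Real.arctan (w j / t) := by
      rw [Finset.mul_sum]
      exact Finset.sum_congr rfl fun j _ => by ring
    have h4 : t * ∑ j, 2 / π * Real.arctan (w j / t) ≤ t * (F t + R t) :=
      mul_le_mul_of_nonneg_left (hb.trans (add_le_add hU le_rfl)) ht.le
    rw [h3]
    linarith
  have hF : Tendsto (fun t => t * F t) atTop (nhds (2 / π)) := by
    refine tendsto_of_tendsto_of_tendsto_of_le_of_le' ?_ ?_ hlow hup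
    · have h := (tendsto_finsetSum Finset.univ fun j _ =>
        (aux_tendsto_arctan (w j)).const_mul (2 / π)).sub hR
      rwa [← Finset.mul_sum, hwsum, mul_one, sub_zero] at h
    · have h := (((hδ0.const_sub 1).inv₀ (by norm_num)).const_mul (2 / π)).add hR
      simpa using h
  have h := hF.div aux_tail (by positivity)
  rw [div_self (by positivity)] at h
  refine h.congr' ?_
  filter_upwards [eventually_gt_atTop 0] with t ht
  exact mul_div_mul_left _ _ ht.ne'
end
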